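/- Suppose that for all integers 1 ≤ ℓ ≤ L and 0 ≤ κ < ℓ one has min_{1≤j≤J} Υ(λ*_{m_j,r_j}(κ,ℓ))·gcd(m_j,ℓ)²/m_j ≥ Δ(κ,ℓ)/24. Then for every positive integer n with n > −Ω/24, g(n) = 2π·i^{δ_1+⋯+δ_J} · Σ_{(κ,ℓ)∈𝓛_{>0}} ((24n+Ω)/Δ(κ,ℓ))^{−1/2} · Σ_{k≥1, k≡ℓ (mod L)} (1/k)·I_{−1}((π/(6k))·√(Δ(κ,ℓ)(24n+Ω))) · Σ_{0≤h<k, gcd(h,k)=1, h≡κ (mod ℓ)} e^{−2πinh/k}·(−1)^{Σ_{j=1}^J δ_j λ_{m_j,r_j}(h,k)}·ω_{h,k}²·D_{h,k}·Π_{h,k}, where the series over k converges. -/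

import Mathlib

open Complex Finset

noncomputable section

/-- `λ_{m,r}(h,k) := ⌈rh/gcd(m,k)⌉` (with the convention `gcd(0,n) = n`). -/
def lamF (m r h k : ℕ) : ℤ := ⌈(r * h : ℚ) / (Nat.gcd m k : ℚ)⌉

/-- `λ*_{m,r}(h,k) := λ_{m,r}(h,k) − rh/gcd(m,k)`. -/
def lamStar (m r h k : ℕ) : ℚ := (lamF m r h k : ℚ) - (r * h : ℚ) / (Nat.gcd m k : ℚ)

/-- The sawtooth function `((x)) := x − ⌊x⌋ − 1/2` if `x ∉ ℤ`, and `0` if `x ∈ ℤ`. -/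
def saw (x : ℝ) : ℝ := if Int.fract x = 0 then 0 else Int.fract x - 1 / 2

/-- The Dedekind sum `s(d,c) := Σ_{n mod c} ((dn/c))·((n/c))`. -/
def dedekindSum (d c : ℕ) : ℝ :=
  ∑ n ∈ Finset.range c, saw ((d : ℝ) * (n : ℝ) / (c : ℝ)) * saw ((n : ℝ) / (c : ℝ))

/-- `Ω := Σ_j δ_j (2m_j − 12r_j + 12r_j²/m_j)`. -/
def OmegaC (J : ℕ) (m r : Fin J → ℕ) (δ : Fin J → ℤ) : ℝ :=
  ∑ j, (δ j : ℝ) * (2 * (m j : ℝ) - 12 * (r j : ℝ) + 12 * (r j : ℝ) ^ 2 / (m j : ℝ))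

/-- `Δ(h,k) := −Σ_j δ_j (2·gcd(m_j,k)²/m_j + (12·gcd(m_j,k)²/m_j)(λ*_j² − λ*_j))`. -/
def DeltaC (J : ℕ) (m r : Fin J → ℕ) (δ : Fin J → ℤ) (h k : ℕ) : ℝ :=
  - ∑ j, (δ j : ℝ) * (2 * (Nat.gcd (m j) k : ℝ) ^ 2 / (m j : ℝ) +
      12 * (Nat.gcd (m j) k : ℝ) ^ 2 / (m j : ℝ) *
        (((lamStar (m j) (r j) h k : ℚ) : ℝ) ^ 2 - ((lamStar (m j) (r j) h k : ℚ) : ℝ)))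

/-- `ω_{h,k} := exp(−πi Σ_j δ_j·s(m_j h/gcd(m_j,k), k/gcd(m_j,k)))`. -/
def omegaC (J : ℕ) (m : Fin J → ℕ) (δ : Fin J → ℤ) (h k : ℕ) : ℂ :=
  Complex.exp (-(Real.pi : ℂ) * Complex.I *
    ∑ j, (δ j : ℂ) *
      ((dedekindSum ((m j / Nat.gcd (m j) k) * h) (k / Nat.gcd (m j) k) : ℝ) : ℂ))

/-- The quantity `D_{h,k}`, computed from a choice `ℏ j` of the integers `ℏ_{m_j}(h,k)`. -/
def DC (J : ℕ) (m r : Fin J → ℕ) (δ : Fin J → ℤ) (ℏ : Fin J → ℤ) (h k : ℕ) : ℂ :=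
  Complex.exp ((Real.pi : ℂ) * Complex.I *
    ∑ j, (δ j : ℂ) * ((r j : ℂ) * (h : ℂ) / (k : ℂ) -
        (r j : ℂ) * (Nat.gcd (m j) k : ℂ) / ((m j : ℂ) * (k : ℂ)) +
        2 * (r j : ℂ) * (Nat.gcd (m j) k : ℂ) * ((lamStar (m j) (r j) h k : ℚ) : ℂ) /
          ((m j : ℂ) * (k : ℂ)) +
        (ℏ j : ℂ) * (Nat.gcd (m j) k : ℂ) / (k : ℂ) *
          ((lamF (m j) (r j) h k : ℂ) ^ 2 - (lamF (m j) (r j) h k : ℂ))))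

/-- The quantity `Π_{h,k}`, computed from a choice `ℏ j` of the integers `ℏ_{m_j}(h,k)`;
an empty product is `1`. -/
def PiC (J : ℕ) (m r : Fin J → ℕ) (δ : Fin J → ℤ) (ℏ : Fin J → ℤ) (h k : ℕ) : ℂ :=
  ∏ j ∈ Finset.univ.filter (fun j => lamStar (m j) (r j) h k = 0),
    (1 - Complex.exp (2 * (Real.pi : ℂ) * Complex.I *
      ((r j : ℂ) * (Nat.gcd (m j) k : ℂ) + (r j : ℂ) * (ℏ j : ℂ) * (m j : ℂ) * (h : ℂ)) /
      ((m j : ℂ) * (k : ℂ)))) ^ (δ j)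

/-- `Υ(x) := 1` if `x = 0`, `x` if `0 < x ≤ 1/2`, and `1 − x` if `1/2 < x < 1`. -/
def ups (x : ℚ) : ℚ := if x = 0 then 1 else if x ≤ 1 / 2 then x else 1 - x

/-- The modified Bessel function of the first kind of order `−1`:
`I_{−1}(x) := Σ_{k≥0} (x/2)^{2k+1}/(k!·(k+1)!)`. -/
def besselImin1 (x : ℝ) : ℝ :=
  ∑' k : ℕ, (x / 2) ^ (2 * k + 1) / ((Nat.factorial k : ℝ) * (Nat.factorial (k + 1) : ℝ))

/-- The inner sum over `0 ≤ h < k`, `gcd(h,k) = 1`, `h ≡ κ (mod ℓ)` of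
`e^{−2πinh/k}·(−1)^{Σ_j δ_j λ_{m_j,r_j}(h,k)}·ω_{h,k}²·D_{h,k}·Π_{h,k}`. -/
def innerH (J : ℕ) (m r : Fin J → ℕ) (δ : Fin J → ℤ) (ℏ : Fin J → ℕ → ℕ → ℤ)
    (n κ ℓ k : ℕ) : ℂ :=
  ∑ h ∈ Finset.range k,
    if Nat.gcd h k = 1 ∧ h % ℓ = κ % ℓ then
      Complex.exp (-2 * (Real.pi : ℂ) * Complex.I * (n : ℂ) * (h : ℂ) / (k : ℂ)) *
        (-1 : ℂ) ^ (∑ j, δ j * lamF (m j) (r j) h k) *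
        (omegaC J m δ h k) ^ 2 * DC J m r δ (fun j => ℏ j h k) h k *
        PiC J m r δ (fun j => ℏ j h k) h k
    else 0

/-- The term of the series over `k ≡ ℓ (mod L)`:
`(1/k)·I_{−1}((π/(6k))·√(Δ(κ,ℓ)(24n+Ω)))·(inner sum over h)`. -/
def kTerm (J : ℕ) (m r : Fin J → ℕ) (δ : Fin J → ℤ) (ℏ : Fin J → ℕ → ℕ → ℤ)
    (n κ ℓ k : ℕ) : ℂ :=
  (1 / (k : ℂ)) *
    ((besselImin1 (Real.pi / (6 * (k : ℝ)) *
      Real.sqrt (DeltaC J m r δ κ ℓ * (24 * (n : ℝ) + OmegaC J m r δ))) : ℝ) : ℂ) *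
    innerH J m r δ ℏ n κ ℓ k

open scoped Real

/-- `e(x) = exp(2πix)` -/
def ec (x : ℂ) : ℂ := exp (2 * (π : ℂ) * I * x)

lemma ec_add (x y : ℂ) : ec (x + y) = ec x * ec y := by
  rw [ec, ec, ec, ← Complex.exp_add]; ring_nf

lemma ec_zero : ec 0 = 1 := by simp [ec]

lemma ec_ne_zero (x : ℂ) : ec x ≠ 0 := Complex.exp_ne_zero _

lemma ec_neg (x : ℂ) : ec (-x) = (ec x)⁻¹ := by
  rw [ec, ec, ← Complex.exp_neg]; ring_nf

lemma ec_sub (x y : ℂ) : ec (x - y) = ec x / ec y := by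
  rw [sub_eq_add_neg, ec_add, ec_neg, div_eq_mul_inv]

lemma ec_int (n : ℤ) : ec n = 1 := by
  rw [ec, mul_comm, Complex.exp_int_mul_two_pi_mul_I]

lemma ec_nat (n : ℕ) : ec n = 1 := by exact_mod_cast ec_int n

lemma ec_one : ec 1 = 1 := by exact_mod_cast ec_int 1

lemma ec_add_int (x : ℂ) (n : ℤ) : ec (x + n) = ec x := by rw [ec_add, ec_int, mul_one]

lemma ec_eq_of_sub_int {x y : ℂ} (n : ℤ) (h : x - y = n) : ec x = ec y := by
  rw [show x = y + n by rw [← h]; ring, ec_add_int]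

lemma ec_int_mul (n : ℤ) (x : ℂ) : ec (n * x) = ec x ^ n := by
  rw [ec, ec, ← Complex.exp_int_mul]; ring_nf

lemma ec_nat_mul (n : ℕ) (x : ℂ) : ec (n * x) = ec x ^ n := by
  rw [ec, ec, ← Complex.exp_nat_mul]; ring_nf

lemma ec_half : ec (1 / 2) = -1 := by
  rw [ec, show 2 * (π : ℂ) * I * (1 / 2) = π * I by ring,
    Complex.exp_pi_mul_I]

lemma norm_ec (x : ℂ) : ‖ec x‖ = Real.exp (-2 * π * x.im) := by
  rw [ec, Complex.norm_exp]; congr 1; simp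

lemma norm_ec_real (x : ℝ) : ‖ec x‖ = 1 := by simp [norm_ec]

lemma differentiable_ec : Differentiable ℂ ec := by unfold ec; fun_prop

lemma continuous_ec : Continuous ec := differentiable_ec.continuous

/-! ### divisor bound -/

lemma tau_local_small (v : ℕ) : ((v : ℝ) + 1) ≤ 12 * (2 : ℝ) ^ ((v : ℝ) / 6) := by
  have h1 : (1 + 1 / 6 * Real.log 2 * v : ℝ) ≤ (2 : ℝ) ^ ((v : ℝ) / 6) := by
    rw [Real.rpow_def_of_pos (by norm_num)]
    have := Real.add_one_le_exp (Real.log 2 * ((v : ℝ) / 6))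
    linarith
  have h2 := Real.log_two_gt_d9
  nlinarith [Nat.cast_nonneg (α := ℝ) v]

lemma tau_local (p v : ℕ) (hp : 2 ≤ p) :
    ((v : ℝ) + 1) ≤ (if p < 64 then 12 else 1) * ((p : ℝ) ^ v) ^ ((1 : ℝ) / 6) := by
  have e : ((p : ℝ) ^ v) ^ ((1 : ℝ) / 6) = (p : ℝ) ^ ((v : ℝ) / 6) := by
    rw [← Real.rpow_natCast, ← Real.rpow_mul (by positivity)]; ring_nf
  rw [e]
  have hp' : (2 : ℝ) ≤ p := by exact_mod_cast hp
  split_ifs with h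
  · refine (tau_local_small v).trans ?_
    gcongr
  · have h64 : (64 : ℝ) ≤ p := by exact_mod_cast not_lt.mp h
    have : (2 : ℝ) ^ v ≤ (p : ℝ) ^ ((v : ℝ) / 6) := by
      calc (2 : ℝ) ^ v = (64 : ℝ) ^ ((v : ℝ) / 6) := by
            rw [show (64 : ℝ) = (2 : ℝ) ^ (6 : ℝ) by norm_num, ← Real.rpow_mul (by norm_num),
              ← Real.rpow_natCast]; ring_nf
        _ ≤ _ := by gcongr
    have h2 : ((v : ℝ) + 1) ≤ 2 ^ v := by exact_mod_cast Nat.lt_two_pow_self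
    linarith

lemma tau_bound (n : ℕ) (hn : n ≠ 0) :
    (n.divisors.card : ℝ) ≤ 12 ^ 64 * (n : ℝ) ^ ((1 : ℝ) / 6) := by
  rw [Nat.card_divisors hn]
  push_cast
  have h1 : ∏ p ∈ n.primeFactors, ((n.factorization p : ℝ) + 1) ≤
      ∏ p ∈ n.primeFactors, ((if p < 64 then 12 else 1) *
        ((p : ℝ) ^ (n.factorization p)) ^ ((1 : ℝ) / 6)) := by
    refine prod_le_prod (fun p _ => by positivity) (fun p hp => ?_)
    exact tau_local p _ (Nat.prime_of_mem_primeFactors hp).two_le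
  refine h1.trans ?_
  rw [prod_mul_distrib]
  have h2 : ∏ p ∈ n.primeFactors, (if p < 64 then (12 : ℝ) else 1) ≤ 12 ^ 64 := by
    rw [prod_ite, prod_const_one, mul_one, prod_const]
    refine pow_le_pow_right₀ (by norm_num) ?_
    calc _ ≤ (range 64).card := Finset.card_le_card (fun x hx => by
            simpa using (mem_filter.mp hx).2)
      _ = 64 := by simp
  have h3 : ∏ p ∈ n.primeFactors, ((p : ℝ) ^ (n.factorization p)) ^ ((1 : ℝ) / 6) =
      (n : ℝ) ^ ((1 : ℝ) / 6) := by
    rw [Real.finsetProd_rpow _ _ (fun p _ => by positivity)]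
    congr 1
    have := Nat.prod_factorization_pow_eq_self hn
    conv_rhs => rw [← this]
    rw [Finsupp.prod]
    push_cast
    rfl
  rw [h3]
  gcongr

/-! ### counting -/

def Gset (k : ℕ) [NeZero k] : Finset (ZMod k) :=
  univ.filter (fun u => k ≤ (Nat.gcd u.val k) ^ 3)

lemma Gset_card (k : ℕ) [NeZero k] :
    ((Gset k).card : ℝ) ≤ 12 ^ 64 * (k : ℝ) ^ ((5 : ℝ) / 6) := by
  have hk : 0 < k := Nat.pos_of_ne_zero (NeZero.ne k)
  have hkr : (0 : ℝ) < k := by exact_mod_cast hk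
  have h1 : (Gset k).card ≤ ∑ e ∈ k.divisors.filter (fun e => k ≤ e ^ 3), k / e := by
    have hsub : Gset k ⊆ (k.divisors.filter (fun e => k ≤ e ^ 3)).biUnion
        (fun e => image (fun i : ℕ => ((e * i : ℕ) : ZMod k)) (range (k / e))) := by
      intro u hu
      have hu' := (mem_filter.mp hu).2
      simp only [mem_biUnion, mem_filter, Nat.mem_divisors, mem_image,
        mem_range]
      refine ⟨Nat.gcd u.val k, ⟨⟨Nat.gcd_dvd_right _ _, hk.ne'⟩, hu'⟩,
        u.val / Nat.gcd u.val k, ?_, ?_⟩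
      · apply Nat.div_lt_div_of_lt_of_dvd (Nat.gcd_dvd_right _ _) (ZMod.val_lt u)
      · rw [Nat.mul_div_cancel' (Nat.gcd_dvd_left _ _)]
        simp
    refine (Finset.card_le_card hsub).trans (Finset.card_biUnion_le.trans ?_)
    refine sum_le_sum fun e _ => ?_
    exact Finset.card_image_le.trans (by simp)
  have h2 : ((∑ e ∈ k.divisors.filter (fun e => k ≤ e ^ 3), k / e : ℕ) : ℝ) ≤
      ∑ e ∈ k.divisors.filter (fun e => k ≤ e ^ 3), (k : ℝ) ^ ((2 : ℝ) / 3) := by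
    push_cast
    refine sum_le_sum fun e he => ?_
    have he' := (mem_filter.mp he).2
    have hepos : 0 < e := by
      rcases Nat.eq_zero_or_pos e with h | h
      · subst h; simp at he'; omega
      · exact h
    have hepr : (0 : ℝ) < e := by exact_mod_cast hepos
    refine (Nat.cast_div_le).trans ?_
    rw [div_le_iff₀ hepr]
    have h3 : (k : ℝ) ^ ((1 : ℝ) / 3) ≤ e := by
      have : (k : ℝ) ≤ (e : ℝ) ^ 3 := by exact_mod_cast he'
      calc (k : ℝ) ^ ((1 : ℝ) / 3) ≤ ((e : ℝ) ^ 3) ^ ((1 : ℝ) / 3) := by gcongr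
        _ = e := by
          rw [← Real.rpow_natCast, ← Real.rpow_mul (by positivity)]; norm_num
    calc (k : ℝ) = (k : ℝ) ^ ((2 : ℝ) / 3) * (k : ℝ) ^ ((1 : ℝ) / 3) := by
          rw [← Real.rpow_add hkr]; norm_num
      _ ≤ _ := by gcongr
  rw [sum_const, nsmul_eq_mul] at h2
  have h4 : ((k.divisors.filter (fun e => k ≤ e ^ 3)).card : ℝ) ≤ 12 ^ 64 * (k : ℝ) ^ ((1 : ℝ) / 6) :=
    le_trans (by exact_mod_cast Finset.card_filter_le _ _) (tau_bound k hk.ne')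
  calc ((Gset k).card : ℝ) ≤ _ := by exact_mod_cast h1
    _ ≤ _ := h2
    _ ≤ (12 ^ 64 * (k : ℝ) ^ ((1 : ℝ) / 6)) * (k : ℝ) ^ ((2 : ℝ) / 3) := by gcongr
    _ = _ := by rw [mul_assoc, ← Real.rpow_add hkr]; norm_num

lemma mem_Gset_of_prod (k : ℕ) [NeZero k] (u v w : ZMod k) (h : u * v * w = 0) :
    u ∈ Gset k ∨ v ∈ Gset k ∨ w ∈ Gset k := by
  have hk : 0 < k := Nat.pos_of_ne_zero (NeZero.ne k)
  simp only [Gset, mem_filter, mem_univ, true_and]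
  have hd : k ∣ u.val * v.val * w.val := by
    rw [← ZMod.natCast_eq_zero_iff]; push_cast; simpa using h
  have hd2 : k ∣ Nat.gcd u.val k * Nat.gcd v.val k * Nat.gcd w.val k := by
    have h1 : k ∣ Nat.gcd (u.val * v.val) k * Nat.gcd w.val k := by
      have := Nat.gcd_mul_right_dvd_mul_gcd k (u.val * v.val) w.val
      rw [Nat.gcd_eq_left hd] at this
      simpa [Nat.gcd_comm] using this
    refine h1.trans (Nat.mul_dvd_mul_right ?_ _)
    have := Nat.gcd_mul_right_dvd_mul_gcd k u.val v.val
    simpa [Nat.gcd_comm] using this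
  have hpos : ∀ x : ZMod k, 0 < Nat.gcd x.val k := fun x => Nat.gcd_pos_of_pos_right _ hk
  have hle := Nat.le_of_dvd (Nat.mul_pos (Nat.mul_pos (hpos u) (hpos v)) (hpos w)) hd2
  by_contra! hcon
  obtain ⟨h1, h2, h3⟩ := hcon
  generalize Nat.gcd u.val k = a at *
  generalize Nat.gcd v.val k = b at *
  generalize Nat.gcd w.val k = c at *
  have e1 : a ^ 3 * b ^ 3 * c ^ 3 < k * k * k := by
    have := Nat.mul_lt_mul'' h1 h2
    exact Nat.mul_lt_mul'' this h3
  have e2 : k ^ 3 ≤ (a * b * c) ^ 3 := Nat.pow_le_pow_left hle 3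
  nlinarith

def Rset (k : ℕ) [NeZero k] : Finset (ZMod k × ZMod k) :=
  univ.filter (fun p => (p.1 + p.2) * (p.1 - 1) * (p.2 - 1) = 0)

lemma Rset_card (k : ℕ) [NeZero k] : (Rset k).card ≤ 3 * (k * (Gset k).card) := by
  have hsub : Rset k ⊆ (image (fun p : ZMod k × ZMod k => (p.1, p.2 - p.1)) (univ ×ˢ Gset k)) ∪
      ((image (fun p : ZMod k × ZMod k => (p.2 + 1, p.1)) (univ ×ˢ Gset k)) ∪
      (image (fun p : ZMod k × ZMod k => (p.1, p.2 + 1)) (univ ×ˢ Gset k))) := by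
    rintro ⟨x, y⟩ h
    have h' := (mem_filter.mp h).2
    simp only [mem_union, mem_image, mem_product, mem_univ, true_and,
      Prod.exists, Prod.mk.injEq]
    rcases mem_Gset_of_prod k _ _ _ h' with h1 | h1 | h1
    · exact Or.inl ⟨x, _, h1, rfl, by ring⟩
    · exact Or.inr (Or.inl ⟨y, _, h1, by ring, rfl⟩)
    · exact Or.inr (Or.inr ⟨x, _, h1, rfl, by ring⟩)
  have hc : (univ ×ˢ Gset k : Finset (ZMod k × ZMod k)).card = k * (Gset k).card := by
    rw [Finset.card_product, Finset.card_univ, ZMod.card]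
  refine (Finset.card_le_card hsub).trans ?_
  refine (Finset.card_union_le _ _).trans ?_
  have a1 := Finset.card_image_le (s := (univ ×ˢ Gset k : Finset (ZMod k × ZMod k)))
    (f := fun p : ZMod k × ZMod k => (p.1, p.2 - p.1))
  have a2 := Finset.card_image_le (s := (univ ×ˢ Gset k : Finset (ZMod k × ZMod k)))
    (f := fun p : ZMod k × ZMod k => (p.2 + 1, p.1))
  have a3 := Finset.card_image_le (s := (univ ×ˢ Gset k : Finset (ZMod k × ZMod k)))
    (f := fun p : ZMod k × ZMod k => (p.1, p.2 + 1))
  have a4 := Finset.card_union_le (image (fun p : ZMod k × ZMod k => (p.2 + 1, p.1)) (univ ×ˢ Gset k))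
    (image (fun p : ZMod k × ZMod k => (p.1, p.2 + 1)) (univ ×ˢ Gset k))
  omega

lemma Rset_card_real (k : ℕ) [NeZero k] :
    ((Rset k).card : ℝ) ≤ 3 * 12 ^ 64 * (k : ℝ) ^ ((11 : ℝ) / 6) := by
  have hk : 0 < k := Nat.pos_of_ne_zero (NeZero.ne k)
  have hkr : (0 : ℝ) < k := by exact_mod_cast hk
  have h1 : ((Rset k).card : ℝ) ≤ 3 * (k * (Gset k).card) := by exact_mod_cast Rset_card k
  have h2 := Gset_card k
  calc ((Rset k).card : ℝ) ≤ 3 * (k * (12 ^ 64 * (k : ℝ) ^ ((5 : ℝ) / 6))) := h1.trans (by gcongr)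
    _ = 3 * 12 ^ 64 * ((k : ℝ) ^ (1 : ℝ) * (k : ℝ) ^ ((5 : ℝ) / 6)) := by rw [Real.rpow_one]; ring
    _ = _ := by rw [← Real.rpow_add hkr]; norm_num

abbrev psiQ (Q : ℕ) [NeZero Q] : AddChar (ZMod Q) ℂ := ZMod.stdAddChar (N := Q)

lemma psiQ_conj (Q : ℕ) [NeZero Q] (x : ZMod Q) : (starRingEnd ℂ) (psiQ Q x) = psiQ Q (-x) := by
  rw [AddChar.map_neg_eq_conj]

lemma psiQ_norm (Q : ℕ) [NeZero Q] (x : ZMod Q) : ‖psiQ Q x‖ = 1 := by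
  exact AddChar.norm_apply _ _

lemma psiQ_sum (Q : ℕ) [NeZero Q] (b : ZMod Q) :
    ∑ x : ZMod Q, psiQ Q (x * b) = if b = 0 then (Q : ℂ) else 0 := by
  have := AddChar.sum_mulShift b (ZMod.isPrimitive_stdAddChar Q)
  rw [ZMod.card] at this
  rw [this]; split_ifs <;> simp

lemma second_moment (Q : ℕ) [NeZero Q] {σ : Type*} [DecidableEq σ] (S : Finset σ)
    (f1 f2 : σ → ZMod Q) :
    ∑ a : ZMod Q, ∑ b : ZMod Q, ‖∑ s ∈ S, psiQ Q (a * f1 s + b * f2 s)‖ ^ 2 =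
      (Q : ℝ) ^ 2 * (((S ×ˢ S).filter (fun p => f1 p.1 = f1 p.2 ∧ f2 p.1 = f2 p.2)).card : ℝ) := by
  have key : ∑ a : ZMod Q, ∑ b : ZMod Q, ((‖∑ s ∈ S, psiQ Q (a * f1 s + b * f2 s)‖ ^ 2 : ℝ) : ℂ) =
      (Q : ℂ) ^ 2 * (((S ×ˢ S).filter (fun p => f1 p.1 = f1 p.2 ∧ f2 p.1 = f2 p.2)).card : ℂ) := by
    have e : ∀ a b : ZMod Q, ((‖∑ s ∈ S, psiQ Q (a * f1 s + b * f2 s)‖ ^ 2 : ℝ) : ℂ) =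
        ∑ p ∈ S ×ˢ S, psiQ Q (a * (f1 p.1 - f1 p.2)) * psiQ Q (b * (f2 p.1 - f2 p.2)) := by
      intro a b
      push_cast
      rw [← Complex.mul_conj', map_sum, sum_mul_sum, sum_product]
      refine sum_congr rfl fun s _ => sum_congr rfl fun t _ => ?_
      rw [psiQ_conj, ← AddChar.map_add_eq_mul, ← AddChar.map_add_eq_mul]
      congr 1; ring
    simp_rw [e]
    have e2 : ∑ a : ZMod Q, ∑ b : ZMod Q, ∑ p ∈ S ×ˢ S,
        psiQ Q (a * (f1 p.1 - f1 p.2)) * psiQ Q (b * (f2 p.1 - f2 p.2)) =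
        ∑ p ∈ S ×ˢ S, (∑ a : ZMod Q, psiQ Q (a * (f1 p.1 - f1 p.2))) *
          (∑ b : ZMod Q, psiQ Q (b * (f2 p.1 - f2 p.2))) := by
      simp_rw [sum_mul_sum]
      refine (sum_congr rfl fun a _ => sum_comm).trans ?_
      rw [sum_comm]
    rw [e2]
    simp_rw [psiQ_sum, sub_eq_zero]
    rw [Finset.card_filter]
    push_cast
    rw [Finset.mul_sum]
    refine sum_congr rfl fun p _ => ?_
    by_cases h1 : f1 p.1 = f1 p.2 <;> by_cases h2 : f2 p.1 = f2 p.2 <;> simp [h1, h2, sq]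
  exact_mod_cast key

section
variable (M k : ℕ) [NeZero M] [NeZero k]

abbrev ck : ZMod (M * k) →+* ZMod k := ZMod.castHom (Dvd.intro_left M rfl) (ZMod k)
abbrev cM : ZMod (M * k) →+* ZMod M := ZMod.castHom (Dvd.intro k rfl) (ZMod M)

def Xset (c : ZMod (M * k)) (h0 d0 : ZMod M) : Finset (ZMod (M * k) × ZMod (M * k)) :=
  univ.filter (fun p => p.1 * p.2 = c ∧ cM M k p.1 = h0 ∧ cM M k p.2 = d0)

lemma ck_fiber (v : ZMod k) :
    (univ.filter (fun h : ZMod (M * k) => ck M k h = v)).card ≤ M := by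
  have hk : 0 < k := Nat.pos_of_ne_zero (NeZero.ne k)
  have : Set.MapsTo (fun h : ZMod (M * k) => h.val / k)
      (univ.filter (fun h : ZMod (M * k) => ck M k h = v) : Finset _) (range M : Finset ℕ) := by
    intro h _
    simp only [coe_range, Set.mem_Iio]
    exact Nat.div_lt_of_lt_mul ((ZMod.val_lt h).trans_eq (mul_comm _ _))
  calc _ ≤ (range M).card := by
        refine Finset.card_le_card_of_injOn _ this ?_
        intro x hx y hy hxy
        simp only [coe_filter, mem_univ, true_and, Set.mem_ofPred_eq] at hx hy
        have h1 : (x.val : ZMod k) = (y.val : ZMod k) := by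
          have hx' : ck M k x = (x.val : ZMod k) := by
            conv_lhs => rw [← ZMod.natCast_zmod_val x]
            rw [map_natCast]
          have hy' : ck M k y = (y.val : ZMod k) := by
            conv_lhs => rw [← ZMod.natCast_zmod_val y]
            rw [map_natCast]
          rw [← hx', ← hy', hx, hy]
        have h2 : x.val % k = y.val % k := by
          have := (ZMod.natCast_eq_natCast_iff _ _ _).mp h1
          exact this
        apply ZMod.val_injective
        rw [← Nat.div_add_mod x.val k, ← Nat.div_add_mod y.val k, h2]
        simp only at hxy
        rw [hxy]
    _ = M := by simp

variable {M k}
variable {c : ZMod (M * k)} {h0 d0 : ZMod M}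

lemma X_mul (hc : ck M k c = 1) {p : ZMod (M * k) × ZMod (M * k)} (hp : p ∈ Xset M k c h0 d0) :
    ck M k p.1 * ck M k p.2 = 1 := by
  rw [← map_mul, (mem_filter.mp hp).2.1, hc]

lemma X_fiber (hc : ck M k c = 1) (v w : ZMod k) (hw : IsUnit w):
    ((Xset M k c h0 d0).filter (fun p => ck M k p.1 * w = v)).card ≤ M ^ 2 := by
  obtain ⟨w', hw'⟩ := hw.exists_right_inv
  rcases eq_empty_or_nonempty ((Xset M k c h0 d0).filter (fun p => ck M k p.1 * w = v)) with h | ⟨p0, hp0⟩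
  · rw [h]; simp
  obtain ⟨hp0, hp0v⟩ := mem_filter.mp hp0
  calc _ ≤ ((univ.filter (fun h : ZMod (M * k) => ck M k h = ck M k p0.1)) ×ˢ
        (univ.filter (fun h : ZMod (M * k) => ck M k h = ck M k p0.2))).card := by
        refine Finset.card_le_card fun p hp => ?_
        obtain ⟨hp, hpv⟩ := mem_filter.mp hp
        have h1 : ck M k p.1 = ck M k p0.1 := by
          have : (ck M k p.1 * w) * w' = (ck M k p0.1 * w) * w' := by rw [hpv, hp0v]
          rwa [mul_assoc, mul_assoc, hw', mul_one, mul_one] at this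
        have h2 : ck M k p.2 = ck M k p0.2 := by
          have e1 := X_mul hc hp
          have e2 := X_mul hc hp0
          calc ck M k p.2 = ck M k p.2 * (ck M k p0.1 * ck M k p0.2) := by rw [e2, mul_one]
            _ = (ck M k p.1 * ck M k p.2) * ck M k p0.2 := by rw [h1]; ring
            _ = _ := by rw [e1, one_mul]
        simp only [mem_product, mem_filter, mem_univ, true_and]
        exact ⟨h1, h2⟩
    _ ≤ M * M := by
        rw [Finset.card_product]
        exact Nat.mul_le_mul (ck_fiber M k _) (ck_fiber M k _)
    _ = M ^ 2 := by ring

lemma X_card (hc : ck M k c = 1) : (Xset M k c h0 d0).card ≤ M ^ 2 * Nat.totient k := by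
  have hmaps : ∀ p ∈ Xset M k c h0 d0, ck M k p.1 ∈ (univ : Finset (ZMod k)ˣ).image (fun u : (ZMod k)ˣ => (u : ZMod k)) := by
    intro p hp
    have := X_mul hc hp
    simp only [mem_image, mem_univ, true_and]
    exact IsUnit.of_mul_eq_one _ this
  have := Finset.card_le_mul_card_image_of_maps_to hmaps (M ^ 2) (fun v _ => by
    have := X_fiber hc (h0 := h0) (d0 := d0) v 1 isUnit_one
    simp only [mul_one] at this
    exact this)
  refine this.trans (Nat.mul_le_mul_left _ ?_)
  refine Finset.card_image_le.trans ?_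
  rw [Finset.card_univ, ZMod.card_units_eq_totient]

def N4set (c : ZMod (M * k)) (h0 d0 : ZMod M) :=
  ((Xset M k c h0 d0 ×ˢ Xset M k c h0 d0) ×ˢ (Xset M k c h0 d0 ×ˢ Xset M k c h0 d0)).filter
    (fun p => p.1.1.1 + p.1.2.1 = p.2.1.1 + p.2.2.1 ∧ p.1.1.2 + p.1.2.2 = p.2.1.2 + p.2.2.2)

lemma N4_card (hc : ck M k c = 1) : (N4set c h0 d0).card ≤ (Xset M k c h0 d0).card * ((M ^ 2) ^ 2 * (Rset k).card) := by
  set X := Xset M k c h0 d0 with hX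
  have hmaps : ∀ p ∈ N4set c h0 d0, p.2.2 ∈ X := by
    intro p hp
    have := (mem_filter.mp hp).1
    simp only [mem_product] at this
    exact this.2.2
  have := Finset.card_le_mul_card_image_of_maps_to hmaps ((M ^ 2) ^ 2 * (Rset k).card) ?_
  · exact this.trans_eq (mul_comm _ _)
  intro x4 hx4
  have e4 := X_mul hc hx4
  have u4 : IsUnit (ck M k x4.2) := IsUnit.of_mul_eq_one _ (by rw [mul_comm]; exact e4)
  have hmaps2 : ∀ p ∈ (N4set c h0 d0).filter (fun p => p.2.2 = x4),
      ((ck M k p.1.1.1 * ck M k x4.2, ck M k p.1.2.1 * ck M k x4.2) : ZMod k × ZMod k) ∈ Rset k := by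
    rintro ⟨⟨x1, x2⟩, x3, y4⟩ hpa
    obtain ⟨hpb, h4⟩ := mem_filter.mp hpa
    obtain ⟨hp, hh, hd⟩ := mem_filter.mp hpb
    rw [mem_product, mem_product, mem_product] at hp
    simp only at hp h4 hh hd
    subst h4
    have e1 := X_mul hc hp.1.1
    have e2 := X_mul hc hp.1.2
    have e3 := X_mul hc hp.2.1
    have hh' := congrArg (ck M k) hh
    have hd' := congrArg (ck M k) hd
    simp only [map_add] at hh' hd'
    simp only [Rset, mem_filter, mem_univ, true_and]
    generalize ck M k x1.1 = a1 at *
    generalize ck M k x1.2 = b1 at *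
    generalize ck M k x2.1 = a2 at *
    generalize ck M k x2.2 = b2 at *
    generalize ck M k x3.1 = a3 at *
    generalize ck M k x3.2 = b3 at *
    generalize ck M k y4.1 = a4 at *
    generalize ck M k y4.2 = b4 at *
    have ha3 : a3 = a1 + a2 - a4 := by rw [hh']; ring
    have hb3 : b3 = b1 + b2 - b4 := by rw [hd']; ring
    subst ha3 hb3
    have key : (a1 + a2) * (a1 - a4) * (a2 - a4) = 0 := by
      linear_combination (-a1 * a2 * a4) * e3 + (a2 * a4 * (a1 + a2 - a4)) * e1 +
        (a1 * a4 * (a1 + a2 - a4)) * e2 - (a1 * a2 * (a1 + a2 - a4)) * e4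
    linear_combination b4 ^ 3 * key + ((a1 + a2) * b4) * (a1 * b4 + a2 * b4 - 1 - a4 * b4) * e4
  have := Finset.card_le_mul_card_image_of_maps_to hmaps2 ((M ^ 2) ^ 2) ?_
  · exact this
  rintro ⟨v, w⟩ _
  calc _ ≤ ((X.filter (fun p => ck M k p.1 * ck M k x4.2 = v)) ×ˢ
        (X.filter (fun p => ck M k p.1 * ck M k x4.2 = w))).card := by
        refine Finset.card_le_card_of_injOn (fun p => p.1) ?_ ?_
        · rintro ⟨⟨x1, x2⟩, x3, y4⟩ hp
          simp only [N4set, coe_filter, mem_filter, mem_product, Prod.mk.injEq,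
            Set.mem_ofPred_eq] at hp
          simp only [coe_product, coe_filter, Set.mem_prod, Set.mem_ofPred_eq]
          exact ⟨⟨hp.1.1.1.1.1, hp.2.1⟩, ⟨hp.1.1.1.1.2, hp.2.2⟩⟩
        · rintro ⟨⟨x1, x2⟩, x3, y4⟩ hp ⟨⟨z1, z2⟩, z3, w4⟩ hq hpq
          simp only [N4set, coe_filter, mem_filter, mem_product, Prod.mk.injEq,
            Set.mem_ofPred_eq] at hp hq hpq
          obtain ⟨rfl, rfl⟩ := hpq
          obtain ⟨⟨⟨_, hp1, hp2⟩, hp3⟩, _⟩ := hp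
          obtain ⟨⟨⟨_, hq1, hq2⟩, hq3⟩, _⟩ := hq
          have e : x3 = z3 := by
            subst hp3
            rw [hq3] at hq1 hq2
            exact Prod.ext (add_right_cancel (hp1.symm.trans hq1)) (add_right_cancel (hp2.symm.trans hq2))
          rw [e, hp3, hq3]
    _ ≤ (M ^ 2) * (M ^ 2) := by
        rw [Finset.card_product]
        exact Nat.mul_le_mul (X_fiber hc _ _ u4) (X_fiber hc _ _ u4)
    _ = _ := by ring

end

lemma mul_fiber (Q : ℕ) [NeZero Q] (a : ℤ) (ha : a ≠ 0) (v : ZMod Q) :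
    (univ.filter (fun u : ZMod Q => u * (a : ZMod Q) = v)).card ≤ a.natAbs := by
  have hQ : 0 < Q := Nat.pos_of_ne_zero (NeZero.ne Q)
  have hapos : 0 < a.natAbs := Int.natAbs_pos.mpr ha
  calc _ ≤ (range a.natAbs).card := by
        refine Finset.card_le_card_of_injOn (fun u : ZMod Q => u.val * a.natAbs / Q) ?_ ?_
        · intro u _
          simp only [coe_range, Set.mem_Iio]
          apply Nat.div_lt_of_lt_mul
          exact Nat.mul_lt_mul_of_pos_right (ZMod.val_lt u) hapos
        · intro x hx y hy hxy
          simp only [coe_filter, mem_univ, true_and, Set.mem_ofPred_eq] at hx hy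
          have h1 : ((x.val * a.natAbs : ℕ) : ZMod Q) = ((y.val * a.natAbs : ℕ) : ZMod Q) := by
            push_cast
            simp only [ZMod.natCast_val, ZMod.cast_id', id]
            rcases Int.natAbs_eq a with h | h
            · have : (a : ZMod Q) = (a.natAbs : ZMod Q) := by
                conv_lhs => rw [h]
                simp
              rw [← this, hx, hy]
            · have : (a : ZMod Q) = -(a.natAbs : ZMod Q) := by
                conv_lhs => rw [h]
                simp
              have h2 : (a.natAbs : ZMod Q) = -(a : ZMod Q) := by rw [this, neg_neg]
              rw [h2, mul_neg, mul_neg, hx, hy]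
          have h2 : (x.val * a.natAbs) % Q = (y.val * a.natAbs) % Q :=
            (ZMod.natCast_eq_natCast_iff _ _ _).mp h1
          have h3 : x.val * a.natAbs = y.val * a.natAbs := by
            rw [← Nat.div_add_mod (x.val * a.natAbs) Q, ← Nat.div_add_mod (y.val * a.natAbs) Q, h2]
            simp only at hxy
            rw [hxy]
          exact ZMod.val_injective Q (Nat.eq_of_mul_eq_mul_right hapos h3)
    _ = _ := by simp

section
variable (M k : ℕ) [NeZero M] [NeZero k]

def Uset : Finset (ZMod (M * k))ˣ := univ.filter (fun u => cM M k (u : ZMod (M * k)) = 1)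

lemma Uset_card : Nat.totient k ≤ (Uset M k).card := by
  have h1 : Fintype.card (ZMod (M * k))ˣ ≤ (Uset M k).card * Fintype.card (ZMod M)ˣ := by
    rw [← Finset.card_univ, ← Finset.card_univ]
    refine Finset.card_le_mul_card_image_of_maps_to (f := fun u => Units.map (cM M k).toMonoidHom u)
      (fun _ _ => mem_univ _) _ (fun v _ => ?_)
    rcases eq_empty_or_nonempty (univ.filter (fun u => Units.map (cM M k).toMonoidHom u = v)) with h | ⟨u0, hu0⟩
    · rw [h]; simp
    · have hu0' := (mem_filter.mp hu0).2
      refine Finset.card_le_card_of_injOn (fun u => u * u0⁻¹) ?_ ?_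
      · intro u hu
        have hu' := (mem_filter.mp hu).2
        have e : Units.map (cM M k).toMonoidHom (u * u0⁻¹) = 1 := by
          rw [map_mul, map_inv, hu0', hu', mul_inv_cancel]
        have := congrArg Units.val e
        simp only [Uset, coe_filter, mem_univ, true_and, Set.mem_ofPred_eq]
        exact this
      · intro x _ y _ hxy
        exact mul_right_cancel hxy
  rw [ZMod.card_units_eq_totient, ZMod.card_units_eq_totient] at h1
  have h2 := Nat.totient_super_multiplicative M k
  have h3 : 0 < Nat.totient M := Nat.totient_pos.mpr (Nat.pos_of_ne_zero (NeZero.ne M))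
  have h4 : Nat.totient k * Nat.totient M ≤ (Uset M k).card * Nat.totient M := by
    rw [mul_comm]; exact h2.trans h1
  exact Nat.le_of_mul_le_mul_right h4 h3

def Tsum (c : ZMod (M * k)) (h0 d0 : ZMod M) (a b : ZMod (M * k)) : ℂ :=
  ∑ p ∈ Xset M k c h0 d0, psiQ (M * k) (a * p.1 + b * p.2)

variable {M k}
variable {c : ZMod (M * k)} {h0 d0 : ZMod M}

lemma Tsum_orbit (u : (ZMod (M * k))ˣ) (hu : u ∈ Uset M k) (a b : ZMod (M * k)) :
    Tsum M k c h0 d0 a b = Tsum M k c h0 d0 (u * a) ((u⁻¹ : (ZMod (M * k))ˣ) * b) := by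
  have hu1 : cM M k (u : ZMod (M * k)) = 1 := (mem_filter.mp hu).2
  have hu2 : cM M k ((u⁻¹ : (ZMod (M * k))ˣ) : ZMod (M * k)) = 1 := by
    have : cM M k ((u : ZMod (M * k)) * ((u⁻¹ : (ZMod (M * k))ˣ) : ZMod (M * k))) = 1 := by
      rw [Units.mul_inv, map_one]
    rwa [map_mul, hu1, one_mul] at this
  unfold Tsum
  refine sum_bij' (fun p _ => (((u⁻¹ : (ZMod (M * k))ˣ) : ZMod (M * k)) * p.1, (u : ZMod (M * k)) * p.2))
    (fun p _ => ((u : ZMod (M * k)) * p.1, ((u⁻¹ : (ZMod (M * k))ˣ) : ZMod (M * k)) * p.2)) ?_ ?_ ?_ ?_ ?_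
  · intro p hp
    have hp := (mem_filter.mp hp).2
    refine mem_filter.mpr ⟨mem_univ _, ?_, ?_, ?_⟩
    · simp only; rw [mul_mul_mul_comm, Units.inv_mul, one_mul, hp.1]
    · simp only; rw [map_mul, hu2, one_mul, hp.2.1]
    · simp only; rw [map_mul, hu1, one_mul, hp.2.2]
  · intro p hp
    have hp := (mem_filter.mp hp).2
    refine mem_filter.mpr ⟨mem_univ _, ?_, ?_, ?_⟩
    · simp only; rw [mul_mul_mul_comm, Units.mul_inv, one_mul, hp.1]
    · simp only; rw [map_mul, hu1, one_mul, hp.2.1]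
    · simp only; rw [map_mul, hu2, one_mul, hp.2.2]
  · intro p _; ext <;> simp
  · intro p _; ext <;> simp
  · intro p _
    congr 1
    simp only
    linear_combination (-a * p.1 - b * p.2) * (Units.mul_inv u)

lemma fourth_moment :
    ∑ a : ZMod (M * k), ∑ b : ZMod (M * k), ‖Tsum M k c h0 d0 a b‖ ^ 4 =
      ((M * k : ℕ) : ℝ) ^ 2 * ((N4set c h0 d0).card : ℝ) := by
  rw [N4set, ← second_moment (M * k) (Xset M k c h0 d0 ×ˢ Xset M k c h0 d0)
    (fun p => p.1.1 + p.2.1) (fun p => p.1.2 + p.2.2)]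
  refine sum_congr rfl fun a _ => sum_congr rfl fun b _ => ?_
  rw [show (4 : ℕ) = 2 * 2 from rfl, pow_mul, ← norm_pow]
  congr 2
  rw [sq, Tsum, sum_mul_sum, sum_product]
  refine sum_congr rfl fun s _ => sum_congr rfl fun t _ => ?_
  rw [← AddChar.map_add_eq_mul]
  congr 1; ring

lemma Tsum_pow4 (hc : ck M k c = 1) (a : ℤ) (ha : a ≠ 0) (b : ZMod (M * k)) :
    ‖Tsum M k c h0 d0 (a : ZMod (M * k)) b‖ ^ 4 ≤
      (a.natAbs : ℝ) * (M : ℝ) ^ 8 * (k : ℝ) ^ 2 * (Rset k).card := by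
  have hk : 0 < k := Nat.pos_of_ne_zero (NeZero.ne k)
  have hphi : (0 : ℝ) < Nat.totient k := by exact_mod_cast Nat.totient_pos.mpr hk
  set t := ‖Tsum M k c h0 d0 (a : ZMod (M * k)) b‖ ^ 4 with ht
  have ht0 : 0 ≤ t := by positivity
  have h1 : (Nat.totient k : ℝ) * t ≤ ∑ u ∈ Uset M k, t := by
    rw [sum_const, nsmul_eq_mul]
    gcongr
    exact Uset_card M k
  have h2 : ∑ u ∈ Uset M k, t ≤ (a.natAbs : ℝ) *
      ∑ p : ZMod (M * k) × ZMod (M * k), ‖Tsum M k c h0 d0 p.1 p.2‖ ^ 4 := by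
    have e : ∑ u ∈ Uset M k, t = ∑ u ∈ Uset M k,
        ‖Tsum M k c h0 d0 (u * (a : ZMod (M * k))) ((u⁻¹ : (ZMod (M * k))ˣ) * b)‖ ^ 4 :=
      sum_congr rfl fun u hu => by rw [ht, Tsum_orbit u hu]
    rw [e]
    rw [← sum_fiberwise_of_maps_to (s := Uset M k) (t := univ)
      (g := fun u : (ZMod (M * k))ˣ => ((u * (a : ZMod (M * k)), (u⁻¹ : (ZMod (M * k))ˣ) * b) : ZMod (M * k) × ZMod (M * k)))
      (fun _ _ => mem_univ _), Finset.mul_sum]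
    refine sum_le_sum fun p _ => ?_
    have : ∀ u ∈ (Uset M k).filter (fun u : (ZMod (M * k))ˣ => ((u * (a : ZMod (M * k)), (u⁻¹ : (ZMod (M * k))ˣ) * b) : ZMod (M * k) × ZMod (M * k)) = p),
        ‖Tsum M k c h0 d0 (u * (a : ZMod (M * k))) ((u⁻¹ : (ZMod (M * k))ˣ) * b)‖ ^ 4 =
        ‖Tsum M k c h0 d0 p.1 p.2‖ ^ 4 := by
      intro u hu
      rw [← (mem_filter.mp hu).2]
    rw [sum_congr rfl this, sum_const, nsmul_eq_mul]
    gcongr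
    refine le_trans ?_ (mul_fiber (M * k) a ha p.1)
    refine Finset.card_le_card_of_injOn (fun u => (u : ZMod (M * k))) ?_ ?_
    · intro u hu
      have := (mem_filter.mp hu).2
      simp only [coe_filter, mem_univ, true_and, Set.mem_ofPred_eq]
      rw [← this]
    · intro x _ y _ hxy
      exact Units.ext hxy
  rw [Fintype.sum_prod_type, fourth_moment] at h2
  have h3 : ((N4set c h0 d0).card : ℝ) ≤ ((M : ℝ) ^ 2 * Nat.totient k) * (((M : ℝ) ^ 2) ^ 2 * (Rset k).card) := by
    have := (N4_card hc (h0 := h0) (d0 := d0)).trans (Nat.mul_le_mul_right _ (X_card hc))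
    exact_mod_cast this
  have h4 : (Nat.totient k : ℝ) * t ≤ (Nat.totient k : ℝ) *
      ((a.natAbs : ℝ) * (M : ℝ) ^ 8 * (k : ℝ) ^ 2 * (Rset k).card) := by
    refine (h1.trans h2).trans ?_
    calc (a.natAbs : ℝ) * (((M * k : ℕ) : ℝ) ^ 2 * ((N4set c h0 d0).card : ℝ)) ≤
        (a.natAbs : ℝ) * (((M * k : ℕ) : ℝ) ^ 2 *
          (((M : ℝ) ^ 2 * Nat.totient k) * (((M : ℝ) ^ 2) ^ 2 * (Rset k).card))) := by gcongr
      _ = _ := by push_cast; ring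
  exact le_of_mul_le_mul_left h4 hphi

lemma Tsum_bound (hc : ck M k c = 1) (a : ℤ) (ha : a ≠ 0) (b : ZMod (M * k)) :
    ‖Tsum M k c h0 d0 (a : ZMod (M * k)) b‖ ≤
      ((a.natAbs : ℝ) * (M : ℝ) ^ 8 * (3 * 12 ^ 64)) * (k : ℝ) ^ ((23 : ℝ) / 24) := by
  have hk : 0 < k := Nat.pos_of_ne_zero (NeZero.ne k)
  have hkr : (0 : ℝ) < k := by exact_mod_cast hk
  have hM : (1 : ℝ) ≤ M := by exact_mod_cast Nat.pos_of_ne_zero (NeZero.ne M)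
  have ha1 : (1 : ℝ) ≤ a.natAbs := by exact_mod_cast Int.natAbs_pos.mpr ha
  set C := ((a.natAbs : ℝ) * (M : ℝ) ^ 8 * (3 * 12 ^ 64)) with hC
  have hC1 : 1 ≤ C := by
    have : (1 : ℝ) ≤ (M : ℝ) ^ 8 := one_le_pow₀ hM
    have h2 : (1 : ℝ) ≤ (a.natAbs : ℝ) * (M : ℝ) ^ 8 := by nlinarith
    rw [hC]; nlinarith
  have h := Tsum_pow4 hc (h0 := h0) (d0 := d0) a ha b
  have hR := Rset_card_real k
  have h2 : ‖Tsum M k c h0 d0 (a : ZMod (M * k)) b‖ ^ 4 ≤ (C * (k : ℝ) ^ ((23 : ℝ) / 24)) ^ 4 := by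
    calc _ ≤ (a.natAbs : ℝ) * (M : ℝ) ^ 8 * (k : ℝ) ^ 2 * (3 * 12 ^ 64 * (k : ℝ) ^ ((11 : ℝ) / 6)) :=
          h.trans (by gcongr)
      _ = C * ((k : ℝ) ^ (2 : ℝ) * (k : ℝ) ^ ((11 : ℝ) / 6)) := by
          rw [hC, ← Real.rpow_natCast (k : ℝ) 2]; push_cast; ring
      _ = C * (k : ℝ) ^ ((23 : ℝ) / 6) := by rw [← Real.rpow_add hkr]; norm_num
      _ ≤ C ^ 4 * (k : ℝ) ^ ((23 : ℝ) / 6) := by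
          gcongr
          exact le_self_pow₀ hC1 (by norm_num)
      _ = _ := by
          rw [mul_pow C ((k : ℝ) ^ ((23 : ℝ) / 24)) 4]
          congr 1
          rw [← Real.rpow_natCast ((k : ℝ) ^ ((23 : ℝ) / 24)) 4, ← Real.rpow_mul hkr.le]
          norm_num
  exact le_of_pow_le_pow_left₀ (by norm_num) (by positivity) h2

end

lemma psiQ_eq_ec (Q : ℕ) [NeZero Q] (j : ℤ) : psiQ Q (j : ZMod Q) = ec (j / Q) := by
  rw [ZMod.stdAddChar_coe, ec]; congr 1; ring

lemma norm_one_sub_psiQ (Q : ℕ) [NeZero Q] (c : ZMod Q) :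
    4 * min (c.val : ℝ) ((Q : ℝ) - c.val) / Q ≤ ‖psiQ Q (-c) - 1‖ := by
  have hQ : (0 : ℝ) < Q := by exact_mod_cast Nat.pos_of_ne_zero (NeZero.ne Q)
  have h0 : ‖psiQ Q (-c) - 1‖ = ‖psiQ Q c - 1‖ := by
    rw [← psiQ_conj, ← RCLike.norm_conj (psiQ Q c - 1), map_sub, map_one]
  have h1 : psiQ Q c = exp (I * ((2 * π * c.val / Q : ℝ) : ℂ)) := by
    have := psiQ_eq_ec Q (c.val : ℤ)
    rw [show (((c.val : ℤ)) : ZMod Q) = c by simp] at this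
    rw [this, ec]; congr 1; push_cast; ring
  rw [h0, h1, Complex.norm_exp_I_mul_ofReal_sub_one]
  have hv : (c.val : ℝ) ≤ Q := by exact_mod_cast (ZMod.val_lt c).le
  have hv0 : (0 : ℝ) ≤ c.val := by positivity
  have hpi := Real.pi_pos
  refine le_trans ?_ (le_abs_self _)
  rcases le_total (c.val : ℝ) ((Q : ℝ) - c.val) with h | h
  · rw [min_eq_left h]
    have hx : π * (c.val / Q) ≤ π / 2 := by
      rw [div_eq_mul_inv π 2]; gcongr
      rw [div_le_iff₀ hQ]; linarith
    have := Real.mul_le_sin (x := π * (c.val / Q)) (by positivity) hx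
    rw [show 2 * π * c.val / Q / 2 = π * (c.val / Q) by ring]
    have e : 2 / π * (π * (c.val / Q)) = 2 * (c.val / Q) := by field_simp
    rw [e] at this
    have : 4 * (c.val : ℝ) / Q = 2 * (2 * (c.val / Q)) := by ring
    linarith
  · rw [min_eq_right h]
    have hx : π * (((Q : ℝ) - c.val) / Q) ≤ π / 2 := by
      rw [div_eq_mul_inv π 2]; gcongr
      rw [div_le_iff₀ hQ]; linarith
    have := Real.mul_le_sin (x := π * (((Q : ℝ) - c.val) / Q))
      (by have : 0 ≤ (Q : ℝ) - c.val := by linarith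
          positivity) hx
    have e2 : 2 * π * c.val / Q / 2 = π - π * (((Q : ℝ) - c.val) / Q) := by
      field_simp; ring
    rw [e2, Real.sin_pi_sub]
    have e : 2 / π * (π * (((Q : ℝ) - c.val) / Q)) = 2 * (((Q : ℝ) - c.val) / Q) := by field_simp
    rw [e] at this
    have : 4 * ((Q : ℝ) - c.val) / Q = 2 * (2 * (((Q : ℝ) - c.val) / Q)) := by ring
    linarith

lemma geom_bound (Q : ℕ) [NeZero Q] (c : ZMod Q) (hc : c ≠ 0) (len : ℕ) :
    ‖∑ i ∈ range len, psiQ Q (-c) ^ i‖ ≤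
      (Q : ℝ) * (1 / (2 * c.val) + 1 / (2 * ((Q : ℝ) - c.val))) := by
  have hQ : (0 : ℝ) < Q := by exact_mod_cast Nat.pos_of_ne_zero (NeZero.ne Q)
  have hv : (c.val : ℝ) < Q := by exact_mod_cast (ZMod.val_lt c)
  have hv0 : (0 : ℝ) < c.val := by
    have : c.val ≠ 0 := by rwa [Ne, ZMod.val_eq_zero]
    exact_mod_cast Nat.pos_of_ne_zero this
  have hv' : 0 < (Q : ℝ) - c.val := by linarith
  have h1 := norm_one_sub_psiQ Q c
  have hmin : 0 < min (c.val : ℝ) ((Q : ℝ) - c.val) := lt_min hv0 hv'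
  have hpos : 0 < ‖psiQ Q (-c) - 1‖ := lt_of_lt_of_le (by positivity) h1
  have hne : psiQ Q (-c) ≠ 1 := fun h => by simp [h] at hpos
  rw [geom_sum_eq hne, norm_div]
  have h2 : ‖psiQ Q (-c) ^ len - 1‖ ≤ 2 := by
    refine (norm_sub_le _ _).trans ?_
    rw [norm_pow, psiQ_norm]; norm_num
  calc _ ≤ 2 / (4 * min (c.val : ℝ) ((Q : ℝ) - c.val) / Q) := by gcongr
    _ = Q * (1 / (2 * min (c.val : ℝ) ((Q : ℝ) - c.val))) := by field_simp; norm_num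
    _ ≤ _ := by
      gcongr
      rcases le_total (c.val : ℝ) ((Q : ℝ) - c.val) with h | h
      · rw [min_eq_left h]; have : 0 ≤ 1 / (2 * ((Q : ℝ) - c.val)) := by positivity
        linarith
      · rw [min_eq_right h]; have : 0 ≤ 1 / (2 * (c.val : ℝ)) := by positivity
        linarith

lemma sum_geom_bound (Q : ℕ) [NeZero Q] (len : ℕ) (hlen : len ≤ Q) :
    ∑ c : ZMod Q, ‖∑ i ∈ range len, psiQ Q (-c) ^ i‖ ≤ (Q : ℝ) * (2 + Real.log Q) := by
  have hQ0 := Nat.pos_of_ne_zero (NeZero.ne Q)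
  have hQ : (0 : ℝ) < Q := by exact_mod_cast hQ0
  rw [← add_sum_erase _ _ (mem_univ (0 : ZMod Q))]
  have h0 : ‖∑ i ∈ range len, psiQ Q (-0) ^ i‖ ≤ Q := by
    simp only [neg_zero, AddChar.map_zero_eq_one, one_pow, sum_const, Finset.card_range,
      nsmul_eq_mul, mul_one]
    rw [Complex.norm_natCast]; exact_mod_cast hlen
  have h1 : ∑ c ∈ univ.erase (0 : ZMod Q), ‖∑ i ∈ range len, psiQ Q (-c) ^ i‖ ≤
      ∑ c ∈ univ.erase (0 : ZMod Q), (Q : ℝ) * (1 / (2 * c.val) + 1 / (2 * ((Q : ℝ) - c.val))) :=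
    sum_le_sum fun c hc => geom_bound Q c (ne_of_mem_erase hc) len
  have h2 : ∑ c ∈ univ.erase (0 : ZMod Q), (Q : ℝ) * (1 / (2 * c.val) + 1 / (2 * ((Q : ℝ) - c.val))) =
      ∑ v ∈ Finset.Ico 1 Q, (Q : ℝ) * (1 / (2 * (v : ℝ)) + 1 / (2 * ((Q : ℝ) - v))) := by
    refine sum_bij (fun c _ => c.val) ?_ ?_ ?_ ?_
    · intro c hc
      have : c.val ≠ 0 := by rw [Ne, ZMod.val_eq_zero]; exact ne_of_mem_erase hc
      rw [mem_Ico]; exact ⟨Nat.pos_of_ne_zero this, ZMod.val_lt c⟩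
    · intro a _ b _ h; exact ZMod.val_injective Q h
    · intro v hv
      rw [mem_Ico] at hv
      refine ⟨(v : ZMod Q), ?_, ZMod.val_cast_of_lt hv.2⟩
      refine mem_erase.mpr ⟨?_, mem_univ _⟩
      intro h
      have := ZMod.val_cast_of_lt hv.2
      rw [h, ZMod.val_zero] at this; omega
    · intro c _; rfl
  have h3 : ∑ v ∈ Finset.Ico 1 Q, (Q : ℝ) * (1 / (2 * (v : ℝ)) + 1 / (2 * ((Q : ℝ) - v))) =
      (Q : ℝ) * ∑ v ∈ Finset.Ico 1 Q, (1 / (v : ℝ)) := by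
    rw [← Finset.mul_sum, sum_add_distrib]
    congr 1
    have : ∑ v ∈ Finset.Ico 1 Q, 1 / (2 * ((Q : ℝ) - v)) = ∑ v ∈ Finset.Ico 1 Q, 1 / (2 * (v : ℝ)) := by
      have hr := sum_Ico_reflect (fun v : ℕ => 1 / (2 * (v : ℝ))) 1 (n := Q) (m := Q) (by omega)
      rw [show Q + 1 - Q = 1 by omega, show Q + 1 - 1 = Q by omega] at hr
      rw [← hr]
      refine sum_congr rfl fun v hv => ?_
      rw [mem_Ico] at hv
      rw [Nat.cast_sub hv.2.le]
    rw [this, ← sum_add_distrib]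
    refine sum_congr rfl fun v hv => ?_
    field_simp; norm_num
  have h4 : ∑ v ∈ Finset.Ico 1 Q, (1 / (v : ℝ)) ≤ 1 + Real.log Q := by
    have := harmonic_le_one_add_log Q
    refine le_trans ?_ this
    rw [harmonic_eq_sum_Icc]
    push_cast
    simp only [one_div]
    refine sum_le_sum_of_subset_of_nonneg ?_ (fun _ _ _ => by positivity)
    intro x hx; rw [mem_Ico] at hx; rw [mem_Icc]; omega
  calc _ ≤ (Q : ℝ) + Q * (1 + Real.log Q) := by
        refine add_le_add h0 (h1.trans (h2.trans h3 |>.le.trans ?_))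
        gcongr
    _ = _ := by ring

lemma KL_complete (M k : ℕ) [NeZero M] [NeZero k] (c : ZMod (M * k)) (hc : ck M k c = 1) (h0 d0 : ZMod M)
    (a : ℤ) (ha : a ≠ 0) (ν A : ZMod (M * k)) (len : ℕ) (hlen : len ≤ M * k) :
    ‖∑ i ∈ range len, ∑ p ∈ (Xset M k c h0 d0).filter (fun p => p.2 = A + i),
      psiQ (M * k) (a * p.1 + ν * p.2)‖ ≤
      (2 + Real.log ((M * k : ℕ) : ℝ)) * (((a.natAbs : ℝ) * (M : ℝ) ^ 8 * (3 * 12 ^ 64)) * (k : ℝ) ^ ((23 : ℝ) / 24)) := by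
  have hQ : (0 : ℝ) < ((M * k : ℕ) : ℝ) := by exact_mod_cast Nat.pos_of_ne_zero (NeZero.ne (M * k))
  have hQc : ((M * k : ℕ) : ℂ) ≠ 0 := by exact_mod_cast NeZero.ne (M * k)
  have key : ((M * k : ℕ) : ℂ) * ∑ i ∈ range len, ∑ p ∈ (Xset M k c h0 d0).filter (fun p => p.2 = A + i),
      psiQ (M * k) (a * p.1 + ν * p.2) =
      ∑ t : ZMod (M * k), (psiQ (M * k) (-t * A) * ∑ i ∈ range len, psiQ (M * k) (-t) ^ i) *
        Tsum M k c h0 d0 a (ν + t) := by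
    have e1 : ∀ t : ZMod (M * k), (psiQ (M * k) (-t * A) * ∑ i ∈ range len, psiQ (M * k) (-t) ^ i) *
        Tsum M k c h0 d0 a (ν + t) = ∑ i ∈ range len, ∑ p ∈ Xset M k c h0 d0,
          psiQ (M * k) (a * p.1 + ν * p.2) * psiQ (M * k) (t * (p.2 - (A + i))) := by
      intro t
      rw [Tsum, mul_sum (range len), sum_mul_sum]
      refine sum_congr rfl fun i _ => sum_congr rfl fun p _ => ?_
      rw [← AddChar.map_nsmul_eq_pow, ← AddChar.map_add_eq_mul, ← AddChar.map_add_eq_mul,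
        ← AddChar.map_add_eq_mul]
      congr 1
      rw [nsmul_eq_mul]; ring
    simp_rw [e1]
    rw [sum_comm, Finset.mul_sum]
    refine sum_congr rfl fun i _ => ?_
    rw [sum_comm, sum_filter, Finset.mul_sum]
    refine sum_congr rfl fun p _ => ?_
    rw [← Finset.mul_sum, psiQ_sum]
    simp only [sub_eq_zero]
    split_ifs <;> ring
  set S := ∑ i ∈ range len, ∑ p ∈ (Xset M k c h0 d0).filter (fun p => p.2 = A + i),
      psiQ (M * k) (a * p.1 + ν * p.2)
  set B := (((a.natAbs : ℝ) * (M : ℝ) ^ 8 * (3 * 12 ^ 64)) * (k : ℝ) ^ ((23 : ℝ) / 24))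
  have hB : 0 ≤ B := by positivity
  have h1 : ((M * k : ℕ) : ℝ) * ‖S‖ ≤ ((M * k : ℕ) : ℝ) * ((2 + Real.log ((M * k : ℕ) : ℝ)) * B) := by
    calc ((M * k : ℕ) : ℝ) * ‖S‖ = ‖((M * k : ℕ) : ℂ) * S‖ := by rw [norm_mul, Complex.norm_natCast]
      _ ≤ ∑ t : ZMod (M * k), ‖∑ i ∈ range len, psiQ (M * k) (-t) ^ i‖ * B := by
          rw [key]
          refine (norm_sum_le _ _).trans (sum_le_sum fun t _ => ?_)
          rw [norm_mul, norm_mul, psiQ_norm, one_mul]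
          gcongr
          exact Tsum_bound hc a ha _
      _ ≤ _ := by
          rw [← sum_mul]
          have := sum_geom_bound (M * k) len hlen
          calc _ ≤ (((M * k : ℕ) : ℝ) * (2 + Real.log ((M * k : ℕ) : ℝ))) * B := by gcongr
            _ = _ := by ring
  exact le_of_mul_le_mul_left h1 hQ

lemma sum_range_periodic (k M : ℕ) (f : ℤ → ℂ) (hf : ∀ x, f (x + k) = f x) :
    ∑ x ∈ range (M * k), f x = M * ∑ x ∈ range k, f x := by
  induction M with
  | zero => simp
  | succ M ih =>
    rw [Nat.succ_mul, sum_range_add, ih]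
    have : ∀ (j : ℕ) (x : ℤ), f (x + (j * k : ℕ)) = f x := by
      intro j
      induction j with
      | zero => simp
      | succ j ihj =>
        intro x
        rw [show (x + ((j + 1) * k : ℕ) : ℤ) = (x + (j * k : ℕ)) + k by push_cast; ring, hf, ihj]
    have e : ∀ x ∈ range k, f ((M * k + x : ℕ) : ℤ) = f x := by
      intro x _
      rw [show ((M * k + x : ℕ) : ℤ) = (x : ℤ) + (M * k : ℕ) by push_cast; ring, this]
    rw [sum_congr rfl e]; push_cast; ring

lemma log_aux (M k : ℕ) (hM : 0 < M) (hk : 0 < k) :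
    2 + Real.log ((M * k : ℕ) : ℝ) ≤ (50 + Real.log M) * (k : ℝ) ^ ((1 : ℝ) / 48) := by
  have hMr : (1 : ℝ) ≤ M := by exact_mod_cast hM
  have hkr : (1 : ℝ) ≤ k := by exact_mod_cast hk
  push_cast
  rw [Real.log_mul (by positivity) (by positivity)]
  have h1 := Real.log_le_rpow_div (x := (k : ℝ)) (by positivity) (ε := (1 : ℝ) / 48) (by norm_num)
  have h2 : (1 : ℝ) ≤ (k : ℝ) ^ ((1 : ℝ) / 48) := Real.one_le_rpow hkr (by norm_num)
  have h3 : 0 ≤ Real.log M := Real.log_nonneg hMr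
  have h4 : Real.log k ≤ 48 * (k : ℝ) ^ ((1 : ℝ) / 48) := h1.trans_eq (by ring)
  nlinarith

lemma KL_int (M k : ℕ) [NeZero M] [NeZero k] (b0 h0 d0 : ZMod M)
    (a : ℤ) (ha : a ≠ 0) (ν A : ℤ) (len : ℕ) (hlen : len ≤ M * k) :
    ‖∑ i ∈ range len, ∑ x ∈ range (M * k),
      if (((x : ℤ) * (A + i) : ℤ) : ZMod (M * k)) = 1 + (b0.val : ZMod (M * k)) * (k : ZMod (M * k)) ∧
        ((x : ℤ) : ZMod M) = h0 ∧ ((A + i : ℤ) : ZMod M) = d0 then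
        ec (((a * x + ν * (A + i) : ℤ) : ℂ) / ((M * k : ℕ) : ℂ)) else 0‖ ≤
      (2 + Real.log ((M * k : ℕ) : ℝ)) * (((a.natAbs : ℝ) * (M : ℝ) ^ 8 * (3 * 12 ^ 64)) * (k : ℝ) ^ ((23 : ℝ) / 24)) := by
  have hc : ck M k (1 + (b0.val : ZMod (M * k)) * (k : ZMod (M * k))) = 1 := by
    rw [map_add, map_one, map_mul, map_natCast, map_natCast]; simp
  refine le_trans (le_of_eq ?_) (KL_complete M k _ hc h0 d0 a ha (ν : ZMod (M * k)) (A : ZMod (M * k)) len hlen)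
  congr 1
  refine sum_congr rfl fun i _ => ?_
  rw [sum_ite, sum_const_zero, add_zero]
  refine sum_bij (fun x _ => (((x : ℕ) : ZMod (M * k)), ((A + i : ℤ) : ZMod (M * k)))) ?_ ?_ ?_ ?_
  · intro x hx
    obtain ⟨hx, h1, h2, h3⟩ := mem_filter.mp hx
    simp only [mem_filter, Xset, mem_univ, true_and]
    refine ⟨⟨?_, ?_, ?_⟩, by push_cast; rfl⟩
    · rw [← h1]; push_cast; rfl
    · rw [map_natCast, ← h2]; push_cast; rfl
    · rw [map_intCast, h3]
  · intro x hx y hy hxy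
    have hx := mem_range.mp (mem_filter.mp hx).1
    have hy := mem_range.mp (mem_filter.mp hy).1
    have := congrArg (fun p => (Prod.fst p).val) hxy
    simpa [ZMod.val_cast_of_lt hx, ZMod.val_cast_of_lt hy] using this
  · rintro ⟨u, v⟩ hp
    simp only [mem_filter, Xset, mem_univ, true_and] at hp
    obtain ⟨⟨h1, h2, h3⟩, h4⟩ := hp
    have e1 : ((u.val : ℕ) : ZMod (M * k)) = u := by simp
    have e2 : ((A + i : ℤ) : ZMod (M * k)) = v := by rw [h4]; push_cast; rfl
    refine ⟨u.val, ?_, ?_⟩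
    · refine mem_filter.mpr ⟨mem_range.mpr (ZMod.val_lt u), ?_, ?_, ?_⟩
      · rw [← h1, Int.cast_mul, e2, Int.cast_natCast, e1]
      · rw [← h2, Int.cast_natCast, ← map_natCast (cM M k), e1]
      · rw [← h3, ← e2, map_intCast]
    · rw [e1, e2]
  · intro x _
    rw [← psiQ_eq_ec]
    congr 1
    push_cast; rfl

def Gf (M k : ℕ) (a ν : ℤ) (w : ℤ → ℤ → ℤ → ℂ) (x y : ℤ) : ℂ :=
  w x ((x * y - 1) / k) y * ec (((a * x + ν * y : ℤ) : ℂ) / ((M * k : ℕ) : ℂ))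

lemma KLf (M : ℕ) (hM : 0 < M) (a : ℤ) (ha : a ≠ 0) : ∃ B : ℝ, 0 ≤ B ∧
    ∀ k : ℕ, 0 < k → ∀ (ν A : ℤ) (len : ℕ), len ≤ M * k → ∀ (W : ℝ) (w : ℤ → ℤ → ℤ → ℂ),
      (∀ x b y, ‖w x b y‖ ≤ W) → (∀ x b y, w x b y = w (x % M) (b % M) (y % M)) →
      ‖∑ i ∈ range len, ∑ x ∈ range (M * k),
        if (k : ℤ) ∣ (x : ℤ) * (A + i) - 1 then Gf M k a ν w x (A + i) else 0‖ ≤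
        B * W * (k : ℝ) ^ ((47 : ℝ) / 48) := by
  have : NeZero M := ⟨hM.ne'⟩
  set C := (a.natAbs : ℝ) * (M : ℝ) ^ 8 * (3 * 12 ^ 64) with hC
  have hlM : 0 ≤ Real.log M := Real.log_nonneg (by exact_mod_cast hM)
  refine ⟨(M : ℝ) ^ 3 * ((50 + Real.log M) * C), by positivity, ?_⟩
  intro k hk ν A len hlen W w hW hw
  have : NeZero k := ⟨hk.ne'⟩
  have hkr : (0 : ℝ) < k := by exact_mod_cast hk
  have hMr : (1 : ℝ) ≤ M := by exact_mod_cast hM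
  have hkz : (k : ℤ) ≠ 0 := by exact_mod_cast hk.ne'
  set S := ∑ i ∈ range len, ∑ x ∈ range (M * k),
        if (k : ℤ) ∣ (x : ℤ) * (A + i) - 1 then Gf M k a ν w x (A + i) else 0 with hS
  have e2 : ∀ x y : ℤ, (if (k : ℤ) ∣ x * y - 1 then Gf M k a ν w x y else 0) =
      ∑ q : ZMod M × ZMod M × ZMod M, w (q.1.val) (q.2.1.val) (q.2.2.val) *
        (if ((x * y : ℤ) : ZMod (M * k)) = 1 + (q.2.1.val : ZMod (M * k)) * (k : ZMod (M * k)) ∧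
        ((x : ℤ) : ZMod M) = q.1 ∧ ((y : ℤ) : ZMod M) = q.2.2 then
        ec (((a * x + ν * y : ℤ) : ℂ) / ((M * k : ℕ) : ℂ)) else 0) := by
    intro x y
    have hdv : ∀ b0 : ZMod M, ((x * y : ℤ) : ZMod (M * k)) = 1 + (b0.val : ZMod (M * k)) * (k : ZMod (M * k)) ↔
        ((k : ℤ) ∣ x * y - 1 ∧ (((x * y - 1) / k : ℤ) : ZMod M) = b0) := by
      intro b0
      have : (1 + (b0.val : ZMod (M * k)) * (k : ZMod (M * k))) = ((1 + b0.val * k : ℤ) : ZMod (M * k)) := by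
        push_cast; rfl
      rw [this, ZMod.intCast_eq_intCast_iff_dvd_sub]
      have hb0 : b0 = ((b0.val : ℤ) : ZMod M) := by simp
      constructor
      · rintro ⟨t, ht⟩
        have hxy : x * y - 1 = k * (b0.val - M * t) := by push_cast at ht; linear_combination -ht
        refine ⟨⟨_, hxy⟩, ?_⟩
        rw [hxy, Int.mul_ediv_cancel_left _ hkz]
        push_cast; simp
      · rintro ⟨⟨t, ht⟩, h2⟩
        rw [ht, Int.mul_ediv_cancel_left _ hkz, hb0, ZMod.intCast_eq_intCast_iff_dvd_sub] at h2
        obtain ⟨s, hs⟩ := h2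
        simp only [ZMod.natCast_val] at hs
        refine ⟨s, ?_⟩
        have : (b0.val : ℤ) = t + M * s := by
          rw [ZMod.natCast_val]; linear_combination hs
        rw [this]; push_cast; linear_combination -ht
    by_cases h : (k : ℤ) ∣ x * y - 1
    · rw [if_pos h, sum_eq_single (((x : ℤ) : ZMod M), (((x * y - 1) / k : ℤ) : ZMod M), ((y : ℤ) : ZMod M))]
      · rw [if_pos ⟨(hdv _).mpr ⟨h, rfl⟩, rfl, rfl⟩, Gf, hw]
        simp only [ZMod.val_intCast]
      · rintro ⟨q1, q2, q3⟩ _ hq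
        rw [if_neg, mul_zero]
        rintro ⟨h1, h2, h3⟩
        simp only at h1 h2 h3
        rw [hdv] at h1
        exact hq (by rw [h1.2, h2, h3])
      · intro h; exact absurd (mem_univ _) h
    · rw [if_neg h]
      symm
      refine sum_eq_zero fun q _ => ?_
      rw [if_neg, mul_zero]
      rintro ⟨h1, _⟩
      exact h ((hdv _).mp h1).1
  have e3 : S = ∑ q : ZMod M × ZMod M × ZMod M, w (q.1.val) (q.2.1.val) (q.2.2.val) *
      ∑ i ∈ range len, ∑ x ∈ range (M * k),
      (if (((x : ℤ) * (A + i) : ℤ) : ZMod (M * k)) = 1 + (q.2.1.val : ZMod (M * k)) * (k : ZMod (M * k)) ∧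
        ((x : ℤ) : ZMod M) = q.1 ∧ ((A + i : ℤ) : ZMod M) = q.2.2 then
        ec (((a * x + ν * (A + i) : ℤ) : ℂ) / ((M * k : ℕ) : ℂ)) else 0) := by
    simp_rw [Finset.mul_sum]
    symm
    rw [sum_comm]
    refine sum_congr rfl fun i _ => ?_
    rw [sum_comm]
    refine sum_congr rfl fun x _ => ?_
    rw [e2]
  have hW0 : 0 ≤ W := (norm_nonneg _).trans (hW 0 0 0)
  have h1 : ‖S‖ ≤ ∑ q : ZMod M × ZMod M × ZMod M, W *
      (((50 + Real.log M) * C) * (k : ℝ) ^ ((47 : ℝ) / 48)) := by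
    rw [e3]
    refine (norm_sum_le _ _).trans (sum_le_sum fun q _ => ?_)
    rw [norm_mul]
    gcongr
    · exact hW _ _ _
    · refine (KL_int M k _ _ _ a ha ν A len hlen).trans ?_
      calc _ ≤ ((50 + Real.log M) * (k : ℝ) ^ ((1 : ℝ) / 48)) * (C * (k : ℝ) ^ ((23 : ℝ) / 24)) := by
            gcongr; exact log_aux M k hM hk
        _ = ((50 + Real.log M) * C) * ((k : ℝ) ^ ((1 : ℝ) / 48) * (k : ℝ) ^ ((23 : ℝ) / 24)) := by ring
        _ = _ := by rw [← Real.rpow_add hkr]; norm_num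
  rw [sum_const, Finset.card_univ, Fintype.card_prod, Fintype.card_prod, ZMod.card, nsmul_eq_mul] at h1
  push_cast at h1
  refine h1.trans_eq ?_
  ring

def Jf (f : ℝ → ℂ) (k κ : ℕ) (a b : ℝ) : ℂ :=
  ∑ h ∈ range k, if k ∣ h * κ + 1 then ∫ x in ((h : ℝ) / k + a)..((h : ℝ) / k + b), f x else 0

lemma fbij {k κ h : ℕ} (hκ : 0 < κ) (hh : h < k) (hd : k ∣ h * κ + 1) :
    κ - (h * κ + 1) / k < κ ∧ κ ∣ (κ - (h * κ + 1) / k) * k + 1 ∧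
      k - ((κ - (h * κ + 1) / k) * k + 1) / κ = h ∧ ((κ - (h * κ + 1) / k : ℕ) : ℝ) / κ = 1 - (h : ℝ) / k - 1 / (k * κ) := by
  obtain ⟨q, hq⟩ := hd
  have hk : 0 < k := by omega
  have hq1 : 0 < q := Nat.pos_of_ne_zero fun h0 => by simp [h0] at hq
  have hq2 : q ≤ κ := by
    by_contra hlt; push Not at hlt; nlinarith
  rw [hq, Nat.mul_div_cancel_left _ hk]
  obtain ⟨s, rfl⟩ := Nat.exists_eq_add_of_le hq2
  obtain ⟨u, rfl⟩ := Nat.exists_eq_add_of_le hh.le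
  rw [Nat.add_sub_cancel_left]
  have e : s * (h + u) + 1 = (q + s) * u := by nlinarith
  have hqr : (h : ℝ) * (q + s) + 1 = (h + u) * q := by exact_mod_cast hq
  refine ⟨by omega, ⟨u, e⟩, ?_, ?_⟩
  · rw [e, Nat.mul_div_cancel_left _ hκ]; omega
  · have h1 : ((h + u : ℕ) : ℝ) ≠ 0 := by exact_mod_cast hk.ne'
    have h2 : ((q + s : ℕ) : ℝ) ≠ 0 := by exact_mod_cast hκ.ne'
    push_cast at *
    field_simp
    linear_combination hqr

lemma Jf_refl {f : ℝ → ℂ} (hp : ∀ x, f (x + 1) = f x) {k κ : ℕ} (hk : 0 < k) (hκ : 0 < κ) (a b : ℝ) :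
    Jf f k κ a b = Jf (fun x => f (-x)) κ k (1 / (k * κ) - b) (1 / (k * κ) - a) := by
  unfold Jf
  rw [← sum_filter, ← sum_filter]
  refine sum_bij' (fun h _ => κ - (h * κ + 1) / k) (fun h _ => k - (h * k + 1) / κ) ?_ ?_ ?_ ?_ ?_
  · intro h hh
    rw [mem_filter, mem_range] at *
    have := fbij hκ hh.1 hh.2
    exact ⟨this.1, this.2.1⟩
  · intro h hh
    rw [mem_filter, mem_range] at *
    have := fbij hk hh.1 hh.2
    exact ⟨this.1, this.2.1⟩
  · intro h hh
    rw [mem_filter, mem_range] at hh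
    exact (fbij hκ hh.1 hh.2).2.2.1
  · intro h hh
    rw [mem_filter, mem_range] at hh
    exact (fbij hk hh.1 hh.2).2.2.1
  · intro h hh
    rw [mem_filter, mem_range] at hh
    rw [(fbij hκ hh.1 hh.2).2.2.2, intervalIntegral.integral_comp_neg,
      show -(1 - (h : ℝ) / k - 1 / (k * κ) + (1 / (k * κ) - a)) = (h : ℝ) / k + a - 1 by ring,
      show -(1 - (h : ℝ) / k - 1 / (k * κ) + (1 / (k * κ) - b)) = (h : ℝ) / k + b - 1 by ring,
      ← intervalIntegral.integral_comp_sub_right]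
    congr 1; funext x
    rw [← hp (x - 1), sub_add_cancel]

lemma Jf_add {f : ℝ → ℂ} (hf : Continuous f) (k κ : ℕ) (a b c : ℝ) :
    Jf f k κ a b + Jf f k κ b c = Jf f k κ a c := by
  unfold Jf
  rw [← sum_add_distrib]
  refine sum_congr rfl fun h _ => ?_
  split_ifs
  · exact intervalIntegral.integral_add_adjacent_intervals (hf.intervalIntegrable _ _) (hf.intervalIntegrable _ _)
  · simp

lemma Jf_shift (f : ℝ → ℂ) (k κ : ℕ) (a b : ℝ) : Jf f k (k + κ) a b = Jf f k κ a b := by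
  unfold Jf
  refine sum_congr rfl fun h _ => ?_
  refine if_congr ?_ rfl rfl
  rw [show h * (k + κ) + 1 = (h * κ + 1) + k * h by ring, Nat.dvd_add_left (Dvd.intro _ rfl)]

lemma Jf_split {f : ℝ → ℂ} (hf : Continuous f) (hp : ∀ x, f (x + 1) = f x) {k κ : ℕ} (hk : 0 < k) (hκ : 0 < κ) :
    Jf f k κ 0 (1 / (k * κ)) = Jf f k κ 0 (1 / (k * (k + κ))) + Jf (fun x => f (-x)) κ k 0 (1 / (κ * (κ + k))) := by
  rw [← Jf_add hf k κ 0 (1 / (k * (k + κ))), Jf_refl hp hk hκ _ (1 / (k * κ)), sub_self]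
  congr 2
  have : (k : ℝ) ≠ 0 := by exact_mod_cast hk.ne'
  have : (κ : ℝ) ≠ 0 := by exact_mod_cast hκ.ne'
  have : (κ + k : ℝ) ≠ 0 := by positivity
  have : (k + κ : ℝ) ≠ 0 := by positivity
  field_simp; ring

lemma Jf_med {f : ℝ → ℂ} (hf : Continuous f) (hp : ∀ x, f (x + 1) = f x) {k κ : ℕ} (hk : 0 < k) (hκ : 0 < κ) :
    Jf f k κ 0 (1 / (k * κ)) = Jf f k (k + κ) 0 (1 / (k * (k + κ : ℕ))) + Jf f (k + κ) κ 0 (1 / ((k + κ : ℕ) * κ)) := by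
  rw [Jf_split hf hp hk hκ, Jf_shift, Jf_refl (k := k + κ) hp (by omega) hκ, sub_self, sub_zero, add_comm k κ, Jf_shift]
  congr 2 <;> push_cast <;> ring

def TN (X : ℕ → ℕ → ℂ) (N : ℕ) : ℂ := ∑ k ∈ Icc 1 N, ∑ κ ∈ Icc 1 N, if N < k + κ then X k κ else 0

lemma TN_succ {X : ℕ → ℕ → ℂ} (h1 : ∀ k κ, 0 < k → 0 < κ → X k κ = X k (k + κ) + X (k + κ) κ)
    (h0 : ∀ k, 1 < k → X k k = 0) {N : ℕ} (hN : 0 < N) : TN X (N + 1) = TN X N := by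
  have e1 : TN X N = (∑ k ∈ Icc 1 N, ∑ κ ∈ Icc 1 N, if N + 1 < k + κ then X k κ else 0) +
      ∑ k ∈ Icc 1 N, X k (N + 1 - k) := by
    rw [TN, ← sum_add_distrib]
    refine sum_congr rfl fun k hk => ?_
    rw [mem_Icc] at hk
    rw [← sum_ite_eq' (s := Icc 1 N) (a := N + 1 - k) (b := fun κ => X k κ) |>.trans (if_pos (mem_Icc.mpr (by omega))),
      ← sum_add_distrib]
    refine sum_congr rfl fun κ hκ => ?_
    rw [mem_Icc] at hκ
    rcases lt_trichotomy (N + 1) (k + κ) with h | h | h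
    · rw [if_pos (by omega), if_pos h, if_neg (by omega), add_zero]
    · rw [if_pos (by omega), if_neg (by omega), if_pos (by omega), zero_add]
    · rw [if_neg (by omega), if_neg (by omega), if_neg (by omega), zero_add]
  have e2 : TN X (N + 1) = (∑ k ∈ Icc 1 N, ∑ κ ∈ Icc 1 N, if N + 1 < k + κ then X k κ else 0) +
      ∑ k ∈ Icc 1 N, X k (N + 1) + ∑ κ ∈ Icc 1 N, X (N + 1) κ := by
    rw [TN, sum_Icc_succ_top (by omega), sum_Icc_succ_top (by omega), if_pos (by omega), h0 _ (by omega), add_zero]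
    congr 1
    · rw [← sum_add_distrib]
      refine sum_congr rfl fun k hk => ?_
      rw [mem_Icc] at hk
      rw [sum_Icc_succ_top (by omega), if_pos (by omega)]
    · refine sum_congr rfl fun k hk => ?_
      rw [mem_Icc] at hk
      rw [if_pos (by omega)]
  have e3 : ∑ k ∈ Icc 1 N, X (N + 1) (N + 1 - k) = ∑ κ ∈ Icc 1 N, X (N + 1) κ := by
    refine sum_bij' (fun k _ => N + 1 - k) (fun k _ => N + 1 - k) ?_ ?_ ?_ ?_ ?_ <;> intro k hk <;>
      rw [mem_Icc] at hk <;> first | rfl | (rw [mem_Icc]; omega) | omega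
  rw [e1, e2, ← e3, add_assoc, ← sum_add_distrib]
  congr 1
  refine sum_congr rfl fun k hk => ?_
  rw [mem_Icc] at hk
  rw [h1 k (N + 1 - k) (by omega) (by omega), show k + (N + 1 - k) = N + 1 by omega]

lemma sum_neg_per {k : ℕ} {φ : ℤ → ℂ} (hφ : ∀ x, φ (x + k) = φ x) :
    ∑ h ∈ range k, φ (-(h : ℤ)) = ∑ h ∈ range k, φ h := by
  rcases k with _ | n
  · simp
  rw [sum_range_succ', sum_range_succ', ← sum_range_reflect]
  congr 1
  refine sum_congr rfl fun j hj => ?_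
  rw [mem_range] at hj
  rw [← hφ]; congr 1; push_cast; omega

lemma TN_row (X : ℕ → ℂ) {N k : ℕ} (hk : k ∈ Icc 1 N) :
    (∑ κ ∈ Icc 1 N, if N < k + κ then X κ else 0) = ∑ i ∈ range k, X (N - k + 1 + i) := by
  rw [mem_Icc] at hk
  rw [← sum_filter, show (Icc 1 N).filter (fun κ => N < k + κ) = Ico (N - k + 1) (N + 1) by
    ext x; simp only [mem_filter, mem_Icc, mem_Ico]; omega, sum_Ico_eq_sum_range,
    show N + 1 - (N - k + 1) = k by omega]

def arcI (f : ℝ → ℂ) (σ : ℤ) (k κ : ℕ) : ℂ := ∑ h ∈ range k, if (k : ℤ) ∣ h * (-σ * κ) - 1 then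
  ∫ x in (0 : ℝ)..(1 / (k * (k + κ))), f ((h : ℝ) / k + σ * x) else 0

lemma farey {f : ℝ → ℂ} (hf : Continuous f) (hp : ∀ x, f (x + 1) = f x) {N : ℕ} (hN : 0 < N) :
    ∫ x in (0 : ℝ)..1, f x = ∑ k ∈ Icc 1 N, ∑ i ∈ range k,
      (arcI f 1 k (N - k + 1 + i) + arcI f (-1) k (N - k + 1 + i)) := by
  have h1 : ∫ x in (0 : ℝ)..1, f x = TN (fun k κ => Jf f k κ 0 (1 / (k * κ))) N := by
    induction N, hN using Nat.le_induction with
    | base => simp [TN, Jf]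
    | succ n hn ih =>
      rw [ih]
      refine (TN_succ (fun k κ hk hκ => Jf_med hf hp hk hκ) (fun k hk => ?_) hn).symm
      refine sum_eq_zero fun h _ => if_neg fun hd => ?_
      have := (Nat.dvd_add_right (Dvd.intro_left h rfl)).mp hd
      exact hk.ne' (Nat.dvd_one.mp this)
  have hp' : ∀ x (n : ℤ), f (x + n) = f x := fun x n => by
    have : Function.Periodic f 1 := hp
    simpa using this.int_mul n x
  have h2 : TN (fun k κ => Jf f k κ 0 (1 / (k * κ))) N = TN (fun k κ => Jf f k κ 0 (1 / (k * (k + κ)))) N +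
      TN (fun k κ => Jf (fun x => f (-x)) k κ 0 (1 / (k * (k + κ)))) N := by
    simp only [TN]
    nth_rw 3 [sum_comm]
    rw [← sum_add_distrib]
    refine sum_congr rfl fun k hk => ?_
    rw [← sum_add_distrib]
    refine sum_congr rfl fun κ hκ => ?_
    rw [mem_Icc] at hk hκ
    rw [add_comm κ k]
    split_ifs
    · rw [Jf_split hf hp hk.1 hκ.1, add_comm (κ : ℝ)]
    · simp
  rw [h1, h2]
  unfold TN
  rw [← sum_add_distrib]
  refine sum_congr rfl fun k hk => ?_
  rw [TN_row _ hk, TN_row _ hk, ← sum_add_distrib]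
  have hk0 : (k : ℝ) ≠ 0 := by have := (mem_Icc.mp hk).1; positivity
  refine sum_congr rfl fun i _ => ?_
  generalize N - k + 1 + i = κ
  congr 1
  · refine sum_congr rfl fun h _ => ?_
    have : k ∣ h * κ + 1 ↔ (k : ℤ) ∣ h * (-1 * κ) - 1 := by
      rw [← Int.natCast_dvd_natCast, ← dvd_neg]; push_cast; rw [show -((h : ℤ) * κ + 1) = h * (-1 * κ) - 1 by ring]
    simp only [← this]
    split_ifs
    · rw [← intervalIntegral.integral_comp_add_left]; simp
    · rfl
  · refine Eq.trans ?_ ((sum_neg_per (k := k) (φ := fun h => if (k : ℤ) ∣ h * (-(-1) * κ) - 1 then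
      ∫ x in (0 : ℝ)..(1 / (k * (k + κ))), f ((h : ℝ) / k + (-1 : ℤ) * x) else 0) ?_).trans (by simp [arcI]))
    · refine sum_congr rfl fun h _ => ?_
      have : k ∣ h * κ + 1 ↔ (k : ℤ) ∣ -h * (-(-1) * κ) - 1 := by
        rw [← Int.natCast_dvd_natCast, ← dvd_neg,
          show -h * (-(-1) * κ) - 1 = -(((h * κ + 1 : ℕ)) : ℤ) by push_cast; ring]
      simp only [← this]
      split_ifs
      · rw [← intervalIntegral.integral_comp_add_left]
        congr 1; funext x; congr 1; push_cast; ring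
      · rfl
    · intro h
      have : (k : ℤ) ∣ (h + k) * (-(-1) * κ) - 1 ↔ (k : ℤ) ∣ h * (-(-1) * κ) - 1 := by
        rw [show (h + k) * (-(-1) * κ) - 1 = h * (-(-1) * κ) - 1 + k * κ by ring]
        exact dvd_add_left (Dvd.intro _ rfl)
      simp only [this]
      refine if_congr Iff.rfl (congrArg (fun F : ℝ → ℂ => ∫ x in (0 : ℝ)..(1 / (k * (k + κ))), F x) (funext fun x => ?_)) rfl
      rw [← hp' (h / k + (-1 : ℤ) * x) 1]
      congr 1; push_cast; field_simp; ring

def resS (a b : ℂ) : ℂ := ∑' j : ℕ, a ^ j * b ^ (j + 1) / (j.factorial * (j + 1).factorial)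

lemma exp_dbl (x y : ℂ) : HasSum (fun p : ℕ × ℕ => (x ^ p.1 / p.1.factorial) * (y ^ p.2 / p.2.factorial)) (exp x * exp y) := by
  have hexp : ∀ z : ℂ, HasSum (fun n : ℕ => z ^ n / n.factorial) (exp z) := fun z => by
    rw [Complex.exp_eq_exp_ℂ]; exact NormedSpace.expSeries_div_hasSum_exp z
  have hn : ∀ z : ℂ, Summable fun n : ℕ => ‖z ^ n / n.factorial‖ := fun z => by
    simpa using Real.summable_pow_div_factorial ‖z‖
  exact HasSum.mul (f := fun n : ℕ => x ^ n / n.factorial) (g := fun n : ℕ => y ^ n / n.factorial) (hexp x) (hexp y)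
    (summable_mul_of_summable_norm (f := fun n : ℕ => x ^ n / n.factorial) (g := fun n : ℕ => y ^ n / n.factorial) (hn x) (hn y))

lemma circ_series (a b : ℂ) {ρ : ℝ} (hρ : 0 < ρ) :
    (∮ w in C(0, ρ), exp (a * w + b / w)) = 2 * π * I * resS a b := by
  set c : ℕ × ℕ → ℂ := fun p => (a ^ p.1 / p.1.factorial) * (b ^ p.2 / p.2.factorial) with hc
  have hcm : ∀ θ, circleMap 0 ρ θ ≠ 0 := fun θ => circleMap_ne_center hρ.ne'
  have hexpr : ∀ z : ℝ, Summable fun n : ℕ => z ^ n / n.factorial := Real.summable_pow_div_factorial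
  have key : HasSum (fun p : ℕ × ℕ => ∮ w in C(0, ρ), c p * w ^ ((p.1 : ℤ) - p.2))
      (∮ w in C(0, ρ), exp (a * w + b / w)) := by
    have hb : ∀ (p : ℕ × ℕ) (θ : ℝ), ‖c p * circleMap 0 ρ θ ^ ((p.1 : ℤ) - p.2)‖ =
        ((‖a‖ * ρ) ^ p.1 / p.1.factorial) * ((‖b‖ / ρ) ^ p.2 / p.2.factorial) := by
      intro p θ
      rw [hc, zpow_sub₀ (hcm θ)]
      simp only [norm_mul, norm_div, norm_pow, norm_natCast, zpow_natCast, norm_circleMap_zero, abs_of_pos hρ]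
      rw [mul_pow, div_pow]; field_simp
    have hS : Summable fun p : ℕ × ℕ => ((‖a‖ * ρ) ^ p.1 / p.1.factorial) * ((‖b‖ / ρ) ^ p.2 / p.2.factorial) :=
      (hexpr (‖a‖ * ρ)).mul_of_nonneg (hexpr (‖b‖ / ρ)) (fun n => by positivity) (fun n => by positivity)
    unfold circleIntegral
    refine intervalIntegral.hasSum_integral_of_dominated_convergence
      (fun p _ => ρ * (((‖a‖ * ρ) ^ p.1 / p.1.factorial) * ((‖b‖ / ρ) ^ p.2 / p.2.factorial)))
      (fun p => Continuous.aestronglyMeasurable ?_) (fun p => Filter.Eventually.of_forall fun θ _ => ?_)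
      (Filter.Eventually.of_forall fun θ _ => hS.mul_left ρ) (continuous_const.intervalIntegrable _ _)
      (Filter.Eventually.of_forall fun θ _ => HasSum.const_smul _ ?_)
    · simp only [deriv_circleMap]
      have := continuous_circleMap 0 ρ
      exact (this.mul continuous_const).smul (continuous_const.mul (this.zpow₀ _ fun θ => Or.inl (hcm θ)))
    · rw [norm_smul, hb, deriv_circleMap, norm_mul, norm_I, mul_one, norm_circleMap_zero, abs_of_pos hρ]
    · have e : ∀ p : ℕ × ℕ, c p * circleMap 0 ρ θ ^ ((p.1 : ℤ) - p.2) = ((a * circleMap 0 ρ θ) ^ p.1 / p.1.factorial) *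
          ((b / circleMap 0 ρ θ) ^ p.2 / p.2.factorial) := fun p => by
        simp only [hc]
        rw [zpow_sub₀ (hcm θ), zpow_natCast, zpow_natCast, mul_pow, div_pow]
        have := hcm θ
        field_simp
      beta_reduce
      rw [exp_add]
      exact (congrArg (HasSum · _) (funext e)).mpr (exp_dbl _ _)
  have h2 : ∀ p : ℕ × ℕ, (∮ w in C(0, ρ), c p * w ^ ((p.1 : ℤ) - p.2)) =
      if p.2 = p.1 + 1 then 2 * π * I * c p else 0 := by
    intro p
    rw [circleIntegral.integral_const_mul]
    split_ifs with h
    · rw [h, show ((p.1 : ℤ) - (p.1 + 1 : ℕ)) = -1 by push_cast; ring]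
      have := circleIntegral.integral_sub_center_inv 0 hρ.ne'
      simp only [sub_zero] at this
      simp only [zpow_neg_one, this]; ring
    · have := circleIntegral.integral_sub_zpow_of_ne (n := (p.1 : ℤ) - p.2) (by omega) 0 0 ρ
      simp only [sub_zero] at this
      rw [this, mul_zero]
  simp only [h2] at key
  have hinj : Function.Injective fun j : ℕ => (j, j + 1) := fun x y h => (Prod.mk.inj h).1
  rw [← hinj.hasSum_iff] at key
  · rw [← key.tsum_eq, resS, ← tsum_mul_left]
    refine tsum_congr fun j => ?_
    simp [hc, div_mul_div_comm]
  · rintro ⟨i, j⟩ h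
    rw [if_neg]
    rintro h'
    exact h ⟨i, by simp_all⟩

lemma core_int {a b y α : ℝ} (ha : 0 ≤ a) (hb : 0 ≤ b) (hy : 0 < y) (hα : 0 < α) :
    ‖(∫ θ in (-α)..α, exp (a * (y + θ * I) + b / (y + θ * I))) - 2 * π * resS a b‖ ≤
      2 * π * ((y + α) * Real.exp (a * (y + α) + b * (y / α ^ 2))) := by
  set z : ℂ := y + α * I with hz
  have zre : z.re = y := by simp [hz]
  have zim : z.im = α := by simp [hz]
  have hz0 : z ≠ 0 := fun h => by rw [h] at zre; simp at zre; exact hy.ne zre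
  set ρ := ‖z‖ with hρ
  have hρ0 : 0 < ρ := norm_pos_iff.mpr hz0
  have hρ2 : ρ ^ 2 = y ^ 2 + α ^ 2 := by rw [hρ, ← normSq_eq_norm_sq, normSq_apply, zre, zim]; ring
  have hρle : ρ ≤ y + α := by nlinarith
  set φ := arg z with hφ
  have hcos : ρ * Real.cos φ = y := by rw [hρ, hφ, norm_mul_cos_arg, zre]
  have hsin : ρ * Real.sin φ = α := by rw [hρ, hφ, norm_mul_sin_arg, zim]
  have hφ0 : 0 ≤ φ := arg_nonneg_iff.mpr (by rw [zim]; exact hα.le)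
  have hφ1 : φ ≤ π := arg_le_pi z
  have cmre : ∀ t, (circleMap 0 ρ t).re = ρ * Real.cos t := fun t => by simp [circleMap_zero, exp_ofReal_mul_I_re]
  have cmim : ∀ t, (circleMap 0 ρ t).im = ρ * Real.sin t := fun t => by simp [circleMap_zero, exp_ofReal_mul_I_im]
  have hcm : ∀ t, circleMap 0 ρ t ≠ 0 := fun θ => circleMap_ne_center hρ0.ne'
  set Φ : ℂ → ℂ := fun w => exp (a * w + b / w) with hΦ
  have hd : ∀ w, w ≠ 0 → DifferentiableAt ℂ Φ w := fun w hw => by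
    refine DifferentiableAt.cexp (by fun_prop (disch := assumption))
  have hball : ∀ w : ℂ, y ≤ w.re → ‖w‖ ^ 2 ≤ ρ ^ 2 → w ∈ Metric.ball ((ρ ^ 2 / y : ℝ) : ℂ) (ρ ^ 2 / y) := by
    intro w h1 h2
    rw [← normSq_eq_norm_sq, normSq_apply] at h2
    have hR : 0 < ρ ^ 2 / y := by positivity
    rw [Metric.mem_ball, dist_eq_norm, ← sq_lt_sq₀ (norm_nonneg _) hR.le, ← normSq_eq_norm_sq, normSq_apply]
    simp only [sub_re, sub_im, ofReal_re, ofReal_im, sub_zero]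
    have : ρ ^ 2 ≤ (ρ ^ 2 / y) * w.re := by rw [div_mul_eq_mul_div, le_div_iff₀ hy]; gcongr
    nlinarith [pow_pos hρ0 2]
  obtain ⟨g, hg⟩ : IsExactOn Φ (Metric.ball ((ρ ^ 2 / y : ℝ) : ℂ) (ρ ^ 2 / y)) := by
    refine DifferentiableOn.isExactOn_ball fun w hw => (hd w ?_).differentiableWithinAt
    rintro rfl
    rw [Metric.mem_ball, dist_zero_left, norm_real, Real.norm_of_nonneg (by positivity)] at hw
    exact lt_irrefl _ hw
  have hcont : Continuous fun t : ℝ => deriv (circleMap 0 ρ) t • Φ (circleMap 0 ρ t) := by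
    simp only [deriv_circleMap]
    have := continuous_circleMap 0 ρ
    refine (this.mul continuous_const).smul ?_
    rw [hΦ]
    fun_prop (disch := exact hcm _)
  have hline : ∀ t : ℝ, (y + t * I : ℂ) ≠ 0 := fun t h => by
    have := congrArg re h; simp at this; exact hy.ne' this
  have h1 : (∫ t in (-α)..α, Φ (y + t * I) * I) = g z - g (y + (-α : ℝ) * I) := by
    refine intervalIntegral.integral_eq_sub_of_hasDerivAt (f := fun t : ℝ => g (y + t * I)) (fun t ht => ?_) ?_
    · rw [Set.uIcc_of_le (by linarith)] at ht
      have hw : (y + t * I : ℂ) ∈ Metric.ball ((ρ ^ 2 / y : ℝ) : ℂ) (ρ ^ 2 / y) := by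
        refine hball _ (by simp) ?_
        rw [← normSq_eq_norm_sq, normSq_apply, hρ2]
        simp
        nlinarith [ht.1, ht.2]
      have h2 : HasDerivAt (fun t : ℝ => (y + t * I : ℂ)) I t := by
        simpa using ((ofRealCLM.hasDerivAt (x := t)).mul_const I).const_add (y : ℂ)
      exact (hg _ hw).comp t h2
    · refine Continuous.intervalIntegrable ?_ _ _
      rw [hΦ]
      fun_prop (disch := exact hline _)
  have h2 : (∫ t in (-φ)..φ, deriv (circleMap 0 ρ) t • Φ (circleMap 0 ρ t)) =
      g (circleMap 0 ρ φ) - g (circleMap 0 ρ (-φ)) := by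
    refine intervalIntegral.integral_eq_sub_of_hasDerivAt (f := fun t : ℝ => g (circleMap 0 ρ t)) (fun t ht => ?_)
      (hcont.intervalIntegrable _ _)
    rw [Set.uIcc_of_le (by linarith)] at ht
    have hw : circleMap 0 ρ t ∈ Metric.ball ((ρ ^ 2 / y : ℝ) : ℂ) (ρ ^ 2 / y) := by
      refine hball _ ?_ (by rw [norm_circleMap_zero, abs_of_pos hρ0])
      rw [cmre, ← hcos]
      refine mul_le_mul_of_nonneg_left ?_ hρ0.le
      rw [← Real.cos_abs t]
      exact Real.cos_le_cos_of_nonneg_of_le_pi (abs_nonneg t) hφ1 (abs_le.mpr ht)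
    have := (hg _ hw).comp t (hasDerivAt_circleMap 0 ρ t)
    rw [deriv_circleMap, smul_eq_mul, mul_comm]; exact this
  have e1 : circleMap 0 ρ φ = z := Complex.ext (by rw [cmre, hcos, zre]) (by rw [cmim, hsin, zim])
  have e2 : circleMap 0 ρ (-φ) = y + (-α : ℝ) * I :=
    Complex.ext (by rw [cmre, Real.cos_neg, hcos]; simp) (by rw [cmim, Real.sin_neg]; simp; exact hsin)
  have hper : Function.Periodic (fun t : ℝ => deriv (circleMap 0 ρ) t • Φ (circleMap 0 ρ t)) (2 * π) := fun t => by
    simp only [deriv_circleMap, periodic_circleMap 0 ρ t]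
  have h3 := hper.intervalIntegral_add_eq (-φ) 0
  rw [zero_add, ← intervalIntegral.integral_add_adjacent_intervals (b := φ) (hcont.intervalIntegrable _ _)
    (hcont.intervalIntegrable _ _), h2, e1, e2, ← h1, intervalIntegral.integral_mul_const] at h3
  have h4 := circ_series a b hρ0
  rw [circleIntegral, ← h3] at h4
  have h5 : ‖∫ t in φ..(-φ + 2 * π), deriv (circleMap 0 ρ) t • Φ (circleMap 0 ρ t)‖ ≤
      ((y + α) * Real.exp (a * (y + α) + b * (y / α ^ 2))) * |(-φ + 2 * π) - φ| := by
    refine intervalIntegral.norm_integral_le_of_norm_le_const fun t ht => ?_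
    rw [Set.uIoc_of_le (by linarith)] at ht
    rw [norm_smul, deriv_circleMap, norm_mul, norm_I, mul_one, norm_circleMap_zero, abs_of_pos hρ0, hΦ, norm_exp]
    have hre : (a * circleMap 0 ρ t + b / circleMap 0 ρ t : ℂ).re ≤ a * (y + α) + b * (y / α ^ 2) := by
      have hc : Real.cos t ≤ Real.cos φ := by
        rcases le_total t π with h | h
        · exact Real.cos_le_cos_of_nonneg_of_le_pi hφ0 h ht.1.le
        · rw [← Real.cos_two_pi_sub t]
          exact Real.cos_le_cos_of_nonneg_of_le_pi hφ0 (by linarith) (by linarith [ht.2])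
      have hx : (circleMap 0 ρ t).re ≤ y := by rw [cmre, ← hcos]; gcongr
      have e : (b / circleMap 0 ρ t : ℂ).re = b * ((circleMap 0 ρ t).re / ρ ^ 2) := by
        rw [div_re, normSq_eq_norm_sq, norm_circleMap_zero, abs_of_pos hρ0]; simp; ring
      rw [add_re, e, re_ofReal_mul]
      refine add_le_add (mul_le_mul_of_nonneg_left (by linarith) ha) (mul_le_mul_of_nonneg_left ?_ hb)
      refine (div_le_div_of_nonneg_right hx (by positivity)).trans ?_
      exact div_le_div_of_nonneg_left hy.le (by positivity) (by rw [hρ2]; nlinarith)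
    exact mul_le_mul hρle (Real.exp_le_exp.mpr hre) (Real.exp_nonneg _) (by linarith)
  set X := ∫ t in (-α)..α, Φ (y + t * I) with hX
  set Y := ∫ t in φ..(-φ + 2 * π), deriv (circleMap 0 ρ) t • Φ (circleMap 0 ρ t)
  have h6 : X - 2 * π * resS a b = I * Y := by
    have := congrArg (fun u => -I * u) h4
    linear_combination this + (X - 2 * π * resS a b) * I_sq
  rw [h6, norm_mul, norm_I, one_mul]
  refine h5.trans ?_
  rw [mul_comm]
  refine mul_le_mul_of_nonneg_right ?_ (by positivity)
  rw [abs_le]; constructor <;> linarith [Real.pi_pos]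

/-- finite q-Pochhammer -/
def qp (Q : ℂ) (n : ℕ) : ℂ := ∏ i ∈ range n, (1 - Q ^ (i + 1))

def rq (Q : ℂ) (n : ℤ) : ℂ := if n < 0 then 0 else (qp Q n.toNat)⁻¹

lemma one_sub_pow_ne {Q : ℂ} (hQ : ‖Q‖ < 1) (n : ℕ) : 1 - Q ^ (n + 1) ≠ 0 := by
  intro h
  have h1 : Q ^ (n + 1) = 1 := (sub_eq_zero.mp h).symm
  have h2 : ‖Q‖ ^ (n + 1) = 1 := by rw [← norm_pow, h1, norm_one]
  have h3 : ‖Q‖ ^ (n + 1) < 1 := pow_lt_one₀ (norm_nonneg _) hQ (by omega)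
  linarith

lemma qp_ne {Q : ℂ} (hQ : ‖Q‖ < 1) (n : ℕ) : qp Q n ≠ 0 :=
  prod_ne_zero_iff.mpr fun i _ => one_sub_pow_ne hQ i

lemma rq_rec {Q : ℂ} (hQ : ‖Q‖ < 1) (n : ℤ) : rq Q (n - 1) = (1 - Q ^ n) * rq Q n := by
  rcases lt_trichotomy n 0 with h | h | h
  · rw [rq, rq, if_pos (by omega), if_pos h, mul_zero]
  · subst h; simp [rq]
  · obtain ⟨k, rfl⟩ : ∃ k : ℕ, n = k + 1 := ⟨(n - 1).toNat, by omega⟩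
    rw [rq, rq, if_neg (by omega), if_neg (by omega)]
    have e1 : ((k : ℤ) + 1 - 1).toNat = k := by omega
    have e2 : ((k : ℤ) + 1).toNat = k + 1 := by omega
    rw [e1, e2, qp, qp, prod_range_succ]
    have := one_sub_pow_ne hQ k
    have h2 := qp_ne hQ k
    rw [qp] at h2
    have e3 : Q ^ ((k : ℤ) + 1) = Q ^ (k + 1) := by exact_mod_cast zpow_natCast Q (k + 1)
    rw [e3]
    field_simp

def cN (Q : ℂ) (N : ℕ) (j : ℤ) : ℂ := qp Q (2 * N) * rq Q (N + j) * rq Q (N - j)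

lemma cN_succ {Q : ℂ} (h0 : Q ≠ 0) (hQ : ‖Q‖ < 1) (N : ℕ) (j : ℤ) :
    cN Q (N + 1) j = (1 + Q ^ (2 * N + 1)) * cN Q N j + Q ^ ((N : ℤ) + 1 - j) * cN Q N (j - 1)
      + Q ^ ((N : ℤ) + 1 + j) * cN Q N (j + 1) := by
  have r1 := rq_rec hQ ((N : ℤ) + 1 + j)
  have r2 := rq_rec hQ ((N : ℤ) + 1 + j - 1)
  have r3 := rq_rec hQ ((N : ℤ) + 1 - j)
  have r4 := rq_rec hQ ((N : ℤ) + 1 - j - 1)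
  have hx : Q ^ ((N : ℤ) + 1 + j - 1) = Q ^ ((N : ℤ) + 1 + j) / Q := zpow_sub_one₀ h0 _
  have hy : Q ^ ((N : ℤ) + 1 - j - 1) = Q ^ ((N : ℤ) + 1 - j) / Q := zpow_sub_one₀ h0 _
  have hxy : Q ^ (2 * N + 1) = Q ^ ((N : ℤ) + 1 + j) * Q ^ ((N : ℤ) + 1 - j) / Q := by
    rw [eq_div_iff h0, ← pow_succ, ← zpow_add₀ h0, ← zpow_natCast]; congr 1; push_cast; ring
  have hxy2 : Q ^ (2 * N + 1 + 1) = Q ^ ((N : ℤ) + 1 + j) * Q ^ ((N : ℤ) + 1 - j) := by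
    rw [← zpow_add₀ h0, ← zpow_natCast]; congr 1; push_cast; ring
  have q2 : qp Q (2 * (N + 1)) = qp Q (2 * N) * (1 - Q ^ (2 * N + 1)) * (1 - Q ^ (2 * N + 1 + 1)) := by
    rw [show 2 * (N + 1) = 2 * N + 1 + 1 by ring, qp, prod_range_succ, prod_range_succ, qp]
  unfold cN
  rw [q2, hxy2, hxy]
  rw [show ((N + 1 : ℕ) : ℤ) + j = N + 1 + j by push_cast; ring,
    show ((N + 1 : ℕ) : ℤ) - j = N + 1 - j by push_cast; ring,
    show (N : ℤ) + j = N + 1 + j - 1 by ring, show (N : ℤ) - j = N + 1 - j - 1 by ring,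
    show (N : ℤ) + (j - 1) = N + 1 + j - 1 - 1 by ring, show (N : ℤ) - (j - 1) = N + 1 - j by ring,
    show (N : ℤ) + (j + 1) = N + 1 + j by ring, show (N : ℤ) - (j + 1) = N + 1 - j - 1 - 1 by ring]
  rw [r2, r4, r1, r3, hx, hy]
  generalize Q ^ ((N : ℤ) + 1 + j) = x
  generalize Q ^ ((N : ℤ) + 1 - j) = y
  field_simp
  ring

def tJ (z τ : ℂ) (j : ℤ) : ℂ := jacobiTheta₂_term j (z + 1 / 2 - τ / 2) τ

lemma tJ_rec (z τ : ℂ) (j : ℤ) : tJ z τ (j + 1) = -(ec z * ec τ ^ j) * tJ z τ j := by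
  have : -(ec z * ec τ ^ j) = ec (z + j * τ + 1 / 2) := by
    rw [ec_add, ec_add, ec_half, ec_int_mul]; ring
  rw [this, tJ, tJ, jacobiTheta₂_term, jacobiTheta₂_term, ec, ← Complex.exp_add]
  congr 1; push_cast; ring

def PN (Q w : ℂ) (N : ℕ) : ℂ := ∏ n ∈ range N, ((1 - Q ^ n * w) * (1 - Q ^ (n + 1) / w))

lemma norm_ec_lt {τ : ℂ} (h : 0 < τ.im) : ‖ec τ‖ < 1 := by
  rw [norm_ec, Real.exp_lt_one_iff]; nlinarith [Real.pi_pos]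

lemma hasSum_PN {τ : ℂ} (hτ : 0 < τ.im) (z : ℂ) (N : ℕ) :
    HasSum (fun j : ℤ => cN (ec τ) N j * tJ z τ j) (PN (ec τ) (ec z) N) := by
  have hQ := norm_ec_lt hτ
  have hw := ec_ne_zero z
  have h0 := ec_ne_zero τ
  induction N with
  | zero =>
    have : PN (ec τ) (ec z) 0 = cN (ec τ) 0 0 * tJ z τ 0 := by
      simp [PN, cN, rq, qp, tJ, jacobiTheta₂_term]
    rw [this]
    refine hasSum_single 0 fun j hj => ?_
    have : j < 0 ∨ -j < 0 := by omega
    rcases this with h | h <;> simp [cN, rq, h]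
    intro h1; omega
  | succ N ih =>
    have s1 := ih.mul_left (1 + ec τ ^ (2 * N + 1))
    have s2 := ((Equiv.addRight (-1 : ℤ)).hasSum_iff.mpr ih).mul_left (-(ec τ ^ N * ec z))
    have s3 := ((Equiv.addRight (1 : ℤ)).hasSum_iff.mpr ih).mul_left (-(ec τ ^ (N + 1) / ec z))
    have s := (s1.add s2).add s3
    have e : (1 + ec τ ^ (2 * N + 1)) * PN (ec τ) (ec z) N + -(ec τ ^ N * ec z) * PN (ec τ) (ec z) N
        + -(ec τ ^ (N + 1) / ec z) * PN (ec τ) (ec z) N = PN (ec τ) (ec z) (N + 1) := by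
      rw [PN, PN, prod_range_succ]; field_simp; ring
    rw [e] at s
    refine s.congr_fun ?_
    intro j
    simp only [Function.comp, Equiv.coe_addRight]
    rw [cN_succ h0 hQ]
    have t1 := tJ_rec z τ j
    have t2 := tJ_rec z τ (j - 1)
    rw [show j - 1 + 1 = j by ring] at t2
    rw [← sub_eq_add_neg, t1, t2]
    have z1 : ec τ ^ ((N : ℤ) + 1 - j) * ec τ ^ (j - 1) = ec τ ^ N := by
      rw [← zpow_add₀ h0, ← zpow_natCast]; congr 1; ring
    have z2 : ec τ ^ ((N : ℤ) + 1 + j) = ec τ ^ (N + 1) * ec τ ^ j := by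
      rw [zpow_add₀ h0]; congr 1
    rw [z2, ← z1]
    field_simp
    ring

def BB (Q w : ℂ) : ℂ := ∏' n : ℕ, ((1 - Q ^ n * w) * (1 - Q ^ (n + 1) / w))

def bterm (Q w : ℂ) (n : ℕ) : ℂ := - Q ^ n * w - Q ^ (n + 1) / w + Q ^ n * Q ^ (n + 1)

lemma bterm_eq {Q w : ℂ} (hw : w ≠ 0) (n : ℕ) :
    (1 - Q ^ n * w) * (1 - Q ^ (n + 1) / w) = 1 + bterm Q w n := by
  rw [bterm]; field_simp; ring

lemma summable_bterm {Q : ℂ} (hQ : ‖Q‖ < 1) (w : ℂ) : Summable fun n => ‖bterm Q w n‖ := by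
  have s := summable_geometric_of_lt_one (norm_nonneg Q) hQ
  refine Summable.of_nonneg_of_le (fun _ => norm_nonneg _) (fun n => ?_)
    (s.mul_left (‖w‖ + ‖w⁻¹‖ + 1))
  have h1 : ‖Q‖ ^ n ≤ 1 := pow_le_one₀ (norm_nonneg _) hQ.le
  have h2 : ‖Q‖ ^ (n + 1) ≤ ‖Q‖ ^ n := pow_le_pow_of_le_one (norm_nonneg _) hQ.le (by omega)
  have h3 : 0 ≤ ‖Q‖ ^ n := by positivity
  calc ‖bterm Q w n‖ ≤ ‖- Q ^ n * w‖ + ‖Q ^ (n + 1) / w‖ + ‖Q ^ n * Q ^ (n + 1)‖ := by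
        rw [bterm]; exact (norm_add_le _ _).trans (by gcongr; exact norm_sub_le _ _)
    _ = ‖Q‖ ^ n * ‖w‖ + ‖Q‖ ^ (n + 1) * ‖w⁻¹‖ + ‖Q‖ ^ n * ‖Q‖ ^ (n + 1) := by
        simp [div_eq_mul_inv]
    _ ≤ ‖Q‖ ^ n * ‖w‖ + ‖Q‖ ^ n * ‖w⁻¹‖ + ‖Q‖ ^ n * 1 := by gcongr; linarith
    _ = _ := by ring

lemma tendsto_PN {Q w : ℂ} (hQ : ‖Q‖ < 1) (hw : w ≠ 0) :
    Filter.Tendsto (PN Q w) Filter.atTop (nhds (BB Q w)) := by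
  have h : Multipliable fun n : ℕ => ((1 - Q ^ n * w) * (1 - Q ^ (n + 1) / w)) := by
    simp_rw [bterm_eq hw]
    exact multipliable_one_add_of_summable (summable_bterm hQ w)
  exact h.hasProd.tendsto_prod_nat

def qpi (Q : ℂ) : ℂ := ∏' n : ℕ, (1 - Q ^ (n + 1))

lemma summable_pow_succ {Q : ℂ} (hQ : ‖Q‖ < 1) : Summable fun n : ℕ => ‖-Q ^ (n + 1)‖ := by
  simp only [norm_neg, norm_pow]
  exact (summable_nat_add_iff 1).mpr (summable_geometric_of_lt_one (norm_nonneg Q) hQ)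

lemma tendsto_qp {Q : ℂ} (hQ : ‖Q‖ < 1) :
    Filter.Tendsto (qp Q) Filter.atTop (nhds (qpi Q)) := by
  have h : Multipliable fun n : ℕ => (1 - Q ^ (n + 1)) := by
    simp_rw [sub_eq_add_neg]
    exact multipliable_one_add_of_summable (summable_pow_succ hQ)
  exact h.hasProd.tendsto_prod_nat

lemma qpi_ne {Q : ℂ} (hQ : ‖Q‖ < 1) : qpi Q ≠ 0 := by
  have := tprod_one_add_ne_zero_of_summable (f := fun n : ℕ => -Q ^ (n + 1))
    (fun n => by rw [← sub_eq_add_neg]; exact one_sub_pow_ne hQ n) (summable_pow_succ hQ)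
  simpa [qpi, sub_eq_add_neg] using this

lemma tendsto_rq {Q : ℂ} (hQ : ‖Q‖ < 1) :
    Filter.Tendsto (rq Q) Filter.atTop (nhds (qpi Q)⁻¹) := by
  have h1 : Filter.Tendsto (fun n : ℤ => n.toNat) Filter.atTop Filter.atTop :=
    Filter.tendsto_atTop.mpr fun b => by
      filter_upwards [Filter.eventually_ge_atTop (b : ℤ)] with n hn; omega
  have h2 := ((tendsto_qp hQ).comp h1).inv₀ (qpi_ne hQ)
  refine h2.congr' ?_
  filter_upwards [Filter.eventually_ge_atTop (0 : ℤ)] with n hn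
  simp [rq, not_lt.mpr hn]

lemma rq_bdd {Q : ℂ} (hQ : ‖Q‖ < 1) : ∃ C, 0 ≤ C ∧ ∀ n, ‖rq Q n‖ ≤ C := by
  have h := ((tendsto_qp hQ).inv₀ (qpi_ne hQ)).norm
  obtain ⟨C, hC⟩ := h.bddAbove_range
  refine ⟨max C 0, le_max_right _ _, fun n => ?_⟩
  rw [rq]
  split_ifs with hn
  · simp
  · exact (hC ⟨n.toNat, rfl⟩).trans (le_max_left _ _)

lemma jtp {τ : ℂ} (hτ : 0 < τ.im) (z : ℂ) :
    qpi (ec τ) * BB (ec τ) (ec z) = jacobiTheta₂ (z + 1 / 2 - τ / 2) τ := by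
  have hQ := norm_ec_lt hτ
  obtain ⟨C, hC0, hC⟩ := rq_bdd hQ
  obtain ⟨C', hC'⟩ := (tendsto_qp hQ).norm.bddAbove_range
  have key : Filter.Tendsto (fun N : ℕ => ∑' j : ℤ, cN (ec τ) N j * tJ z τ j) Filter.atTop
      (nhds (∑' j : ℤ, (qpi (ec τ))⁻¹ * tJ z τ j)) := by
    have hs : Summable fun j : ℤ => ‖tJ z τ j‖ :=
      ((summable_jacobiTheta₂_term_iff (z + 1 / 2 - τ / 2) τ).mpr hτ).norm
    refine tendsto_tsum_of_dominated_convergence (hs.mul_left (C' * C * C)) (fun j => ?_) ?_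
    · refine Filter.Tendsto.mul_const _ ?_
      have a1 : Filter.Tendsto (fun N : ℕ => qp (ec τ) (2 * N)) Filter.atTop (nhds (qpi (ec τ))) :=
        (tendsto_qp hQ).comp (Filter.tendsto_id.const_mul_atTop' (by norm_num))
      have a2 : Filter.Tendsto (fun N : ℕ => rq (ec τ) (N + j)) Filter.atTop (nhds (qpi (ec τ))⁻¹) :=
        (tendsto_rq hQ).comp (Filter.tendsto_atTop_add_const_right _ _ tendsto_natCast_atTop_atTop)
      have a3 : Filter.Tendsto (fun N : ℕ => rq (ec τ) (N - j)) Filter.atTop (nhds (qpi (ec τ))⁻¹) :=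
        (tendsto_rq hQ).comp (Filter.tendsto_atTop_add_const_right _ (-j) tendsto_natCast_atTop_atTop)
      have := (a1.mul a2).mul a3
      rwa [mul_inv_cancel₀ (qpi_ne hQ), one_mul] at this
    · refine Filter.Eventually.of_forall fun N j => ?_
      rw [norm_mul, cN, norm_mul, norm_mul]
      have := hC' ⟨2 * N, rfl⟩
      simp only at this
      have h0 : 0 ≤ C' := (norm_nonneg _).trans this
      gcongr
      · exact hC _
      · exact hC _
  have e : (fun N : ℕ => ∑' j : ℤ, cN (ec τ) N j * tJ z τ j) = PN (ec τ) (ec z) :=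
    funext fun N => (hasSum_PN hτ z N).tsum_eq
  rw [e] at key
  have := tendsto_nhds_unique key (tendsto_PN hQ (ec_ne_zero z))
  rw [← this, tsum_mul_left, ← mul_assoc, mul_inv_cancel₀ (qpi_ne hQ), one_mul]
  rfl

/-- Siegel function -/
def sg (a b τ : ℂ) : ℂ := ec (τ * (a ^ 2 - a + 1 / 6) / 2 + b * (a - 1) / 2) * BB (ec τ) (ec (a * τ + b))

lemma eta_eq {τ : ℂ} (_hτ : 0 < τ.im) : ModularForm.eta τ = ec (τ / 24) * qpi (ec τ) := by
  rw [ModularForm.eta, qpi, Function.Periodic.qParam]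
  congr 1
  · rw [ec]; congr 1; push_cast; ring
  · simp_rw [ModularForm.eta_q_eq_pow]; rfl

lemma sg_theta {τ : ℂ} (hτ : 0 < τ.im) (a b : ℂ) :
    sg a b τ = ec (τ * (a ^ 2 - a) / 2 + τ / 8 + b * (a - 1) / 2) *
      jacobiTheta₂ (a * τ + b + 1 / 2 - τ / 2) τ / ModularForm.eta τ := by
  rw [eta_eq hτ, ← jtp hτ, sg,
    show τ * (a ^ 2 - a) / 2 + τ / 8 + b * (a - 1) / 2 =
      (τ * (a ^ 2 - a + 1 / 6) / 2 + b * (a - 1) / 2) + τ / 24 by ring,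
    ec_add _ (τ / 24)]
  have h1 := ec_ne_zero (τ / 24)
  have h2 := qpi_ne (norm_ec_lt hτ)
  generalize ec (τ / 24) = u at *
  generalize ec (τ * (a ^ 2 - a + 1 / 6) / 2 + b * (a - 1) / 2) = v
  generalize qpi (ec τ) = u' at *
  generalize BB (ec τ) (ec (a * τ + b)) = v'
  field_simp

lemma sg_T (a b τ : ℂ) (n : ℤ) : sg a b (τ + n) = ec (n / 12) * sg a (b + n * a) τ := by
  rw [sg, sg, ec_add_int, ← mul_assoc, ← ec_add]
  congr 2 <;> ring_nf

lemma sg_shift2 (a b τ : ℂ) (n : ℤ) : sg a (b + n) τ = ec (n * (a - 1) / 2) * sg a b τ := by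
  rw [sg, sg, ← add_assoc, ec_add_int, ← mul_assoc, ← ec_add]
  congr 2; ring

lemma cexp_ec (x : ℂ) : cexp (-π * I * x) = ec (-x / 2) := by
  rw [ec]; congr 1; ring

lemma sg_shift1' {τ : ℂ} (hτ : 0 < τ.im) (a b : ℂ) : sg (a + 1) b τ = ec ((1 - b) / 2) * sg a b τ := by
  rw [sg_theta hτ, sg_theta hτ,
    show (a + 1) * τ + b + 1 / 2 - τ / 2 = (a * τ + b + 1 / 2 - τ / 2) + τ by ring,
    jacobiTheta₂_add_left', cexp_ec, ← mul_assoc, ← mul_div_assoc, ← mul_assoc, ← ec_add, ← ec_add]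
  congr 2
  refine ec_eq_of_sub_int (-1) ?_
  push_cast; ring

lemma sg_shift1 {τ : ℂ} (hτ : 0 < τ.im) (a b : ℂ) (n : ℤ) :
    sg (a + n) b τ = ec (n * (1 - b) / 2) * sg a b τ := by
  induction n using Int.induction_on with
  | zero => simp [ec_zero]
  | succ n ih =>
    push_cast at ih ⊢
    rw [← add_assoc, sg_shift1' hτ, ih, ← mul_assoc, ← ec_add]; congr 2; ring
  | pred n ih =>
    have h := sg_shift1' hτ (a + ((-(n:ℤ) - 1 : ℤ) : ℂ)) b
    rw [show a + ((-(n:ℤ) - 1 : ℤ) : ℂ) + 1 = a + ((-(n:ℤ) : ℤ) : ℂ) by push_cast; ring, ih] at h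
    have h2 := ec_ne_zero ((1 - b) / 2)
    rw [← mul_right_inj' h2, ← h, ← mul_assoc, ← ec_add]; congr 2; push_cast; ring

lemma sg_neg {τ : ℂ} (hτ : 0 < τ.im) (a b : ℂ) : sg (-a) (-b) τ = - sg a b τ := by
  rw [sg_theta hτ, sg_theta hτ, ← jacobiTheta₂_neg_left,
    show -(-a * τ + -b + 1 / 2 - τ / 2) = (a * τ + b - 1 / 2 - τ / 2) + τ by ring,
    jacobiTheta₂_add_left', cexp_ec, ← jacobiTheta₂_add_left, ← mul_assoc, ← ec_add,
    ← neg_div, ← neg_mul]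
  rw [show ∀ x, -ec x = ec (1 / 2 + x) from fun x => by rw [ec_add, ec_half]; ring]
  rw [show a * τ + b - 1 / 2 - τ / 2 + 1 = a * τ + b + 1 / 2 - τ / 2 by ring]
  congr 3
  ring

lemma sqrt_aux {τ : ℂ} (hτ : 0 < τ.im) :
    (Complex.sqrt I)⁻¹ * Complex.sqrt τ = (-I * τ) ^ (1 / 2 : ℂ) := by
  have hI : I ≠ 0 := I_ne_zero
  have h0 : τ ≠ 0 := by rintro rfl; simp at hτ
  have h1 : -I * τ ≠ 0 := by simp [h0]
  have hre : 0 < (-I * τ).re := by simpa using hτ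
  have harg := abs_lt.mp (Complex.abs_arg_lt_pi_div_two_iff.mpr (Or.inl hre))
  have hl : log (I * (-I * τ)) = log I + log (-I * τ) := by
    rw [Complex.log_mul_eq_add_log_iff hI h1, Complex.arg_I]
    constructor <;> linarith
  have h2 : I * (-I * τ) = τ := by rw [← mul_assoc]; simp
  rw [h2] at hl
  rw [Complex.sqrt, Complex.sqrt, cpow_def_of_ne_zero hI, cpow_def_of_ne_zero h0,
    cpow_def_of_ne_zero h1, hl, ← Complex.exp_neg, ← Complex.exp_add]
  congr 1; ring

lemma im_neg_inv_pos {τ : ℂ} (hτ : 0 < τ.im) : 0 < (-1 / τ).im := by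
  rw [neg_div, neg_im, one_div, inv_im, neg_div, neg_neg]
  have h0 : τ ≠ 0 := by rintro rfl; simp at hτ
  exact div_pos hτ (normSq_pos.mpr h0)

lemma sg_S {τ : ℂ} (hτ : 0 < τ.im) (a b : ℂ) :
    sg a b (-1 / τ) = ec (-1 / 4) * sg b (-a) τ := by
  have h0 : τ ≠ 0 := by rintro rfl; simp at hτ
  have h1 : -I * τ ≠ 0 := by simp [h0]
  have hs : (-I * τ) ^ (1 / 2 : ℂ) ≠ 0 := by simp [h0]
  have he := ModularForm.eta_ne_zero (show τ ∈ UpperHalfPlane.upperHalfPlaneSet from hτ)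
  have h := ModularForm.eta_comp_eq_csqrt_I_inv (show τ ∈ UpperHalfPlane.upperHalfPlaneSet from hτ)
  simp only [Function.comp, Pi.smul_apply, Pi.mul_apply, smul_eq_mul, ← mul_assoc] at h
  rw [sqrt_aux hτ] at h
  have hf := jacobiTheta₂_functional_equation (b * τ - a + τ / 2 + 1 / 2) τ
  rw [sg_theta (im_neg_inv_pos hτ), sg_theta hτ, h]
  have e1 : a * (-1 / τ) + b + 1 / 2 - -1 / τ / 2 = (b * τ - a + τ / 2 + 1 / 2) / τ := by
    field_simp; ring
  rw [e1]
  rw [show b * τ - a + τ / 2 + 1 / 2 = (b * τ + -a + 1 / 2 - τ / 2) + τ by ring] at hf ⊢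
  rw [jacobiTheta₂_add_left', mul_div_assoc, cexp_ec, cexp_ec] at hf
  generalize jacobiTheta₂ (b * τ + -a + 1 / 2 - τ / 2) τ = X at hf ⊢
  generalize jacobiTheta₂ ((b * τ + -a + 1 / 2 - τ / 2 + τ) / τ) (-1 / τ) = Y at hf ⊢
  generalize (-I * τ) ^ (1 / 2 : ℂ) = s at hs hf ⊢
  have hY : Y = s * ec (((b * τ + -a + 1 / 2 - τ / 2 + τ) ^ 2 / τ) / 2 +
      -(τ + 2 * (b * τ + -a + 1 / 2 - τ / 2)) / 2) * X := by
    rw [ec_add, mul_assoc, mul_assoc, hf, neg_div, ec_neg]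
    have := ec_ne_zero ((b * τ + -a + 1 / 2 - τ / 2 + τ) ^ 2 / τ / 2)
    generalize ec ((b * τ + -a + 1 / 2 - τ / 2 + τ) ^ 2 / τ / 2) = v at *
    field_simp
  rw [hY]
  have : ec (-1 / τ * (a ^ 2 - a) / 2 + -1 / τ / 8 + b * (a - 1) / 2) *
     ec (((b * τ + -a + 1 / 2 - τ / 2 + τ) ^ 2 / τ) / 2 +
      -(τ + 2 * (b * τ + -a + 1 / 2 - τ / 2)) / 2) =
      ec (-1 / 4) * ec (τ * (b ^ 2 - b) / 2 + τ / 8 + -a * (b - 1) / 2) := by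
    rw [← ec_add, ← ec_add]; congr 1; field_simp; ring
  rw [← mul_div_assoc, ← mul_assoc (ec (-1 / 4)), ← this]
  generalize ec (-1 / τ * (a ^ 2 - a) / 2 + -1 / τ / 8 + b * (a - 1) / 2) = v
  generalize ec (((b * τ + -a + 1 / 2 - τ / 2 + τ) ^ 2 / τ) / 2 +
      -(τ + 2 * (b * τ + -a + 1 / 2 - τ / 2)) / 2) = v'
  field_simp

lemma differentiableAt_sg {τ : ℂ} (hτ : 0 < τ.im) (a b : ℂ) : DifferentiableAt ℂ (sg a b) τ := by
  have hd : DifferentiableAt ℂ (fun τ => ec (τ * (a ^ 2 - a) / 2 + τ / 8 + b * (a - 1) / 2) *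
      jacobiTheta₂ (a * τ + b + 1 / 2 - τ / 2) τ / ModularForm.eta τ) τ := by
    refine DifferentiableAt.div (DifferentiableAt.mul ?_ ?_)
      (ModularForm.differentiableAt_eta_of_mem_upperHalfPlaneSet hτ) (ModularForm.eta_ne_zero hτ)
    · exact differentiable_ec.differentiableAt.comp τ (by fun_prop)
    · have := (hasFDerivAt_jacobiTheta₂ (a * τ + b + 1 / 2 - τ / 2) hτ).differentiableAt
      exact this.comp (f := fun t => (a * t + b + 1 / 2 - t / 2, t)) τ (by fun_prop)
  refine hd.congr_of_eventuallyEq ?_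
  filter_upwards [UpperHalfPlane.isOpen_upperHalfPlaneSet.mem_nhds hτ] with t ht
  exact sg_theta ht a b

def ds (a : ℤ) (c : ℕ) : ℝ := ∑ n ∈ range c, saw ((a : ℝ) * n / c) * saw ((n : ℝ) / c)

lemma ds_eq (d c : ℕ) : dedekindSum d c = ds d c := by simp [dedekindSum, ds]

lemma saw_add_int (x : ℝ) (n : ℤ) : saw (x + n) = saw x := by simp [saw]

lemma saw_neg (x : ℝ) : saw (-x) = - saw x := by
  unfold saw
  by_cases h : Int.fract x = 0
  · rw [if_pos h, if_pos (Int.fract_neg_eq_zero.mpr h), neg_zero]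
  · rw [if_neg h, if_neg (by rwa [Int.fract_neg_eq_zero]), Int.fract_neg h]; ring

lemma ds_add (a n : ℤ) {c : ℕ} (hc : 0 < c) : ds (a + n * c) c = ds a c := by
  refine sum_congr rfl fun i _ => ?_
  rw [← saw_add_int ((a : ℝ) * i / c) (n * i)]
  congr 2
  have : (c : ℝ) ≠ 0 := by positivity
  push_cast; field_simp

lemma ds_neg (a : ℤ) (c : ℕ) : ds (-a) c = - ds a c := by
  rw [ds, ds, ← sum_neg_distrib]
  refine sum_congr rfl fun i _ => ?_
  rw [← neg_mul, ← saw_neg]; congr 2; push_cast; ring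

lemma sum_mul_mod {h k : ℕ} (hc : Nat.Coprime h k) (f : ℕ → ℝ) :
    ∑ n ∈ range k, f (h * n % k) = ∑ n ∈ range k, f n := by
  rcases Nat.eq_zero_or_pos k with rfl | hk
  · simp
  have hmaps : ∀ n ∈ range k, h * n % k ∈ range k := fun n _ => mem_range.mpr (Nat.mod_lt _ hk)
  have hinj : Set.InjOn (fun n => h * n % k) (range k : Set ℕ) := by
    intro x hx y hy hxy
    simp only [coe_range, Set.mem_Iio] at hx hy
    have h1 : h * x ≡ h * y [MOD k] := hxy
    exact (Nat.ModEq.cancel_left_of_coprime hc.symm h1).eq_of_lt_of_lt hx hy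
  exact sum_nbij (fun n => h * n % k) hmaps hinj
    (surjOn_of_injOn_of_card_le _ hmaps hinj le_rfl) fun _ _ => rfl

lemma saw_frac {ρ k : ℕ} (hk : 0 < k) (hρ : ρ < k) (h0 : ρ ≠ 0) :
    saw ((ρ : ℝ) / k) = (ρ : ℝ) / k - 1 / 2 := by
  have hk' : (0 : ℝ) < k := by positivity
  have hf : Int.fract ((ρ : ℝ) / k) = (ρ : ℝ) / k := by
    rw [Int.fract_eq_self]; constructor
    · positivity
    · rw [div_lt_one hk']; exact_mod_cast hρ
  rw [saw, hf, if_neg]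
  have : (0 : ℝ) < ρ := by exact_mod_cast Nat.pos_of_ne_zero h0
  positivity

lemma sum_range_real (k : ℕ) : ∑ n ∈ range k, (n : ℝ) = k * (k - 1) / 2 := by
  induction k with
  | zero => simp
  | succ k ih => rw [sum_range_succ, ih]; push_cast; ring

lemma sum_range_sq_real (k : ℕ) : ∑ n ∈ range k, (n : ℝ) ^ 2 = k * (k - 1) * (2 * k - 1) / 6 := by
  induction k with
  | zero => simp
  | succ k ih => rw [sum_range_succ, ih]; push_cast; ring

lemma modeq_real (h k n : ℕ) : ((h * n % k : ℕ) : ℝ) = h * n - k * ((h * n / k : ℕ) : ℝ) := by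
  have := Nat.mod_add_div (h * n) k
  have h2 : ((h * n % k : ℕ) : ℝ) + k * ((h * n / k : ℕ) : ℝ) = h * n := by exact_mod_cast this
  linarith

lemma saw_mul_eq {h k : ℕ} (hk : 0 < k) (hc : Nat.Coprime h k) {n : ℕ} (hn : n ∈ range k) :
    saw ((h : ℝ) * n / k) * saw ((n : ℝ) / k) =
     (((h * n % k : ℕ) : ℝ) / k - 1 / 2) * ((n : ℝ) / k - 1 / 2) - if n = 0 then 1 / 4 else 0 := by
  have hk' : (k : ℝ) ≠ 0 := by positivity
  split_ifs with h0
  · subst h0; simp [saw]; norm_num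
  · have hne : h * n % k ≠ 0 := by
      intro h1
      have h2 : k ∣ n := hc.symm.dvd_of_dvd_mul_left (Nat.dvd_of_mod_eq_zero h1)
      exact absurd (Nat.le_of_dvd (Nat.pos_of_ne_zero h0) h2) (by have := mem_range.mp hn; omega)
    rw [saw_frac hk (mem_range.mp hn) h0]
    have e : (h : ℝ) * n / k = ((h * n % k : ℕ) : ℝ) / k + ((h * n / k : ℕ) : ℤ) := by
      rw [modeq_real, Int.cast_natCast]; field_simp; ring
    rw [e, saw_add_int, saw_frac hk (Nat.mod_lt _ hk) hne, sub_zero]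

lemma ds_formula {h k : ℕ} (hk : 0 < k) (hc : Nat.Coprime h k) :
    (k : ℝ) ^ 2 * ds h k = h * (k * (k - 1) * (2 * k - 1) / 6)
      - k * ∑ n ∈ range k, (n : ℝ) * ((h * n / k : ℕ) : ℝ) - k ^ 2 * (k - 1) / 4 := by
  have hk' : (k : ℝ) ≠ 0 := by positivity
  have hp := sum_mul_mod hc (fun x => (x : ℝ))
  rw [sum_range_real] at hp
  have h1 : ds h k = ∑ n ∈ range k, ((((h * n % k : ℕ) : ℝ) / k - 1 / 2) * ((n : ℝ) / k - 1 / 2)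
      - if n = 0 then 1 / 4 else 0) := by
    rw [ds]; refine sum_congr rfl fun n hn => ?_
    rw [← saw_mul_eq hk hc hn]; simp
  rw [sum_sub_distrib, sum_ite_eq' (range k) 0, if_pos (mem_range.mpr hk)] at h1
  have h2 : ∀ n, (((h * n % k : ℕ) : ℝ) / k - 1 / 2) * ((n : ℝ) / k - 1 / 2) =
     (h / (k:ℝ) ^ 2) * (n : ℝ) ^ 2 - (1 / k) * ((n : ℝ) * ((h * n / k : ℕ) : ℝ)) -
     1 / (2 * k) * ((h * n % k : ℕ) : ℝ) - 1 / (2 * k) * n + 1 / 4 := by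
    intro n
    rw [modeq_real]; field_simp; ring
  simp_rw [h2] at h1
  rw [sum_add_distrib, sum_sub_distrib, sum_sub_distrib, sum_sub_distrib, ← mul_sum, ← mul_sum,
    ← mul_sum, ← mul_sum, hp, sum_range_real, sum_range_sq_real, sum_const, card_range] at h1
  rw [h1]; simp only [nsmul_eq_mul]; field_simp; ring

lemma sum_q {h k : ℕ} (hk : 0 < k) (hc : Nat.Coprime h k) :
    ∑ n ∈ range k, ((h * n / k : ℕ) : ℝ) = ((h : ℝ) - 1) * (k - 1) / 2 := by
  have hk' : (k : ℝ) ≠ 0 := by positivity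
  have hp := sum_mul_mod hc (fun x => (x : ℝ))
  simp_rw [modeq_real] at hp
  rw [sum_sub_distrib, ← mul_sum, ← mul_sum, sum_range_real] at hp
  rw [← mul_right_inj' hk']; linarith

lemma sum_q2 {h k : ℕ} (hc : Nat.Coprime h k) :
    (k : ℝ) ^ 2 * ∑ n ∈ range k, ((h * n / k : ℕ) : ℝ) ^ 2 =
      2 * h * k * ∑ n ∈ range k, (n : ℝ) * ((h * n / k : ℕ) : ℝ)
      - (h ^ 2 - 1) * (k * (k - 1) * (2 * k - 1) / 6) := by
  have hp := sum_mul_mod hc (fun x => (x : ℝ) ^ 2)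
  simp_rw [modeq_real] at hp
  have h2 : ∀ n : ℕ, ((h : ℝ) * n - k * ((h * n / k : ℕ) : ℝ)) ^ 2 = h ^ 2 * (n : ℝ) ^ 2
    - 2 * h * k * ((n : ℝ) * ((h * n / k : ℕ) : ℝ)) + k ^ 2 * ((h * n / k : ℕ) : ℝ) ^ 2 := by
    intro n; ring
  simp_rw [h2] at hp
  rw [sum_add_distrib, sum_sub_distrib, ← mul_sum, ← mul_sum, ← mul_sum, sum_range_sq_real] at hp
  linarith

lemma sum_odd (q : ℕ) : ∑ m ∈ range q, (2 * (m : ℝ) + 1) = (q : ℝ) ^ 2 := by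
  induction q with
  | zero => simp
  | succ k ih => rw [sum_range_succ, ih]; push_cast; ring

lemma sum_q2' {h k : ℕ} (hh : 0 < h) (hk : 0 < k) (hc : Nat.Coprime h k) :
    ∑ n ∈ range k, ((h * n / k : ℕ) : ℝ) ^ 2 =
      ∑ m ∈ range h, (2 * (m : ℝ) - 1) * (k - 1 - ((k * m / h : ℕ) : ℝ)) + (k - 1) := by
  obtain ⟨h', rfl⟩ : ∃ h', h = h' + 1 := ⟨h - 1, by omega⟩
  rw [sum_range_succ' _ h']
  simp only [Nat.cast_zero, mul_zero, Nat.zero_div]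
  have e1 : ∀ n ∈ range k, (((h' + 1) * n / k : ℕ) : ℝ) ^ 2 =
      ∑ m ∈ range h', if m < (h' + 1) * n / k then 2 * (m : ℝ) + 1 else 0 := by
    intro n hn
    rw [← sum_odd, ← sum_filter]
    congr 1
    ext m; simp only [mem_range, mem_filter]
    constructor
    · intro hm
      refine ⟨?_, hm⟩
      have : (h' + 1) * n / k < h' + 1 := by
        rw [Nat.div_lt_iff_lt_mul hk]
        exact Nat.mul_lt_mul_of_pos_left (mem_range.mp hn) hh
      omega
    · exact fun h => h.2
  rw [sum_congr rfl e1, sum_comm]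
  have e2 : ∀ m ∈ range h', (∑ n ∈ range k, if m < (h' + 1) * n / k then 2 * (m : ℝ) + 1 else 0) =
      (2 * ((m + 1 : ℕ) : ℝ) - 1) * (k - 1 - ((k * (m + 1) / (h' + 1) : ℕ) : ℝ)) := by
    intro m hm
    have hm' := mem_range.mp hm
    have hp : k * (m + 1) / (h' + 1) < k := by
      rw [Nat.div_lt_iff_lt_mul hh]
      exact Nat.mul_lt_mul_of_pos_left (by omega) hk
    have key : ∀ n, m < (h' + 1) * n / k ↔ k * (m + 1) / (h' + 1) + 1 ≤ n := by
      intro n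
      rw [← Nat.succ_le_iff, Nat.succ_eq_add_one, Nat.le_div_iff_mul_le hk, Nat.succ_le_iff,
        Nat.div_lt_iff_lt_mul hh, mul_comm n, mul_comm k]
      constructor
      · intro hle
        refine lt_of_le_of_ne hle fun he => ?_
        have : (h' + 1) ∣ m + 1 := hc.dvd_of_dvd_mul_right ⟨n, he⟩
        have := Nat.le_of_dvd (by omega) this
        omega
      · exact le_of_lt
    simp_rw [key]
    rw [← sum_filter, sum_const]
    have : (range k).filter (fun n => k * (m + 1) / (h' + 1) + 1 ≤ n) =
        Ico (k * (m + 1) / (h' + 1) + 1) k := by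
      ext n; simp; omega
    rw [this, Nat.card_Ico, nsmul_eq_mul, Nat.cast_sub (by omega)]
    push_cast; ring
  rw [sum_congr rfl e2]; simp; ring

lemma ds_recip {h k : ℕ} (hh : 0 < h) (hk : 0 < k) (hc : Nat.Coprime h k) :
    ds h k + ds k h = -1 / 4 + ((h : ℝ) / k + k / h + 1 / (h * k)) / 12 := by
  have f1 := ds_formula hk hc
  have f2 := ds_formula hh hc.symm
  have q1 := sum_q2 hc
  have q2 := sum_q2' hh hk hc
  have q3 := sum_q hh hc.symm
  have h1 : (h : ℝ) ≠ 0 := by positivity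
  have h2 : (k : ℝ) ≠ 0 := by positivity
  have e : ∀ m : ℕ, (2 * (m : ℝ) - 1) * (k - 1 - ((k * m / h : ℕ) : ℝ)) =
    2 * (k - 1) * (m : ℝ) - (k - 1) - 2 * ((m : ℝ) * ((k * m / h : ℕ) : ℝ)) + ((k * m / h : ℕ) : ℝ) := by
    intro m; ring
  simp_rw [e] at q2
  rw [sum_add_distrib, sum_sub_distrib, sum_sub_distrib, ← mul_sum, ← mul_sum, q3, sum_range_real,
    sum_const, card_range, nsmul_eq_mul] at q2
  rw [q2] at q1
  generalize ∑ m ∈ range h, (m : ℝ) * ((k * m / h : ℕ) : ℝ) = B at *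
  generalize ∑ m ∈ range k, (m : ℝ) * ((h * m / k : ℕ) : ℝ) = A at *
  have s1 : ds h k = (h * (k * (k - 1) * (2 * k - 1) / 6) - k * A - k ^ 2 * (k - 1) / 4) / (k:ℝ) ^ 2 := by
    rw [← f1]; field_simp
  have s2 : ds k h = (k * (h * (h - 1) * (2 * h - 1) / 6) - h * B - h ^ 2 * (h - 1) / 4) / (h:ℝ) ^ 2 := by
    rw [← f2]; field_simp
  have hA : A = ((k:ℝ) ^ 2 * (2 * (k - 1) * (h * (h - 1) / 2) - h * (k - 1) - 2 * B + ((k:ℝ) - 1) * (h - 1) / 2 + (k - 1))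
     + (h ^ 2 - 1) * (k * (k - 1) * (2 * k - 1) / 6)) / (2 * h * k) := by
    rw [q1]; field_simp; ring
  rw [s1, s2, hA]
  field_simp
  ring

def Ef (a b c d : ℤ) : ℤ := (1 - c ^ 2) * (b * d + 3 * (c - 1) * d + c + 3) + c * (a + d - 3)

lemma dvd12 {x : ℤ} (h4 : ((x : ℤ) : ZMod 4) = 0) (h3 : ((x : ℤ) : ZMod 3) = 0) : (12 : ℤ) ∣ x := by
  have a := (ZMod.intCast_zmod_eq_zero_iff_dvd x 4).mp h4
  have b := (ZMod.intCast_zmod_eq_zero_iff_dvd x 3).mp h3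
  push_cast at a b
  omega

set_option maxRecDepth 100000 in
lemma EfT4 : ∀ a b c d n : ZMod 4, a * d - b * c = 1 →
   ((1 - c ^ 2) * ((b + n * d) * d + 3 * (c - 1) * d + c + 3) + c * (a + n * c + d - 3)) -
   ((1 - c ^ 2) * (b * d + 3 * (c - 1) * d + c + 3) + c * (a + d - 3)) - n = 0 := by decide

set_option maxRecDepth 100000 in
lemma EfT3 : ∀ a b c d n : ZMod 3, a * d - b * c = 1 →
   ((1 - c ^ 2) * ((b + n * d) * d + 3 * (c - 1) * d + c + 3) + c * (a + n * c + d - 3)) -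
   ((1 - c ^ 2) * (b * d + 3 * (c - 1) * d + c + 3) + c * (a + d - 3)) - n = 0 := by decide

set_option maxRecDepth 100000 in
lemma EfS4 : ∀ a b c d : ZMod 4, a * d - b * c = 1 →
   ((1 - a ^ 2) * (-d * b + 3 * (a - 1) * b + a + 3) + a * (-c + b - 3)) -
   ((1 - c ^ 2) * (b * d + 3 * (c - 1) * d + c + 3) + c * (a + d - 3)) + 3 = 0 := by decide

set_option maxRecDepth 100000 in
lemma EfS3 : ∀ a b c d : ZMod 3, a * d - b * c = 1 →
   ((1 - a ^ 2) * (-d * b + 3 * (a - 1) * b + a + 3) + a * (-c + b - 3)) -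
   ((1 - c ^ 2) * (b * d + 3 * (c - 1) * d + c + 3) + c * (a + d - 3)) + 3 = 0 := by decide

lemma ec_congr12 {x y : ℤ} (h : (12 : ℤ) ∣ x - y) : ec ((x : ℂ) / 12) = ec ((y : ℂ) / 12) := by
  obtain ⟨n, hn⟩ := h
  refine ec_eq_of_sub_int n ?_
  rw [← sub_div, div_eq_iff (by norm_num)]
  have : ((x - y : ℤ) : ℂ) = ((12 * n : ℤ) : ℂ) := by rw [hn]
  push_cast at this; rw [this]; ring

lemma Ef_T {a b c d : ℤ} (n : ℤ) (h : a * d - b * c = 1) :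
    ec ((Ef (a + n * c) (b + n * d) c d : ℂ) / 12) = ec (n / 12) * ec ((Ef a b c d : ℂ) / 12) := by
  rw [← ec_add, ← add_div]
  have := ec_congr12 (x := Ef (a + n * c) (b + n * d) c d) (y := n + Ef a b c d) (dvd12 ?_ ?_)
  · rw [this]; push_cast; rfl
  · have := EfT4 a b c d n (by exact_mod_cast congrArg (Int.cast (R := ZMod 4)) h)
    rw [← this, Ef, Ef]; push_cast; ring
  · have := EfT3 a b c d n (by exact_mod_cast congrArg (Int.cast (R := ZMod 3)) h)
    rw [← this, Ef, Ef]; push_cast; ring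

lemma Ef_S {a b c d : ℤ} (h : a * d - b * c = 1) :
    ec ((Ef (-c) (-d) a b : ℂ) / 12) = ec (-1 / 4) * ec ((Ef a b c d : ℂ) / 12) := by
  rw [← ec_add, show (-1 / 4 : ℂ) = (-3) / 12 by norm_num, ← add_div]
  have := ec_congr12 (x := Ef (-c) (-d) a b) (y := -3 + Ef a b c d) (dvd12 ?_ ?_)
  · rw [this]; push_cast; rfl
  · have := EfS4 a b c d (by exact_mod_cast congrArg (Int.cast (R := ZMod 4)) h)
    rw [← this, Ef, Ef]; push_cast; ring
  · have := EfS3 a b c d (by exact_mod_cast congrArg (Int.cast (R := ZMod 3)) h)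
    rw [← this, Ef, Ef]; push_cast; ring

lemma Ef_congr {a b c d a' b' c' d' : ℤ} (ha : (12 : ℤ) ∣ a - a') (hb : (12 : ℤ) ∣ b - b')
    (hc : (12 : ℤ) ∣ c - c') (hd : (12 : ℤ) ∣ d - d') :
    ec ((Ef a b c d : ℂ) / 12) = ec ((Ef a' b' c' d' : ℂ) / 12) := by
  refine ec_congr12 (Int.ModEq.dvd ?_)
  have f : ∀ {x y : ℤ}, (12 : ℤ) ∣ x - y → y ≡ x [ZMOD 12] := fun h => (Int.modEq_iff_dvd.mpr h)
  unfold Ef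
  have := f ha; have := f hb; have := f hc; have := f hd
  gcongr

lemma im_moeb {a b c d : ℝ} {τ : ℂ} (hτ : 0 < τ.im) (h : a * d - b * c = 1) :
    (c * τ + d : ℂ) ≠ 0 ∧ 0 < ((a * τ + b) / (c * τ + d) : ℂ).im := by
  have h0 : (c * τ + d : ℂ) ≠ 0 := by
    intro h1
    have h2 := congrArg Complex.im h1
    simp at h2
    rcases h2 with h2 | h2
    · rw [h2] at h1; simp at h1; rw [h2, h1] at h; simp at h
    · linarith
  refine ⟨h0, ?_⟩
  have h2 : 0 < normSq (c * τ + d : ℂ) := normSq_pos.mpr h0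
  rw [Complex.div_im]
  have : (a * τ + b : ℂ).im * (c * τ + d : ℂ).re / normSq (c * τ + d : ℂ) -
     (a * τ + b : ℂ).re * (c * τ + d : ℂ).im / normSq (c * τ + d : ℂ) = τ.im / normSq (c * τ + d : ℂ) := by
    rw [← sub_div]; congr 1; simp
    linear_combination τ.im * h
  rw [this]; positivity

lemma im_moeb_int {a b c d : ℤ} {τ : ℂ} (hτ : 0 < τ.im) (h : a * d - b * c = 1) :
    (c * τ + d : ℂ) ≠ 0 ∧ 0 < ((a * τ + b) / (c * τ + d) : ℂ).im := by
  have := im_moeb (a := a) (b := b) (c := c) (d := d) hτ (by exact_mod_cast h)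
  simpa using this

def Psg (a b c d : ℤ) (n : ℕ) : Prop :=
  (∀ x y τ : ℂ, 0 < τ.im → sg x y ((a * τ + b) / (c * τ + d)) =
    ec ((Ef a b c d : ℂ) / 12) * sg (x * a + y * c) (x * b + y * d) τ) ∧
  ec ((Ef a b c d : ℂ) / 12) = ec (((a : ℂ) + d) / (12 * c) - (ds a n : ℝ) - 1 / 4)

lemma Psg_T {a b c d : ℤ} {n : ℕ} (hn : 0 < n) (hc : c = n) (h : a * d - b * c = 1) (N : ℤ)
    (hP : Psg a b c d n) : Psg (a + N * c) (b + N * d) c d n := by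
  have hc0 : (c : ℂ) ≠ 0 := by rw [hc]; simp; omega
  refine ⟨fun x y τ hτ => ?_, ?_⟩
  · obtain ⟨h0, _⟩ := im_moeb_int hτ h
    have : (((a + N * c : ℤ) : ℂ) * τ + ((b + N * d : ℤ) : ℂ)) / (c * τ + d) =
        (a * τ + b) / (c * τ + d) + N := by
      push_cast; field_simp; ring
    rw [this, sg_T, hP.1 _ _ _ hτ, Ef_T N h, mul_assoc]
    push_cast; ring_nf
  · rw [Ef_T N h, hP.2, ← ec_add, hc, ds_add _ _ hn]
    congr 1; rw [hc] at hc0; push_cast at hc0 ⊢; field_simp; ring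

lemma Psg_all : ∀ (n : ℕ), 0 < n → ∀ a b c d : ℤ, c = n → a * d - b * c = 1 → Psg a b c d n := by
  intro n
  induction n using Nat.strong_induction_on with
  | _ n ih =>
  intro hn a b c d hc h
  have hcpos : 0 < c := by omega
  obtain ⟨a0, N, b0, rfl, rfl, h0, h1, hdet⟩ : ∃ a0 N b0 : ℤ, a = a0 + N * c ∧ b = b0 + N * d ∧ 0 ≤ a0 ∧ a0 < c ∧
      a0 * d - b0 * c = 1 := by
    refine ⟨a % c, a / c, b - a / c * d, ?_, by ring, Int.emod_nonneg _ hcpos.ne', Int.emod_lt_of_pos _ hcpos, ?_⟩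
    · rw [mul_comm]; exact (Int.emod_add_mul_ediv a c).symm
    · rw [Int.emod_def]; linear_combination h
  refine Psg_T hn hc hdet N ?_
  rcases h0.eq_or_lt with h00 | h00
  · subst h00
    have hb : b0 = -1 ∧ c = 1 := by
      have h3 : c ∣ 1 := ⟨-b0, by linear_combination -hdet⟩
      have := Int.eq_one_of_dvd_one hcpos.le h3
      subst this; constructor <;> linarith
    obtain ⟨rfl, rfl⟩ := hb
    have hn1 : n = 1 := by omega
    subst hn1
    have hE : ec ((Ef 0 (-1) 1 d : ℂ) / 12) = ec (-1 / 4) * ec (d / 12) := by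
      rw [← ec_add, Ef]; congr 1; push_cast; ring
    refine ⟨fun x y τ hτ => ?_, ?_⟩
    · have : (((0 : ℤ) : ℂ) * τ + ((-1 : ℤ) : ℂ)) / (((1 : ℤ) : ℂ) * τ + d) = -1 / (τ + d) := by simp
      rw [this, sg_S (by simpa using hτ), sg_T, hE, mul_assoc]
      push_cast; ring_nf
    · rw [hE, ← ec_add]; congr 1; simp [ds, saw]; ring
  · have hlt : a0.toNat < n := by omega
    have ha0 : a0 = (a0.toNat : ℤ) := by omega
    have hdet' : -c * b0 - -d * a0 = 1 := by linear_combination hdet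
    obtain ⟨i1, i2⟩ := ih a0.toNat hlt (by omega) (-c) (-d) a0 b0 ha0 hdet'
    have hS := Ef_S hdet
    rw [hS] at i1 i2
    have e4 : ec (-1 / 4) * ec (-1 / 4) = -1 := by
      rw [← ec_add, ec_eq_of_sub_int (y := 1 / 2) (-1) (by norm_num), ec_half]
    refine ⟨fun x y τ hτ => ?_, ?_⟩
    · obtain ⟨hne, him⟩ := im_moeb_int hτ hdet'
      obtain ⟨hne', him'⟩ := im_moeb_int hτ hdet
      have : ((a0 : ℂ) * τ + b0) / (c * τ + d) = -1 / ((((-c : ℤ) : ℂ) * τ + ((-d : ℤ) : ℂ)) / (a0 * τ + b0)) := by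
        have : (((-c : ℤ) : ℂ) * τ + ((-d : ℤ) : ℂ)) ≠ 0 := by
          push_cast; intro h; apply hne'; linear_combination -h
        rw [div_div_eq_mul_div, div_eq_div_iff hne' this]; push_cast; ring
      rw [this, sg_S him, i1 _ _ _ hτ, ← mul_assoc, ← mul_assoc, e4,
        show y * ((-c : ℤ) : ℂ) + -x * a0 = -(x * a0 + y * c) by push_cast; ring,
        show y * ((-d : ℤ) : ℂ) + -x * b0 = -(x * b0 + y * d) by push_cast; ring, sg_neg hτ]
      ring
    · have h14 : ec (1 / 4) * ec (-1 / 4) = 1 := by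
        rw [← ec_add, show (1 / 4 + -1 / 4 : ℂ) = 0 by norm_num, ec_zero]
      have h15 : ∀ X, X = ec (1 / 4) * (ec (-1 / 4) * X) := fun X => by rw [← mul_assoc, h14, one_mul]
      rw [h15 (ec (_ / 12)), i2, ← ec_add]
      have hco : Nat.Coprime a0.toNat n := by
        rw [← Nat.isCoprime_iff_coprime, ← ha0, ← hc]
        exact ⟨d, -b0, by linear_combination hdet⟩
      have hr := ds_recip (by omega) hn hco
      have hds : ds a0 n = -1 / 4 + ((a0 : ℝ) / c + c / a0 + 1 / (a0 * c)) / 12 + ds (-c) a0.toNat := by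
        rw [← ha0] at hr
        rw [ds_neg, hc]
        have : (a0.toNat : ℝ) = a0 := by exact_mod_cast ha0.symm
        rw [this] at hr
        push_cast; linarith
      rw [hds]
      congr 1
      have k1 : (c : ℂ) ≠ 0 := by exact_mod_cast hcpos.ne'
      have k2 : (a0 : ℂ) ≠ 0 := by exact_mod_cast h00.ne'
      have k3 : (a0 : ℂ) * d - b0 * c = 1 := by exact_mod_cast hdet
      push_cast
      field_simp
      linear_combination (-4 : ℂ) * k3

def UU (Q x : ℂ) : ℂ := ∏' n : ℕ, (1 - Q ^ n * x)

lemma mulU {Q : ℂ} (hQ : ‖Q‖ < 1) (x : ℂ) : Multipliable fun n : ℕ => 1 - Q ^ n * x := by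
  simp_rw [sub_eq_add_neg]
  refine multipliable_one_add_of_summable ?_
  simp only [norm_neg, norm_mul, norm_pow]
  exact (summable_geometric_of_lt_one (norm_nonneg Q) hQ).mul_right _

lemma UU_succ {Q : ℂ} (hQ : ‖Q‖ < 1) (x : ℂ) : UU Q x = (1 - x) * UU Q (Q * x) := by
  have e : (fun n : ℕ => 1 - Q ^ n * (Q * x)) = fun n : ℕ => 1 - Q ^ (n + 1) * x := by
    ext n; rw [pow_succ]; ring
  have h := mulU hQ (Q * x)
  rw [e] at h
  have := tprod_eq_zero_mul' (f := fun n : ℕ => 1 - Q ^ n * x) h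
  unfold UU
  rw [e]
  refine this.trans ?_
  congr 1
  simp only [pow_zero, one_mul]

lemma BB_eq_UU {Q w : ℂ} (hQ : ‖Q‖ < 1) : BB Q w = UU Q w * UU Q (Q / w) := by
  rw [BB, UU, UU, ← (mulU hQ w).tprod_mul (mulU hQ (Q / w))]
  congr 1; ext n; rw [pow_succ]; ring

lemma UU_near {Q x : ℂ} (hQ : ‖Q‖ ≤ 1 / 2) (hx : ‖x‖ ≤ 1 / 4) : ‖UU Q x - 1‖ ≤ 4 * ‖x‖ := by
  have hQ1 : ‖Q‖ < 1 := by linarith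
  have ht := (mulU hQ1 x).hasProd.tendsto_prod_nat
  refine le_of_tendsto (ht.sub_const 1).norm (Filter.Eventually.of_forall fun N => ?_)
  have h1 := norm_prod_one_add_sub_one_le (range N) (fun n => -(Q ^ n * x))
  simp only [← sub_eq_add_neg, norm_neg, norm_mul, norm_pow] at h1
  refine h1.trans ?_
  have h2 : ∑ i ∈ range N, ‖Q‖ ^ i * ‖x‖ ≤ 2 * ‖x‖ := by
    rw [← sum_mul]
    gcongr
    have := Summable.sum_le_tsum (range N) (fun i _ => by positivity)
      (summable_geometric_of_lt_one (norm_nonneg Q) hQ1)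
    rw [tsum_geometric_of_lt_one (norm_nonneg _) hQ1] at this
    refine this.trans ?_
    rw [inv_le_comm₀ (by linarith) (by norm_num)]; linarith
  have h3 : Real.exp (∑ i ∈ range N, ‖Q‖ ^ i * ‖x‖) ≤ Real.exp (2 * ‖x‖) := Real.exp_le_exp.mpr h2
  have h4 := Real.abs_exp_sub_one_le (x := 2 * ‖x‖) (by rw [abs_of_nonneg (by positivity)]; linarith)
  rw [abs_of_nonneg (a := 2 * ‖x‖) (by positivity)] at h4
  have := le_abs_self (Real.exp (2 * ‖x‖) - 1)
  linarith

/-- filter: imaginary part to infinity -/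
def imInf : Filter ℂ := Filter.comap Complex.im Filter.atTop

lemma tendsto_im : Filter.Tendsto Complex.im imInf Filter.atTop := Filter.tendsto_comap

lemma tendsto_exp_im {a : ℝ} (ha : 0 < a) :
    Filter.Tendsto (fun s : ℂ => Real.exp (-2 * π * (a * s.im))) imInf (nhds 0) := by
  have h1 : Filter.Tendsto (fun y : ℝ => 2 * π * a * y) Filter.atTop Filter.atTop :=
    Filter.tendsto_id.const_mul_atTop (by positivity)
  have := (Real.tendsto_exp_neg_atTop_nhds_zero.comp h1).comp tendsto_im
  refine this.congr fun s => ?_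
  simp only [Function.comp]; congr 1; ring

lemma UU_isBigO {a b : ℝ} (hb : 0 < b) (hab : b ≤ a) {x : ℂ → ℂ}
    (hx : ∀ s, ‖x s‖ = Real.exp (-2 * π * (a * s.im))) :
    (fun s => UU (ec s) (x s) - 1) =O[imInf] fun s => Real.exp (-2 * π * (b * s.im)) := by
  refine Asymptotics.IsBigO.of_bound 4 ?_
  have e1 := (tendsto_exp_im one_pos).eventually_le_const (show (0 : ℝ) < 1 / 2 by norm_num)
  have e2 := (tendsto_exp_im (hb.trans_le hab)).eventually_le_const (show (0 : ℝ) < 1 / 4 by norm_num)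
  filter_upwards [e1, e2, tendsto_im.eventually_ge_atTop 0] with s h1 h2 h3
  refine (UU_near (by rw [norm_ec]; simpa using h1) (by rw [hx]; exact h2)).trans ?_
  rw [hx, Real.norm_of_nonneg (Real.exp_nonneg _)]
  gcongr 4 * ?_
  refine Real.exp_le_exp.mpr ?_
  have : b * s.im ≤ a * s.im := by gcongr
  nlinarith [Real.pi_pos]

lemma BB_asymp (l : ℚ) (hl0 : 0 ≤ l) (hl1 : l < 1) (β : ℝ) : ∃ u : ℂ → ℂ,
    (∀ s : ℂ, 0 < s.im → BB (ec s) (ec ((l : ℂ) * s - β)) =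
      (if l = 0 then 1 - ec (-β) else 1) * u s) ∧
    (fun s => u s - 1) =O[imInf] fun s => Real.exp (-2 * π * ((ups l : ℝ) * s.im)) := by
  have key : ∀ (x1 x2 : ℂ → ℂ) (a1 a2 b : ℝ), 0 < b → b ≤ a1 → b ≤ a2 →
      (∀ s, ‖x1 s‖ = Real.exp (-2 * π * (a1 * s.im))) →
      (∀ s, ‖x2 s‖ = Real.exp (-2 * π * (a2 * s.im))) →
      (fun s => UU (ec s) (x1 s) * UU (ec s) (x2 s) - 1) =O[imInf]
        fun s => Real.exp (-2 * π * (b * s.im)) := by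
    intro x1 x2 a1 a2 b hb h1 h2 hx1 hx2
    have o1 := UU_isBigO hb h1 hx1
    have o2 := UU_isBigO hb h2 hx2
    have t2 := (o2.trans_tendsto (tendsto_exp_im hb)).add_const 1
    simp only [sub_add_cancel, zero_add] at t2
    have := (o1.mul (t2.isBigO_one ℝ)).add (by simpa using o2)
    refine (this.congr_left fun s => ?_).congr_right fun s => by simp
    ring
  by_cases h0 : l = 0
  · subst h0
    refine ⟨fun s => UU (ec s) (ec (s - β)) * UU (ec s) (ec (s + β)), fun s hs => ?_, ?_⟩
    · rw [BB_eq_UU (norm_ec_lt hs), UU_succ (norm_ec_lt hs), ← ec_add, ← ec_sub]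
      simp [sub_eq_add_neg, mul_assoc]
    · refine key _ _ 1 1 _ (by simp [ups]) (by simp [ups]) (by simp [ups]) ?_ ?_ <;>
        intro s <;> rw [norm_ec] <;> simp
  · have hpos : 0 < l := lt_of_le_of_ne hl0 (Ne.symm h0)
    refine ⟨fun s => UU (ec s) (ec (l * s - β)) * UU (ec s) (ec ((1 - l) * s + β)),
      fun s hs => ?_, ?_⟩
    · rw [BB_eq_UU (norm_ec_lt hs), ← ec_sub, if_neg h0, one_mul]; congr 3; ring
    · have hu : 0 < ups l ∧ ups l ≤ l ∧ ups l ≤ 1 - l := by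
        rw [ups, if_neg h0]; split_ifs with h
        · exact ⟨hpos, le_rfl, by linarith⟩
        · exact ⟨by linarith, by linarith [not_le.mp h], le_rfl⟩
      refine key _ _ l (1 - l : ℚ) _ (by exact_mod_cast hu.1) (by exact_mod_cast hu.2.1)
        (by exact_mod_cast hu.2.2) ?_ ?_ <;> intro s <;> rw [norm_ec] <;> congr 1
      · simp
      · simp

lemma zpow_near {α : Type*} {F : Filter α} {u : α → ℂ} {ε : α → ℝ} (hε : Filter.Tendsto ε F (nhds 0))
    (hu : (fun s => u s - 1) =O[F] ε) (n : ℤ) : (fun s => u s ^ n - 1) =O[F] ε := by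
  have t : Filter.Tendsto u F (nhds 1) := by
    simpa using (hu.trans_tendsto hε).add_const 1
  have := (hasDerivAt_zpow n (1 : ℂ) (Or.inl one_ne_zero)).isBigO_sub.comp_tendsto t
  simp only [Function.comp_def, one_zpow] at this
  exact this.trans hu

lemma prod_near {α ι : Type*} {F : Filter α} {u : ι → α → ℂ} {ε : α → ℝ}
    (hε : Filter.Tendsto ε F (nhds 0)) (S : Finset ι)
    (hu : ∀ i ∈ S, (fun s => u i s - 1) =O[F] ε) : (fun s => ∏ i ∈ S, u i s - 1) =O[F] ε := by
  classical
  induction S using Finset.induction_on with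
  | empty => simp [Asymptotics.isBigO_zero]
  | insert i S hi ih =>
    simp_rw [prod_insert hi]
    have o1 := hu i (mem_insert_self i S)
    have o2 := ih fun j hj => hu j (mem_insert_of_mem hj)
    have t2 := (o2.trans_tendsto hε).add_const 1
    simp only [sub_add_cancel, zero_add] at t2
    have := (o1.mul (t2.isBigO_one ℝ)).add (by simpa using o2)
    refine (this.congr_left fun s => ?_).congr_right fun s => by simp
    ring

def FF (J : ℕ) (m r : Fin J → ℕ) (δ : Fin J → ℤ) (τ : ℂ) : ℂ :=
  ∏ j, sg ((r j : ℂ) / m j) 0 (m j * τ) ^ δ j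

lemma mul_im_pos {m : ℕ} (hm : 0 < m) {τ : ℂ} (hτ : 0 < τ.im) : 0 < ((m : ℂ) * τ).im := by
  have : (0 : ℝ) < m := by exact_mod_cast hm
  simp; positivity

lemma FF_eq {J : ℕ} {m r : Fin J → ℕ} {δ : Fin J → ℤ} (hm : ∀ j, 0 < m j)
    (hrm : ∀ j, r j < m j) (τ : ℂ) :
    FF J m r δ τ = ec ((OmegaC J m r δ : ℝ) * τ / 24) *
      ∏ j, (∏' k : ℕ, (1 - ec τ ^ (r j + m j * k)) * (1 - ec τ ^ (m j * (k + 1) - r j))) ^ (δ j) := by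
  have : ec ((OmegaC J m r δ : ℝ) * τ / 24) = ∏ j, ec ((m j * τ) *
      (((r j : ℂ) / m j) ^ 2 - (r j : ℂ) / m j + 1 / 6) / 2) ^ δ j := by
    simp_rw [← ec_int_mul]
    unfold ec
    rw [← Complex.exp_sum, ← mul_sum]
    congr 2
    rw [OmegaC]; push_cast
    rw [sum_mul, sum_div]
    refine sum_congr rfl fun j _ => ?_
    have : (m j : ℂ) ≠ 0 := by exact_mod_cast (hm j).ne'
    field_simp; ring
  rw [this, ← prod_mul_distrib, FF]
  refine prod_congr rfl fun j _ => ?_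
  have hmj : (m j : ℂ) ≠ 0 := by exact_mod_cast (hm j).ne'
  rw [← mul_zpow, sg]
  congr 2
  · congr 1; ring
  · rw [BB]
    congr 1; ext k
    have e1 : ec ((r j : ℂ) / m j * (m j * τ) + 0) = ec τ ^ r j := by
      rw [← ec_nat_mul]; congr 1; field_simp; ring
    rw [e1, ec_nat_mul]
    congr 2
    · rw [← pow_mul, ← pow_add, add_comm]
    · rw [← pow_mul, div_eq_iff (pow_ne_zero _ (ec_ne_zero _)), ← pow_add]
      congr 1
      have := hrm j
      have : r j ≤ m j * (k + 1) := by nlinarith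
      omega

lemma UU_ne {Q x : ℂ} (hQ : ‖Q‖ < 1) (hx : ‖x‖ < 1) : UU Q x ≠ 0 := by
  have := tprod_one_add_ne_zero_of_summable (f := fun n : ℕ => -(Q ^ n * x))
    (fun n h => ?_) ?_
  · simpa [UU, sub_eq_add_neg] using this
  · have h1 : Q ^ n * x = 1 := by linear_combination -h
    have h2 : ‖Q ^ n * x‖ < 1 := by
      rw [norm_mul, norm_pow]
      calc ‖Q‖ ^ n * ‖x‖ ≤ 1 * ‖x‖ := by gcongr; exact pow_le_one₀ (norm_nonneg _) hQ.le
        _ < 1 := by linarith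
    rw [h1] at h2; simp at h2
  · simp only [norm_neg, norm_mul, norm_pow]
    exact (summable_geometric_of_lt_one (norm_nonneg Q) hQ).mul_right _

lemma sg_ne {m r : ℕ} (hr : 1 ≤ r) (hrm : r < m) {τ : ℂ} (hτ : 0 < τ.im) :
    sg ((r : ℂ) / m) 0 (m * τ) ≠ 0 := by
  have hm : (m : ℂ) ≠ 0 := by norm_cast; omega
  have h := mul_im_pos (by omega : 0 < m) hτ
  rw [sg]
  refine mul_ne_zero (ec_ne_zero _) ?_
  rw [BB_eq_UU (norm_ec_lt h), ← ec_sub]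
  refine mul_ne_zero (UU_ne (norm_ec_lt h) (norm_ec_lt ?_)) (UU_ne (norm_ec_lt h) (norm_ec_lt ?_))
  · rw [show (r : ℂ) / m * (m * τ) + 0 = r * τ by field_simp; ring]
    exact mul_im_pos hr hτ
  · rw [show m * τ - ((r : ℂ) / m * (m * τ) + 0) = ((m - r : ℕ) : ℂ) * τ by
      rw [Nat.cast_sub hrm.le]; field_simp; ring]
    exact mul_im_pos (by omega) hτ

lemma differentiableAt_FF {J : ℕ} {m r : Fin J → ℕ} {δ : Fin J → ℤ} (hr : ∀ j, 1 ≤ r j)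
    (hrm : ∀ j, r j < m j) {τ : ℂ} (hτ : 0 < τ.im) : DifferentiableAt ℂ (FF J m r δ) τ := by
  unfold FF
  refine DifferentiableAt.fun_finsetProd fun j _ => ?_
  have h := mul_im_pos (by have := hrm j; omega : 0 < m j) hτ
  refine DifferentiableAt.zpow ?_ (Or.inl (sg_ne (hr j) (hrm j) hτ))
  exact (differentiableAt_sg h _ _).comp τ (differentiableAt_id.const_mul _)

lemma sg_Gam {m r : ℕ} (hm : 0 < m) {M : ℤ} (hM : (24 * (m : ℤ) ^ 2) ∣ M) {a b c d : ℤ}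
    (h : a * d - b * c = 1) (hc : 0 < c) (ha' : M ∣ a - 1) (hb' : M ∣ b) (hc' : M ∣ c)
    (hd' : M ∣ d - 1) {τ : ℂ} (hτ : 0 < τ.im) :
    sg ((r : ℂ) / m) 0 (m * ((a * τ + b) / (c * τ + d))) = sg ((r : ℂ) / m) 0 (m * τ) := by
  have hm0 : (m : ℂ) ≠ 0 := by exact_mod_cast hm.ne'
  obtain ⟨a1, ha1⟩ := hM.trans ha'
  obtain ⟨b1, rfl⟩ := hM.trans hb'
  obtain ⟨c1, rfl⟩ := hM.trans hc'
  obtain ⟨d1, hd1⟩ := hM.trans hd'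
  obtain rfl : a = 1 + 24 * (m : ℤ) ^ 2 * a1 := by linarith
  obtain rfl : d = 1 + 24 * (m : ℤ) ^ 2 * d1 := by linarith
  have hc1 : 0 < 24 * (m : ℤ) * c1 := by
    have : (0 : ℤ) < m := by exact_mod_cast hm
    have : 0 < c1 := by by_contra hh; push Not at hh; nlinarith [sq_nonneg (m : ℤ)]
    positivity
  have P := (Psg_all (24 * (m : ℤ) * c1).toNat (by omega) (1 + 24 * (m : ℤ) ^ 2 * a1)
    (24 * (m : ℤ) ^ 3 * b1) (24 * (m : ℤ) * c1) (1 + 24 * (m : ℤ) ^ 2 * d1) (by omega)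
    (by linear_combination h)).1 ((r : ℂ) / m) 0 (m * τ) (mul_im_pos hm hτ)
  have hE := Ef_congr (a := 1 + 24 * (m : ℤ) ^ 2 * a1) (b := 24 * (m : ℤ) ^ 3 * b1)
    (c := 24 * (m : ℤ) * c1) (d := 1 + 24 * (m : ℤ) ^ 2 * d1) (a' := 1) (b' := 0) (c' := 0) (d' := 1)
    ⟨2 * m ^ 2 * a1, by ring⟩ ⟨2 * m ^ 3 * b1, by ring⟩ ⟨2 * m * c1, by ring⟩ ⟨2 * m ^ 2 * d1, by ring⟩
  have e0 : ec ((Ef 1 0 0 1 : ℂ) / 12) = 1 := by simp [Ef, ec_zero]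
  rw [hE, e0, one_mul] at P
  have hne := (im_moeb_int hτ h).1
  have e1 : m * ((((1 + 24 * (m : ℤ) ^ 2 * a1 : ℤ) : ℂ) * τ + ((24 * (m : ℤ) ^ 2 * b1 : ℤ) : ℂ)) /
      (((24 * (m : ℤ) ^ 2 * c1 : ℤ) : ℂ) * τ + ((1 + 24 * (m : ℤ) ^ 2 * d1 : ℤ) : ℂ))) =
      (((1 + 24 * (m : ℤ) ^ 2 * a1 : ℤ) : ℂ) * (m * τ) + ((24 * (m : ℤ) ^ 3 * b1 : ℤ) : ℂ)) /
      (((24 * (m : ℤ) * c1 : ℤ) : ℂ) * (m * τ) + ((1 + 24 * (m : ℤ) ^ 2 * d1 : ℤ) : ℂ)) := by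
    rw [show ((24 * (m : ℤ) * c1 : ℤ) : ℂ) * (m * τ) + ((1 + 24 * (m : ℤ) ^ 2 * d1 : ℤ) : ℂ) =
      ((24 * (m : ℤ) ^ 2 * c1 : ℤ) : ℂ) * τ + ((1 + 24 * (m : ℤ) ^ 2 * d1 : ℤ) : ℂ) by push_cast; ring,
      ← mul_div_assoc]
    congr 1; push_cast; ring
  rw [e1, P]
  have e2 : (r : ℂ) / m * ((1 + 24 * (m : ℤ) ^ 2 * a1 : ℤ) : ℂ) + 0 * ((24 * (m : ℤ) * c1 : ℤ) : ℂ) =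
      (r : ℂ) / m + ((24 * r * m * a1 : ℤ) : ℂ) := by push_cast; field_simp; ring
  have e3 : (r : ℂ) / m * ((24 * (m : ℤ) ^ 3 * b1 : ℤ) : ℂ) + 0 * ((1 + 24 * (m : ℤ) ^ 2 * d1 : ℤ) : ℂ) =
      0 + ((24 * r * m ^ 2 * b1 : ℤ) : ℂ) := by push_cast; field_simp; ring
  rw [e2, e3, sg_shift1 (mul_im_pos hm hτ), sg_shift2]
  have e4 : ec (((24 * r * m * a1 : ℤ) : ℂ) * (1 - (0 + ((24 * r * m ^ 2 * b1 : ℤ) : ℂ))) / 2) = 1 := by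
    refine (congrArg ec ?_).trans (ec_int (12 * r * m * a1 * (1 - 24 * r * m ^ 2 * b1)))
    push_cast; ring
  have e5 : ec (((24 * r * m ^ 2 * b1 : ℤ) : ℂ) * ((r : ℂ) / m - 1) / 2) = 1 := by
    refine (congrArg ec ?_).trans (ec_int (12 * r * m * b1 * (r - m)))
    push_cast; field_simp; ring
  rw [e4, e5, one_mul, one_mul]

lemma moeb_comp {a b c d a' b' c' d' : ℤ} (h : a * d - b * c = 1) {τ : ℂ} (hτ : 0 < τ.im) :
    ((a' : ℂ) * ((a * τ + b) / (c * τ + d)) + b') / (c' * ((a * τ + b) / (c * τ + d)) + d') =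
      (((a' * a + b' * c : ℤ) : ℂ) * τ + ((a' * b + b' * d : ℤ) : ℂ)) /
      (((c' * a + d' * c : ℤ) : ℂ) * τ + ((c' * b + d' * d : ℤ) : ℂ)) := by
  have h0 := (im_moeb_int hτ h).1
  rw [← mul_div_mul_right _ _ h0]
  congr 1 <;> · push_cast; rw [add_mul, mul_assoc, div_mul_cancel₀ _ h0]; ring

/-- F_γ depends only on γ mod M -/
lemma FF_class {J : ℕ} {m r : Fin J → ℕ} {δ : Fin J → ℤ} (hm : ∀ j, 0 < m j) {M : ℤ} (hM0 : 0 < M)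
    (hM : ∀ j, (24 * (m j : ℤ) ^ 2) ∣ M) {a b c d a' b' c' d' : ℤ}
    (h : a * d - b * c = 1) (h' : a' * d' - b' * c' = 1) (hc : 0 < c) (hc' : 0 < c')
    (ea : M ∣ a' - a) (eb : M ∣ b' - b) (ec' : M ∣ c' - c) (ed : M ∣ d' - d)
    {τ : ℂ} (hτ : 0 < τ.im) :
    FF J m r δ ((a' * τ + b') / (c' * τ + d')) = FF J m r δ ((a * τ + b) / (c * τ + d)) := by
  have key : ∀ {a b c d a' b' c' d' : ℤ}, a * d - b * c = 1 → a' * d' - b' * c' = 1 →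
      0 < c' * d - d' * c → M ∣ a' - a → M ∣ b' - b → M ∣ c' - c → M ∣ d' - d →
      FF J m r δ ((a' * τ + b') / (c' * τ + d')) = FF J m r δ ((a * τ + b) / (c * τ + d)) := by
    intro a b c d a' b' c' d' h h' hcc ea eb ec' ed
    obtain ⟨x, hx⟩ := ea
    obtain ⟨y, hy⟩ := eb
    obtain ⟨z, hz⟩ := ec'
    obtain ⟨w, hw⟩ := ed
    have h1 : (a' * d - b' * c) * (d' * a - c' * b) - (b' * a - a' * b) * (c' * d - d' * c) = 1 := by
      linear_combination h * (a' * d' - b' * c') + h'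
    have h2 : ((a' : ℂ) * τ + b') / (c' * τ + d') =
        (((a' * d - b' * c : ℤ) : ℂ) * ((a * τ + b) / (c * τ + d)) + ((b' * a - a' * b : ℤ) : ℂ)) /
        (((c' * d - d' * c : ℤ) : ℂ) * ((a * τ + b) / (c * τ + d)) + ((d' * a - c' * b : ℤ) : ℂ)) := by
      rw [moeb_comp h hτ]
      congr 3 <;> norm_cast
      · linear_combination -a' * h
      · linear_combination -b' * h
      · linear_combination -c' * h
      · linear_combination -d' * h
    rw [h2, FF, FF]
    refine prod_congr rfl fun j _ => ?_
    rw [sg_Gam (hm j) (hM j) h1 hcc ⟨x * d - y * c, ?_⟩ ⟨y * a - x * b, ?_⟩ ⟨z * d - w * c, ?_⟩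
      ⟨w * a - z * b, ?_⟩ (im_moeb_int hτ h).2]
    · linear_combination h + d * hx - c * hy
    · linear_combination a * hy - b * hx
    · linear_combination d * hz - c * hw
    · linear_combination h + a * hw - b * hz
  obtain ⟨N, hN, hN1⟩ : ∃ N : ℤ, 0 < N ∧ 0 < c' * d - d' * c + M * N * (c * c') := by
    refine ⟨|c' * d - d' * c| + 1, by positivity, ?_⟩
    have h3 := neg_abs_le (c' * d - d' * c)
    have : 1 ≤ M * (c * c') := Int.add_one_le_of_lt (a := 0) (by positivity)
    nlinarith [abs_nonneg (c' * d - d' * c)]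
  have hT : a * (d + M * N * c) - (b + M * N * a) * c = 1 := by linear_combination h
  have hp : 0 < c * (d + M * N * c) - d * c := by
    have : 0 < M * N * c ^ 2 := by positivity
    linear_combination this
  obtain ⟨y, hy⟩ := eb
  obtain ⟨w, hw⟩ := ed
  rw [key hT h' (by linear_combination hN1) ea ⟨y - N * a, by linear_combination hy⟩ ec'
    ⟨w - N * c, by linear_combination hw⟩]
  exact (key hT h hp ⟨0, by ring⟩ ⟨-N * a, by ring⟩ ⟨0, by ring⟩ ⟨-N * c, by ring⟩).symm

lemma lamStar_bd (m r h k : ℕ) : 0 ≤ lamStar m r h k ∧ lamStar m r h k < 1 := by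
  unfold lamStar lamF
  have h1 := Int.le_ceil ((r * h : ℚ) / (Nat.gcd m k : ℚ))
  have h2 := Int.ceil_lt_add_one ((r * h : ℚ) / (Nat.gcd m k : ℚ))
  exact ⟨by linarith, by linarith⟩

/-- per-factor exponents -/
def Xj (m r : ℕ) (ħ : ℤ) (h k : ℕ) : ℂ := (r : ℂ) * (h : ℂ) / (k : ℂ) -
        (r : ℂ) * (Nat.gcd m k : ℂ) / ((m : ℂ) * (k : ℂ)) +
        2 * (r : ℂ) * (Nat.gcd m k : ℂ) * ((lamStar m r h k : ℚ) : ℂ) /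
          ((m : ℂ) * (k : ℂ)) +
        (ħ : ℂ) * (Nat.gcd m k : ℂ) / (k : ℂ) *
          ((lamF m r h k : ℂ) ^ 2 - (lamF m r h k : ℂ))

def Dj (m r h k : ℕ) : ℝ := -(2 * (Nat.gcd m k : ℝ) ^ 2 / (m : ℝ) +
      12 * (Nat.gcd m k : ℝ) ^ 2 / (m : ℝ) *
        (((lamStar m r h k : ℚ) : ℝ) ^ 2 - ((lamStar m r h k : ℚ) : ℝ)))

def Oj (m r : ℕ) : ℝ := 2 * (m : ℝ) - 12 * (r : ℝ) + 12 * (r : ℝ) ^ 2 / (m : ℝ)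

def P0j (m r : ℕ) (ħ : ℤ) (h k : ℕ) : ℂ := if lamStar m r h k = 0 then
  1 - ec (((r : ℂ) * (Nat.gcd m k : ℂ) + (r : ℂ) * (ħ : ℂ) * (m : ℂ) * (h : ℂ)) /
      ((m : ℂ) * (k : ℂ))) else 1

def pj (m r : ℕ) (ħ d : ℤ) (h k : ℕ) : ℂ :=
  ec (1 / 4 + lamF m r h k / 2 -
    ((dedekindSum ((m / Nat.gcd m k) * h) (k / Nat.gcd m k) : ℝ) : ℂ) + Xj m r ħ h k / 2
    - (Dj m r h k / 24 : ℝ) * d / k + Oj m r * h / (24 * k)) * P0j m r ħ h k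

lemma ec_alg {m g k r h lam l ħ d b bt Bb t : ℂ} (hm : m ≠ 0) (hg : g ≠ 0) (hk : k ≠ 0)
    (hl : l = lam - r * h / g) (hbt : bt = -(r * h * ħ / k) - r * g / (m * k))
    (hdet : h * d - b * k = 1) (hB : Bb = -ħ * m * b + (m / g * h * ħ + 1) / (k / g) * d) (S : ℂ) :
    ((m / g * h - ħ) / (12 * (k / g)) - S - 1 / 4) + lam * (1 - bt) / 2 + 1 / 2 +
      ((g ^ 2 / m * t + g * Bb / m) * (l ^ 2 - l + 1 / 6) / 2 + (-bt) * (l - 1) / 2) =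
    (1 / 4 + lam / 2 - S + (r * h / k - r * g / (m * k) + 2 * r * g * l / (m * k) +
      ħ * g / k * (lam ^ 2 - lam)) / 2 -
      (-(2 * g ^ 2 / m + 12 * g ^ 2 / m * (l ^ 2 - l))) / 24 * d / k +
      (2 * m - 12 * r + 12 * r ^ 2 / m) * h / (24 * k)) +
      -(-(2 * g ^ 2 / m + 12 * g ^ 2 / m * (l ^ 2 - l))) / 24 * t := by
  have e : g * Bb / m = g ^ 2 * d / (m * k) + g * ħ / k := by
    rw [hB]; field_simp; linear_combination m * ħ * hdet
  obtain rfl : lam = l + r * h / g := by rw [hl]; ring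
  rw [e, hbt]
  field_simp
  ring

lemma loc1 {m r h k : ℕ} {b d ħ : ℤ} (hm : 0 < m) (hk : 0 < k) (hdet : (h : ℤ) * d - b * k = 1)
    (hħ : ħ * (((m / Nat.gcd m k) * h : ℕ) : ℤ) ≡ -1 [ZMOD ((k / Nat.gcd m k : ℕ) : ℤ)]) :
    ∃ u : ℂ → ℂ, ((fun t => u t - 1) =O[imInf] fun t => Real.exp (-2 * π *
        ((ups (lamStar m r h k) : ℝ) * (Nat.gcd m k : ℝ) ^ 2 / m * t.im))) ∧
      ∀ t : ℂ, 0 < t.im → sg ((r : ℂ) / m) 0 (m * ((h * t + b) / (k * t + d))) =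
        pj m r ħ d h k * ec (-(Dj m r h k / 24 : ℝ) * t) * u t := by
  set g := Nat.gcd m k with hgdef
  have hg : 0 < g := Nat.gcd_pos_of_pos_left _ hm
  obtain ⟨mg, hmg⟩ : g ∣ m := Nat.gcd_dvd_left _ _
  obtain ⟨kg, hkg⟩ : g ∣ k := Nat.gcd_dvd_right _ _
  have e1 : m / g = mg := by rw [hmg]; exact Nat.mul_div_cancel_left _ hg
  have e2 : k / g = kg := by rw [hkg]; exact Nat.mul_div_cancel_left _ hg
  rw [e1, e2] at hħ
  have hkg0 : 0 < kg := by by_contra hh; obtain rfl : kg = 0 := by omega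
                           omega
  have hmg0 : 0 < mg := by by_contra hh; obtain rfl : mg = 0 := by omega
                           omega
  have cm : (m : ℂ) = g * mg := by exact_mod_cast hmg
  have ck : (k : ℂ) = g * kg := by exact_mod_cast hkg
  have cg0 : (g : ℂ) ≠ 0 := by exact_mod_cast hg.ne'
  have cm0 : (m : ℂ) ≠ 0 := by exact_mod_cast hm.ne'
  have ck0 : (k : ℂ) ≠ 0 := by exact_mod_cast hk.ne'
  have ckg0 : (kg : ℂ) ≠ 0 := by exact_mod_cast hkg0.ne'
  have cmg0 : (mg : ℂ) ≠ 0 := by exact_mod_cast hmg0.ne'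
  obtain ⟨b', hb'⟩ := hħ.dvd
  have hd1 : ((mg * h : ℕ) : ℤ) * (-ħ) - b' * (kg : ℤ) = 1 := by linear_combination hb'
  have hd1c : (mg : ℂ) * h * (-ħ) - b' * kg = 1 := by exact_mod_cast hd1
  have hdetc : (h : ℂ) * d - b * k = 1 := by exact_mod_cast hdet
  have cb' : (b' : ℂ) = -((m / g * h * ħ + 1) / (k / g) : ℂ) := by
    rw [cm, ck, mul_div_cancel_left₀ _ cg0, mul_div_cancel_left₀ _ cg0, ← neg_div, eq_div_iff ckg0]
    linear_combination -hd1c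
  obtain ⟨P1, P2⟩ := Psg_all kg hkg0 _ b' kg (-ħ) rfl hd1
  set l := lamStar m r h k with hl
  set Bb : ℂ := (-ħ) * m * b - b' * d with hBb
  set s : ℂ → ℂ := fun t => (g : ℂ) ^ 2 / m * t + g * Bb / m with hs
  set bt : ℝ := r * b' / m with hbt
  obtain ⟨u, hu1, hu2⟩ := BB_asymp l (lamStar_bd m r h k).1 (lamStar_bd m r h k).2 bt
  have him : ∀ t, (s t).im = (g : ℝ) ^ 2 / m * t.im := by
    intro t
    have : s t = (((g : ℝ) ^ 2 / m : ℝ) : ℂ) * t + (((g : ℝ) * (-ħ * m * b - b' * d) / m : ℝ) : ℂ) := by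
      rw [hs, hBb]; push_cast; ring
    rw [this]; simp only [add_im, im_ofReal_mul, ofReal_im, add_zero]
  have hgm : (0 : ℝ) < (g : ℝ) ^ 2 / m := by positivity
  have hst : Filter.Tendsto s imInf imInf := by
    rw [imInf, Filter.tendsto_comap_iff]
    have : (Complex.im ∘ s) = fun t => (g : ℝ) ^ 2 / m * t.im := by ext t; exact him t
    rw [this]; exact tendsto_im.const_mul_atTop hgm
  refine ⟨fun t => u (s t), ?_, fun t ht => ?_⟩
  · have := hu2.comp_tendsto hst
    refine this.congr_right fun t => ?_
    simp only [Function.comp, him]; congr 2; ring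
  have hst0 : 0 < (s t).im := by rw [him]; positivity
  have hne := (im_moeb_int ht hdet).1
  have hne2 := (im_moeb_int hst0 hd1).1
  have m1 : (m : ℂ) * ((h * t + b) / (k * t + d)) =
      (((mg * h : ℕ) : ℤ) * s t + b') / ((kg : ℤ) * s t + (-ħ : ℤ)) := by
    push_cast at hne hne2 ⊢
    rw [← mul_div_assoc, div_eq_div_iff hne hne2]
    simp only [hs, hBb]
    rw [ck, cm]
    field_simp
    rw [ck] at hdetc
    have A : kg * (g * t + (-(g * mg * b * ħ) - b' * d)) + -(mg * ħ) = g * t * kg + d := by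
      linear_combination (d : ℂ) * hd1c + mg * ħ * hdetc
    have B : h * (g * t + (-(g * mg * b * ħ) - b' * d)) + b' = g * (h * t + b) := by
      linear_combination b * g * hd1c - b' * hdetc
    rw [A, B]
  have m2 : (r : ℂ) / m * ((mg * h : ℕ) : ℤ) + 0 * (kg : ℤ) = -(l : ℂ) + lamF m r h k := by
    rw [hl, lamStar, ← hgdef]; push_cast; rw [cm]; field_simp; ring
  have m3 : (r : ℂ) / m * b' + 0 * (-ħ : ℤ) = bt := by rw [hbt]; push_cast; ring
  rw [m1, P1 _ _ _ hst0, P2, m2, m3, sg_shift1 hst0, show (bt : ℂ) = - -bt by ring,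
    sg_neg hst0, sg, ← sub_eq_add_neg, hu1 _ hst0]
  have hP0 : (if l = 0 then 1 - ec (-bt) else 1) = P0j m r ħ h k := by
    rw [P0j, ← hl]; congr 3
    rw [hbt]; push_cast; rw [cb', ← hgdef]; field_simp; ring
  have key := ec_alg (t := t) cm0 cg0 ck0 (l := l) (lam := lamF m r h k) (r := r) (h := h) (ħ := ħ) (bt := bt)
    (d := d) (b := b) (Bb := Bb) (by rw [hl, lamStar, ← hgdef]; push_cast; rfl)
    (by rw [hbt]; push_cast; rw [cb']; field_simp; ring) hdetc
    (by rw [hBb, cb']; ring) ((dedekindSum (mg * h) kg : ℝ) : ℂ)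
  rw [hP0, pj, ← hgdef, e1, e2, mul_right_comm (ec _) (P0j _ _ _ _ _), ← ec_add, ← neg_one_mul (_ * _), ← ec_half]
  rw [show (m : ℂ) / g = mg by rw [cm]; field_simp, show (k : ℂ) / g = kg by rw [ck]; field_simp] at key
  rw [show ∀ a b c d e f : ℂ, a * (b * (c * (d * (e * f)))) = a * b * c * d * e * f by intros; ring,
    ← ec_add, ← ec_add, ← ec_add]
  congr 3
  rw [← ds_eq]
  simp only [Xj, Dj, Oj, hs, ← hl, ← hgdef]
  push_cast
  linear_combination key

def pG (J : ℕ) (m r : Fin J → ℕ) (δ : Fin J → ℤ) (ħ : Fin J → ℤ) (d : ℤ) (h k : ℕ) : ℂ :=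
  ∏ j, pj (m j) (r j) (ħ j) d h k ^ δ j

lemma Delta_sum {J : ℕ} (m r : Fin J → ℕ) (δ : Fin J → ℤ) (h k : ℕ) :
    DeltaC J m r δ h k = ∑ j, (δ j : ℝ) * Dj (m j) (r j) h k := by
  rw [DeltaC, ← sum_neg_distrib]; refine sum_congr rfl fun j _ => ?_; rw [Dj]; ring

lemma ec_sum {ι : Type*} (s : Finset ι) (f : ι → ℂ) : ec (∑ i ∈ s, f i) = ∏ i ∈ s, ec (f i) := by
  unfold ec; rw [← Complex.exp_sum, mul_sum]

lemma exp_pi_ec (x : ℂ) : exp (π * I * x) = ec (x / 2) := by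
  unfold ec; congr 1; ring

lemma pG_eq {J : ℕ} (m r : Fin J → ℕ) (δ : Fin J → ℤ) (ħ : Fin J → ℤ) (d : ℤ) (h k : ℕ) :
    pG J m r δ ħ d h k = ec (-((DeltaC J m r δ h k / 24 : ℝ) : ℂ) * d / k) *
      ec ((OmegaC J m r δ : ℝ) * h / (24 * k)) * I ^ (∑ j, δ j) *
      ((-1 : ℂ) ^ (∑ j, δ j * lamF (m j) (r j) h k) *
        (omegaC J m δ h k) ^ 2 * DC J m r δ ħ h k * PiC J m r δ ħ h k) := by
  have hI : I = ec (1 / 4) := by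
    rw [ec, show 2 * (π : ℂ) * I * (1 / 4) = π / 2 * I by ring,
      Complex.exp_pi_div_two_mul_I]
  have hPi : PiC J m r δ ħ h k = ∏ j, P0j (m j) (r j) (ħ j) h k ^ δ j := by
    rw [PiC, prod_filter]
    refine prod_congr rfl fun j _ => ?_
    rw [P0j]; split_ifs with hh
    · congr 2; rw [ec]; congr 1; ring
    · simp
  have hom : (omegaC J m δ h k) ^ 2 = ec (∑ j, -((δ j : ℂ) *
      ((dedekindSum ((m j / Nat.gcd (m j) k) * h) (k / Nat.gcd (m j) k) : ℝ) : ℂ))) := by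
    rw [omegaC, ← Complex.exp_nat_mul, ec, sum_neg_distrib]; congr 1; push_cast; ring
  have hDC : DC J m r δ ħ h k = ec (∑ j, (δ j : ℂ) * Xj (m j) (r j) (ħ j) h k / 2) := by
    rw [DC, exp_pi_ec, ← sum_div]; rfl
  have hneg : (-1 : ℂ) ^ (∑ j, δ j * lamF (m j) (r j) h k) =
      ec (∑ j, (δ j : ℂ) * lamF (m j) (r j) h k / 2) := by
    nth_rewrite 1 [← ec_half]; rw [← ec_int_mul]; congr 1; push_cast; rw [sum_mul]
    exact sum_congr rfl fun j _ => by ring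
  have hIs : I ^ (∑ j, δ j) = ec (∑ j, (δ j : ℂ) * (1 / 4)) := by
    rw [hI, ← ec_int_mul]; congr 1; push_cast; rw [sum_mul]
  have hD : ec (-((DeltaC J m r δ h k / 24 : ℝ) : ℂ) * d / k) =
      ec (∑ j, -((δ j : ℂ) * ((Dj (m j) (r j) h k / 24 : ℝ) * d / k))) := by
    rw [Delta_sum]; congr 1; push_cast; rw [sum_div, ← sum_neg_distrib, sum_mul, sum_div]
    exact sum_congr rfl fun j _ => by ring
  have hO : ec ((OmegaC J m r δ : ℝ) * h / (24 * k)) = ec (∑ j, (δ j : ℂ) * (Oj (m j) (r j) * h / (24 * k))) := by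
    congr 1; rw [OmegaC, ofReal_sum, sum_mul, sum_div]
    exact sum_congr rfl fun j _ => by rw [Oj]; push_cast; ring
  rw [hPi, hom, hDC, hneg, hIs, hD, hO, pG]
  simp_rw [pj, mul_zpow, ← ec_int_mul]
  rw [prod_mul_distrib, ← ec_sum, ← mul_assoc, ← mul_assoc, ← mul_assoc, ← ec_add, ← ec_add, ← ec_add,
    ← ec_add, ← ec_add, ← sum_add_distrib, ← sum_add_distrib, ← sum_add_distrib, ← sum_add_distrib,
    ← sum_add_distrib]
  congr 2
  exact sum_congr rfl fun j _ => by ring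

lemma locF {J : ℕ} {m r : Fin J → ℕ} {δ : Fin J → ℤ} {ħ : Fin J → ℤ} {h k : ℕ} {b d : ℤ}
    (hm : ∀ j, 0 < m j) (hk : 0 < k) (hdet : (h : ℤ) * d - b * k = 1)
    (hħ : ∀ j, ħ j * (((m j / Nat.gcd (m j) k) * h : ℕ) : ℤ) ≡ -1 [ZMOD ((k / Nat.gcd (m j) k : ℕ) : ℤ)])
    (hyp : ∀ j, DeltaC J m r δ h k / 24 ≤
      ((ups (lamStar (m j) (r j) h k) : ℚ) : ℝ) * (Nat.gcd (m j) k : ℝ) ^ 2 / (m j : ℝ)) :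
    (fun t : ℂ => FF J m r δ ((h * t + b) / (k * t + d)) - (if 0 < DeltaC J m r δ h k then
      pG J m r δ ħ d h k * ec (-((DeltaC J m r δ h k / 24 : ℝ) : ℂ) * t) else 0))
      =O[imInf] (fun _ => (1 : ℝ)) := by
  choose u hu1 hu2 using fun j => loc1 (r := r j) (hm j) hk hdet (hħ j)
  set D : ℝ := DeltaC J m r δ h k / 24 with hD
  set v : ℂ → ℂ := fun t => ∏ j, u j t ^ δ j with hv
  have hF : ∀ t : ℂ, 0 < t.im → FF J m r δ ((h * t + b) / (k * t + d)) =
      pG J m r δ ħ d h k * ec (-(D : ℂ) * t) * v t := by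
    intro t ht
    rw [FF, pG, hv, hD, Delta_sum]
    simp_rw [hu2 _ t ht, mul_zpow]
    rw [prod_mul_distrib, prod_mul_distrib]
    congr 2
    simp_rw [← ec_int_mul]
    rw [← ec_sum]; congr 1; push_cast
    rw [sum_div, ← sum_neg_distrib, sum_mul]
    exact sum_congr rfl fun j _ => by ring
  have hpos : ∀ j, (0 : ℝ) < (ups (lamStar (m j) (r j) h k) : ℝ) * (Nat.gcd (m j) k : ℝ) ^ 2 / m j := by
    intro j
    have h1 := lamStar_bd (m j) (r j) h k
    have h2 : 0 < Nat.gcd (m j) k := Nat.gcd_pos_of_pos_left _ (hm j)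
    have h3 := hm j
    have : 0 < ups (lamStar (m j) (r j) h k) := by
      unfold ups; split_ifs with a b
      · norm_num
      · exact lt_of_le_of_ne h1.1 (Ne.symm a)
      · linarith [h1.2]
    positivity
  have hev := tendsto_im.eventually_gt_atTop 0
  obtain ⟨E, hE0, hE, hED⟩ : ∃ E : ℝ, 0 < E ∧ (∀ j, E ≤
      (ups (lamStar (m j) (r j) h k) : ℝ) * (Nat.gcd (m j) k : ℝ) ^ 2 / m j) ∧ (0 < D → E = D) := by
    by_cases hD0 : 0 < D
    · exact ⟨D, hD0, hyp, fun _ => rfl⟩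
    · rcases isEmpty_or_nonempty (Fin J) with hJ | hJ
      · exact ⟨1, one_pos, fun j => (hJ.false j).elim, fun h => absurd h hD0⟩
      · obtain ⟨j0, hj0⟩ := Finite.exists_min fun j =>
          (ups (lamStar (m j) (r j) h k) : ℝ) * (Nat.gcd (m j) k : ℝ) ^ 2 / m j
        exact ⟨_, hpos j0, hj0, fun h => absurd h hD0⟩
  have hε := tendsto_exp_im hE0
  have hv1 : (fun t => v t - 1) =O[imInf] fun t => Real.exp (-2 * π * (E * t.im)) := by
    refine prod_near hε _ fun j _ => zpow_near hε ?_ _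
    refine (hu1 j).trans (Asymptotics.IsBigO.of_bound 1 ?_)
    filter_upwards [hev] with t ht
    rw [Real.norm_of_nonneg (Real.exp_nonneg _), Real.norm_of_nonneg (Real.exp_nonneg _), one_mul]
    refine Real.exp_le_exp.mpr ?_
    have := mul_le_mul_of_nonneg_right (hE j) ht.le
    nlinarith [Real.pi_pos]
  by_cases hD0 : 0 < D
  · have hD0' : 0 < DeltaC J m r δ h k := by rw [hD] at hD0; linarith
    simp only [if_pos hD0']
    have h1 : (fun t => pG J m r δ ħ d h k * ec (-(D : ℂ) * t)) =O[imInf]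
        fun t => Real.exp (2 * π * (D * t.im)) := by
      refine Asymptotics.IsBigO.of_bound ‖pG J m r δ ħ d h k‖ (Filter.Eventually.of_forall fun t => ?_)
      rw [norm_mul, norm_ec, Real.norm_of_nonneg (Real.exp_nonneg _)]
      refine mul_le_mul_of_nonneg_left (le_of_eq ?_) (norm_nonneg _)
      congr 1; simp
    refine ((h1.mul hv1).congr' ?_ ?_)
    · filter_upwards [hev] with t ht
      rw [hF t ht]; ring
    · refine Filter.Eventually.of_forall fun t => ?_
      simp only []
      rw [hED hD0, ← Real.exp_add]; simp
  · have hD0' : ¬ 0 < DeltaC J m r δ h k := by rw [hD] at hD0; intro hh; apply hD0; linarith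
    simp only [if_neg hD0', sub_zero]
    have t2 := (hv1.trans_tendsto hε).add_const 1
    simp only [sub_add_cancel, zero_add] at t2
    have h1 : (fun t => pG J m r δ ħ d h k * ec (-(D : ℂ) * t)) =O[imInf] fun _ => (1 : ℝ) := by
      refine Asymptotics.IsBigO.of_bound ‖pG J m r δ ħ d h k‖ ?_
      filter_upwards [hev] with t ht
      rw [norm_mul, norm_ec, norm_one]
      gcongr
      refine Real.exp_le_one_iff.mpr ?_
      simp
      have : D * t.im ≤ 0 := mul_nonpos_of_nonpos_of_nonneg (not_lt.mp hD0) ht.le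
      nlinarith [Real.pi_pos]
    refine (h1.mul (t2.isBigO_one ℝ)).congr' ?_ ?_
    · filter_upwards [hev] with t ht
      rw [hF t ht]
    · simp

lemma expand {M : ℕ} (hM : 0 < M) {R : ℂ → ℂ} (hper : ∀ t : ℂ, 0 < t.im → R (t + M) = R t)
    (hol : ∀ t : ℂ, 0 < t.im → DifferentiableAt ℂ R t) (hbd : R =O[imInf] fun _ => (1 : ℝ)) :
    ∃ c : ℕ → ℂ, (∀ t : ℂ, 0 < t.im → HasSum (fun ν : ℕ => c ν * ec (ν * t / M)) (R t)) ∧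
      ∀ y : ℝ, 0 < y → Summable fun ν : ℕ => ‖c ν‖ * Real.exp (-2 * π * (ν * y / M)) := by
  have hM0 : (0 : ℝ) < (M : ℝ) := by exact_mod_cast hM
  set f : ℂ → ℂ := fun z => if 0 < z.im then R z else 0 with hf
  have hfper : Function.Periodic f ((M : ℝ) : ℂ) := by
    intro z
    simp only [hf, add_im, ofReal_im, add_zero]
    split_ifs with h
    · simpa using hper z h
    · rfl
  have hev : ∀ z : ℂ, 0 < z.im → f =ᶠ[nhds z] R := fun z hz => by
    filter_upwards [(isOpen_lt continuous_const continuous_im).mem_nhds hz] with w hw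
    exact if_pos hw
  have hfhol : ∀ z : ℂ, 0 < z.im → DifferentiableAt ℂ f z := fun z hz =>
    (hol z hz).congr_of_eventuallyEq (hev z hz)
  have hpos := tendsto_im.eventually_gt_atTop 0
  have hfbd : Filter.BoundedAtFilter imInf f := by
    refine (hbd.congr' ?_ (by rfl)).trans (Asymptotics.isBigO_of_le _ (by simp))
    filter_upwards [hpos] with z hz; simp [hf, hz]
  have hd : DifferentiableOn ℂ (Function.Periodic.cuspFunction M f) (Metric.ball 0 1) := by
    intro q hq
    refine DifferentiableAt.differentiableWithinAt ?_
    by_cases hq0 : q = 0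
    · subst hq0
      refine Function.Periodic.differentiableAt_cuspFunction_zero hM0 hfper ?_ hfbd
      exact hpos.mono fun z hz => hfhol z hz
    · have e := Function.Periodic.qParam_right_inv hM0.ne' hq0
      rw [← e]
      refine Function.Periodic.differentiableAt_cuspFunction hM0.ne' hfper (hfhol _ ?_)
      rw [Function.Periodic.im_invQParam]
      have := Real.log_neg (norm_pos_iff.mpr hq0) (by simpa using hq)
      refine mul_pos_of_neg_of_neg ?_ this
      rw [neg_div]; exact neg_neg_of_pos (by positivity)
  have key : ∀ t : ℂ, 0 < t.im → HasSum (fun ν : ℕ => ((ν.factorial : ℂ)⁻¹ *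
      iteratedDeriv ν (Function.Periodic.cuspFunction M f) 0) * ec (ν * t / M)) (R t) := by
    intro t ht
    have hq : ec (t / M) ∈ Metric.ball (0 : ℂ) 1 := by
      rw [mem_ball_zero_iff]
      refine norm_ec_lt ?_
      have : t / M = (((M : ℝ)⁻¹ : ℝ) : ℂ) * t := by push_cast; ring
      rw [this, im_ofReal_mul]; positivity
    have h1 := hasSum_taylorSeries_on_ball hd hq
    have h2 : Function.Periodic.qParam M t = ec (t / M) := by
      rw [Function.Periodic.qParam, ec]; congr 1; push_cast; ring
    have h3 := Function.Periodic.eq_cuspFunction hM0.ne' hfper t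
    rw [h2] at h3
    rw [h3] at h1
    rw [show R t = f t by simp [hf, ht]]
    refine (congrArg (HasSum · (f t)) (funext fun ν => ?_)).mpr h1
    rw [sub_zero, mul_div_assoc, ec_nat_mul, smul_eq_mul, smul_eq_mul]; ring
  refine ⟨_, key, fun y hy => ?_⟩
  have := (key (y * I) (by simpa using hy)).summable.norm
  refine this.congr fun ν => ?_
  rw [norm_mul, norm_ec]; congr 3
  rw [show (ν : ℂ) * (y * I) / M = ((ν * y / M : ℝ) : ℂ) * I by push_cast; ring]
  simp

lemma gcd_cl {m L k l : ℕ} (hmL : m ∣ L) (h : k ≡ l [MOD L]) : Nat.gcd m k = Nat.gcd m l := by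
  rw [Nat.gcd_comm m k, Nat.gcd_comm m l]; exact (h.of_dvd hmL).gcd_eq

lemma lamStar_cl {m k l : ℕ} (hm : 0 < m) (hg : Nat.gcd m k = Nat.gcd m l) (r h : ℕ) :
    lamStar m r h k = lamStar m r (h % l) l := by
  obtain ⟨l', hl'⟩ : Nat.gcd m l ∣ l := Nat.gcd_dvd_right _ _
  have hg0 : (Nat.gcd m l : ℚ) ≠ 0 := by exact_mod_cast (Nat.gcd_pos_of_pos_left _ hm).ne'
  have hh : (h : ℚ) = (h % l : ℕ) + l * (h / l : ℕ) := by exact_mod_cast (Nat.mod_add_div h l).symm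
  have hl : (l : ℚ) = Nat.gcd m l * l' := by exact_mod_cast hl'
  have e : (r * h : ℚ) / Nat.gcd m l = (r * (h % l : ℕ) : ℚ) / Nat.gcd m l + ((r * l' * (h / l : ℕ) : ℕ) : ℤ) := by
    generalize h / l = q at hh ⊢
    rw [hh]; push_cast; field_simp; linear_combination (r:ℚ) * q * hl
  unfold lamStar lamF
  rw [hg, e, Int.ceil_add_intCast]; push_cast; ring

lemma Delta_cl {J : ℕ} {m : Fin J → ℕ} (r : Fin J → ℕ) (δ : Fin J → ℤ) (hm : ∀ j, 0 < m j) {k l : ℕ}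
    (hkl : k ≡ l [MOD univ.lcm m]) (h : ℕ) :
    DeltaC J m r δ h k = DeltaC J m r δ (h % l) l := by
  unfold DeltaC
  congr 1
  refine sum_congr rfl fun j _ => ?_
  have hg := gcd_cl (dvd_lcm (mem_univ j)) hkl
  rw [lamStar_cl (hm j) hg, hg]

def ellF (L : ℕ) (k : ℤ) : ℕ := ((k - 1) % L).toNat + 1

lemma ellF_mem {L : ℕ} (hL : 0 < L) (k : ℤ) : ellF L k ∈ Icc 1 L := by
  have h1 := Int.emod_nonneg (k - 1) (by omega : (L : ℤ) ≠ 0)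
  have h2 := Int.emod_lt_of_pos (k - 1) (by omega : (0 : ℤ) < L)
  rw [mem_Icc, ellF]; omega

lemma ellF_mod {L : ℕ} (hL : 0 < L) (k : ℕ) : k ≡ ellF L k [MOD L] := by
  have h1 := Int.emod_nonneg ((k : ℤ) - 1) (by omega : (L : ℤ) ≠ 0)
  rw [← Int.natCast_modEq_iff, ellF]
  push_cast
  rw [Int.toNat_of_nonneg h1]
  refine Int.modEq_iff_dvd.mpr ⟨-((k - 1) / L), ?_⟩
  have := Int.emod_add_mul_ediv ((k : ℤ) - 1) L
  linear_combination this

def Dc (J : ℕ) (m r : Fin J → ℕ) (δ : Fin J → ℤ) (h k : ℤ) : ℝ :=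
  DeltaC J m r δ (h % ellF (univ.lcm m) k).toNat (ellF (univ.lcm m) k) / 24

lemma lcm_pos' {J : ℕ} {m : Fin J → ℕ} (hm : ∀ j, 0 < m j) : 0 < univ.lcm m :=
  Nat.pos_of_ne_zero fun h => by
    obtain ⟨j, _, hj⟩ := lcm_eq_zero_iff.mp h
    exact (hm j).ne' hj

lemma Dc_eq {J : ℕ} {m : Fin J → ℕ} (r : Fin J → ℕ) (δ : Fin J → ℤ) (hm : ∀ j, 0 < m j) (h k : ℕ) :
    Dc J m r δ h k = DeltaC J m r δ h k / 24 := by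
  rw [Dc, Delta_cl r δ hm (ellF_mod (lcm_pos' hm) k) h]; rfl

lemma Dc_congr {J : ℕ} {m : Fin J → ℕ} (r : Fin J → ℕ) (δ : Fin J → ℤ) (hm : ∀ j, 0 < m j) {M : ℕ}
    (hLM : univ.lcm m ∣ M) (hlM : ∀ l ∈ Icc 1 (univ.lcm m), l ∣ M) {h k h' k' : ℤ}
    (hh : (M : ℤ) ∣ h' - h) (hk : (M : ℤ) ∣ k' - k) : Dc J m r δ h' k' = Dc J m r δ h k := by
  have e : ellF (univ.lcm m) k' = ellF (univ.lcm m) k := by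
    rw [ellF, ellF]
    congr 2
    refine (Int.modEq_iff_dvd.mpr ?_).symm
    rw [show k' - 1 - (k - 1) = k' - k by ring]
    exact (Int.natCast_dvd_natCast.mpr hLM).trans hk
  rw [Dc, Dc, e]
  congr 3
  refine (Int.modEq_iff_dvd.mpr ?_).symm
  exact (Int.natCast_dvd_natCast.mpr (hlM _ (ellF_mem (lcm_pos' hm) k))).trans hh

lemma MD_int {J : ℕ} {m r : Fin J → ℕ} {δ : Fin J → ℤ} (hm : ∀ j, 0 < m j) {M : ℕ}
    (hM : ∀ j, 24 * (m j) ^ 2 ∣ M) (h k : ℕ) : ∃ z : ℤ, (M : ℝ) * (DeltaC J m r δ h k / 24) = z := by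
  have : ∀ j, ∃ z : ℤ, (M : ℝ) * (Dj (m j) (r j) h k / 24) = z := by
    intro j
    obtain ⟨x, hx⟩ := hM j
    have hg := Nat.gcd_pos_of_pos_left k (hm j)
    have hg' : (Nat.gcd (m j) k : ℝ) ≠ 0 := by exact_mod_cast hg.ne'
    have hm' : (m j : ℝ) ≠ 0 := by exact_mod_cast (hm j).ne'
    have hl : (lamStar (m j) (r j) h k : ℝ) = (lamF (m j) (r j) h k * Nat.gcd (m j) k - r j * h) / Nat.gcd (m j) k := by
      rw [lamStar]; push_cast; field_simp
    refine ⟨-(m j * x * (2 * Nat.gcd (m j) k ^ 2 + 12 * ((lamF (m j) (r j) h k * Nat.gcd (m j) k - r j * h) ^ 2 -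
      Nat.gcd (m j) k * (lamF (m j) (r j) h k * Nat.gcd (m j) k - r j * h)))), ?_⟩
    rw [Dj, hl, hx]; push_cast; field_simp
  choose z hz using this
  refine ⟨∑ j, δ j * z j, ?_⟩
  push_cast
  rw [Delta_sum, sum_div, mul_sum]
  exact sum_congr rfl fun j _ => by rw [← hz]; ring

instance : imInf.NeBot := Filter.NeBot.comap_of_surj inferInstance fun y => ⟨⟨0, y⟩, rfl⟩

lemma eq_zero_of_bdd {x : ℂ} {D : ℝ} (hD : 0 < D)
    (h : (fun t : ℂ => x * ec (-(D : ℂ) * t)) =O[imInf] fun _ => (1 : ℝ)) : x = 0 := by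
  have h1 : (fun t : ℂ => ec (D * t)) =O[imInf] fun t => Real.exp (-2 * π * (D * t.im)) := by
    refine Asymptotics.isBigO_of_le _ fun t => ?_
    rw [norm_ec, Real.norm_of_nonneg (Real.exp_nonneg _)]; simp
  have h2 := (h.mul h1).trans_tendsto (by simpa using tendsto_exp_im hD)
  refine tendsto_nhds_unique (tendsto_const_nhds.congr fun t => ?_) h2
  rw [mul_assoc, ← ec_add, show -(D : ℂ) * t + D * t = 0 by ring, ec_zero, mul_one]

lemma exists_hbar {m h k : ℕ} (hm : 0 < m) {b d : ℤ} (hdet : (h : ℤ) * d - b * k = 1) :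
    ∃ ħ : ℤ, ħ * (((m / Nat.gcd m k) * h : ℕ) : ℤ) ≡ -1 [ZMOD ((k / Nat.gcd m k : ℕ) : ℤ)] := by
  have hg := Nat.gcd_pos_of_pos_left k hm
  have c1 : Nat.Coprime (m / Nat.gcd m k) (k / Nat.gcd m k) := Nat.coprime_div_gcd_div_gcd hg
  have c2 : Nat.Coprime h (k / Nat.gcd m k) := by
    have : IsCoprime (h : ℤ) k := ⟨d, -b, by linear_combination hdet⟩
    exact (Nat.isCoprime_iff_coprime.mp this).coprime_dvd_right (Nat.div_dvd_of_dvd (Nat.gcd_dvd_right _ _))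
  obtain ⟨u, v, huv⟩ := Nat.isCoprime_iff_coprime.mpr (c1.mul_left c2)
  refine ⟨-u, Int.modEq_iff_dvd.mpr ⟨-v, ?_⟩⟩
  linear_combination huv

def okG (M h0 b0 k0 d0 h b k d : ℤ) : Prop :=
  0 < k ∧ h * d - b * k = 1 ∧ M ∣ h - h0 ∧ M ∣ b - b0 ∧ M ∣ k - k0 ∧ M ∣ d - d0

lemma Iface0 {J : ℕ} {m r : Fin J → ℕ} {δ : Fin J → ℤ}
    (hm : ∀ j, 0 < m j) (hr : ∀ j, 1 ≤ r j) (hrm : ∀ j, r j < m j)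
    (hassump : ∀ ℓ ∈ Finset.Icc 1 (univ.lcm m), ∀ κ ∈ range ℓ, ∀ j,
      ((ups (lamStar (m j) (r j) κ ℓ) : ℚ) : ℝ) * (Nat.gcd (m j) ℓ : ℝ) ^ 2 / (m j : ℝ)
        ≥ DeltaC J m r δ κ ℓ / 24) {M : ℕ} (hM0 : 0 < M) (hM : ∀ j, 24 * (m j) ^ 2 ∣ M)
    (hLM : univ.lcm m ∣ M) (hlM : ∀ l ∈ Icc 1 (univ.lcm m), l ∣ M) (h0 b0 k0 d0 : ℤ) :
    ∃ (p : ℂ) (c : ℕ → ℂ),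
      (∀ y : ℝ, 0 < y → Summable fun ν : ℕ => ‖c ν‖ * Real.exp (-2 * π * (ν * y / M))) ∧
      (∀ h b k d : ℤ, okG M h0 b0 k0 d0 h b k d → ∀ t : ℂ, 0 < t.im →
        HasSum (fun ν : ℕ => c ν * ec (ν * t / M))
          (FF J m r δ ((h * t + b) / (k * t + d)) - p * ec (-(Dc J m r δ h0 k0 : ℂ) * t))) ∧
      (Dc J m r δ h0 k0 ≤ 0 → p = 0) ∧
      (∀ (h k : ℕ) (b d : ℤ) (ħ : Fin J → ℤ), okG M h0 b0 k0 d0 h b k d → (∀ j, ħ j *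
        (((m j / Nat.gcd (m j) k) * h : ℕ) : ℤ) ≡ -1 [ZMOD ((k / Nat.gcd (m j) k : ℕ) : ℤ)]) →
        0 < Dc J m r δ h0 k0 → p = pG J m r δ ħ d h k) := by
  have hMi : (0 : ℤ) < M := by exact_mod_cast hM0
  have hM24 : ∀ j, (24 * (m j : ℤ) ^ 2) ∣ (M : ℤ) := fun j => by exact_mod_cast hM j
  set D := Dc J m r δ h0 k0 with hD
  have hDD : ∀ {h k : ℕ} {b d : ℤ}, okG M h0 b0 k0 d0 h b k d → DeltaC J m r δ h k / 24 = D := by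
    intro h k b d ⟨_, _, h1, _, h2, _⟩
    rw [hD, ← Dc_eq r δ hm]; exact Dc_congr r δ hm hLM hlM h1 h2
  have hloc : ∀ {h k : ℕ} {b d : ℤ} {ħ : Fin J → ℤ}, okG M h0 b0 k0 d0 h b k d → (∀ j, ħ j *
        (((m j / Nat.gcd (m j) k) * h : ℕ) : ℤ) ≡ -1 [ZMOD ((k / Nat.gcd (m j) k : ℕ) : ℤ)]) →
      (fun t : ℂ => FF J m r δ ((h * t + b) / (k * t + d)) -
        (if 0 < D then pG J m r δ ħ d h k else 0) * ec (-(D : ℂ) * t)) =O[imInf] fun _ => (1 : ℝ) := by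
    intro h k b d ħ hok hħ
    have e := hDD hok
    have hl := ellF_mod (lcm_pos' hm) k
    have := locF (δ := δ) (r := r) hm (by exact_mod_cast hok.1) hok.2.1 hħ fun j => by
      have hg := gcd_cl (dvd_lcm (mem_univ j)) hl
      rw [Delta_cl r δ hm hl h, lamStar_cl (hm j) hg, hg]
      have hmem := ellF_mem (lcm_pos' hm) k
      exact hassump _ hmem _ (mem_range.mpr (Nat.mod_lt _ (mem_Icc.mp hmem).1)) j
    refine this.congr_left fun t => ?_
    rw [e, ite_mul, zero_mul]
    congr 2
    rw [← e]; simp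
  by_cases H : ∃ h b k d, okG M h0 b0 k0 d0 h b k d
  swap
  · push Not at H
    refine ⟨0, fun _ => 0, by simp [summable_zero], fun h b k d hok => (H _ _ _ _ hok).elim, by simp,
      fun h k b d ħ hok => (H _ _ _ _ hok).elim⟩
  obtain ⟨h1, b1, k1, d1, hok1⟩ := H
  obtain ⟨h2, b2, k2, d2, hok2⟩ : ∃ (h2 : ℕ) (b2 : ℤ) (k2 : ℕ) (d2 : ℤ), okG M h0 b0 k0 d0 h2 b2 k2 d2 := by
    obtain ⟨a1, a2, a3, a4, a5, a6⟩ := hok1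
    have : 0 ≤ h1 + M * |h1| * k1 := by
      have := neg_abs_le h1
      have : 1 ≤ M * k1 := Int.add_one_le_of_lt (a := 0) (by positivity)
      nlinarith [abs_nonneg h1]
    refine ⟨(h1 + M * |h1| * k1).toNat, b1 + M * |h1| * d1, k1.toNat, d1, ?_⟩
    rw [Int.toNat_of_nonneg this, Int.toNat_of_nonneg a1.le]
    refine ⟨a1, by linear_combination a2, ?_, ?_, a5, a6⟩
    · rw [add_sub_right_comm]; exact dvd_add a3 ⟨|h1| * k1, by ring⟩
    · rw [add_sub_right_comm]; exact dvd_add a4 ⟨|h1| * d1, by ring⟩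
  have hk2 : 0 < k2 := by exact_mod_cast hok2.1
  choose ħ hħ using fun j => exists_hbar (hm j) hok2.2.1
  have hcl : ∀ h b k d : ℤ, okG M h0 b0 k0 d0 h b k d → ∀ t : ℂ, 0 < t.im →
      FF J m r δ ((h * t + b) / (k * t + d)) = FF J m r δ ((h2 * t + b2) / (k2 * t + d2)) := by
    intro h b k d ⟨a1, a2, a3, a4, a5, a6⟩ t ht
    obtain ⟨c1, c2, c3, c4, c5, c6⟩ := hok2
    have f : ∀ {x y z : ℤ}, (M : ℤ) ∣ x - z → (M : ℤ) ∣ y - z → (M : ℤ) ∣ x - y := fun {x y z} u v => by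
      have := dvd_sub u v; rwa [sub_sub_sub_cancel_right] at this
    exact FF_class hm hMi hM24 c2 a2 c1 a1 (f a3 c3) (f a4 c4) (f a5 c5) (f a6 c6) ht
  set p := if 0 < D then pG J m r δ ħ d2 h2 k2 else 0 with hp
  set R : ℂ → ℂ := fun t => FF J m r δ ((h2 * t + b2) / (k2 * t + d2)) - p * ec (-(D : ℂ) * t) with hR
  have hdet2 := hok2.2.1
  have hper : ∀ t : ℂ, 0 < t.im → R (t + M) = R t := by
    intro t ht
    have e1 := hcl h2 (b2 + M * h2) k2 (d2 + M * k2) ⟨hok2.1, by linear_combination hok2.2.1, hok2.2.2.1,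
      by rw [add_sub_right_comm]; exact dvd_add hok2.2.2.2.1 ⟨h2, by ring⟩, hok2.2.2.2.2.1,
      by rw [add_sub_right_comm]; exact dvd_add hok2.2.2.2.2.2 ⟨k2, by ring⟩⟩ t ht
    simp only [hR]
    congr 1
    · rw [← e1]; push_cast; congr 2 <;> ring
    · obtain ⟨z, hz⟩ := MD_int (r := r) (δ := δ) hm hM h2 k2
      rw [hDD hok2] at hz
      have hz' : (M : ℂ) * D = z := by exact_mod_cast hz
      rw [show -(D : ℂ) * (t + M) = -D * t + ((-z : ℤ) : ℂ) by push_cast; rw [← hz']; ring, ec_add_int]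
  have hdif : ∀ t : ℂ, 0 < t.im → DifferentiableAt ℂ R t := by
    intro t ht
    have hh := im_moeb_int ht hdet2
    push_cast at hh
    refine DifferentiableAt.sub ?_ ?_
    · refine DifferentiableAt.comp (g := FF J m r δ) t (differentiableAt_FF hr hrm hh.2) ?_
      refine DifferentiableAt.div (by fun_prop) (by fun_prop) hh.1
    · exact ((differentiable_ec.comp (differentiable_id.const_mul (-(D : ℂ)))).const_mul p) t
  obtain ⟨c, hc1, hc2⟩ := expand (R := R) hM0 hper hdif (hloc hok2 hħ)
  refine ⟨p, c, hc2, fun h b k d hok t ht => ?_, fun hD0 => by rw [hp, if_neg (not_lt.mpr hD0)],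
    fun h k b d ħ' hok hħ' hD0 => ?_⟩
  · rw [hcl h b k d hok t ht]; exact hc1 t ht
  · have o1 := hloc hok2 hħ
    have o2 := hloc hok hħ'
    rw [← sub_eq_zero]
    refine eq_zero_of_bdd hD0 ((o2.sub o1).congr' ?_ (by rfl))
    filter_upwards [tendsto_im.eventually_gt_atTop 0] with t ht
    have := hcl h b k d hok t ht
    push_cast at this
    rw [this, ← hp, if_pos hD0]; ring

lemma abel_int {f : ℕ → ℝ → ℂ} (hf : ∀ i, Continuous (f i)) {β : ℕ → ℝ} (hβ : Antitone β) {α X : ℝ} {n : ℕ}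
    (hα : α ≤ β n) (hX : ∀ θ ∈ Set.Icc α (β 0), ∀ n' ≤ n, ‖∑ i ∈ range n', f i θ‖ ≤ X) :
    ‖∑ i ∈ range n, ∫ θ in α..β i, f i θ‖ ≤ X * (β 0 - α) := by
  have hP : ∀ n, Continuous fun θ => ∑ i ∈ range n, f i θ := fun n => continuous_finsetSum _ fun i _ => hf i
  have bd : ∀ n' ≤ n, ∀ u v : ℝ, α ≤ u → u ≤ v → v ≤ β 0 →
      ‖∫ θ in u..v, ∑ i ∈ range n', f i θ‖ ≤ X * (v - u) := by
    intro n' hn' u v hu huv hv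
    rw [← abs_of_nonneg (sub_nonneg.mpr huv)]
    refine intervalIntegral.norm_integral_le_of_norm_le_const fun θ hθ => ?_
    rw [Set.uIoc_of_le huv] at hθ
    exact hX θ ⟨hu.trans hθ.1.le, hθ.2.trans hv⟩ n' hn'
  have key : ∀ n' ≤ n, ‖∑ i ∈ range n', (∫ θ in α..β i, f i θ) - ∫ θ in α..β n', ∑ i ∈ range n', f i θ‖ ≤
      X * (β 0 - β n') := by
    intro n'
    induction n' with
    | zero => intro _; simp
    | succ j ih =>
      intro hj
      have h1 := ih (by omega)
      have h2 := bd (j + 1) hj (β (j + 1)) (β j) (hα.trans (hβ hj)) (hβ (by omega)) (hβ (by omega))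
      rw [← intervalIntegral.integral_interval_sub_left (a := α) ((hP _).intervalIntegrable _ _)
        ((hP _).intervalIntegrable _ _)] at h2
      have e : ∫ θ in α..β j, ∑ i ∈ range (j + 1), f i θ =
          (∫ θ in α..β j, ∑ i ∈ range j, f i θ) + ∫ θ in α..β j, f j θ := by
        rw [← intervalIntegral.integral_add ((hP _).intervalIntegrable _ _) ((hf _).intervalIntegrable _ _)]
        simp only [sum_range_succ]
      rw [e] at h2
      rw [sum_range_succ]
      calc _ = ‖(∑ i ∈ range j, (∫ θ in α..β i, f i θ) - ∫ θ in α..β j, ∑ i ∈ range j, f i θ) +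
          ((∫ θ in α..β j, ∑ i ∈ range j, f i θ) + (∫ θ in α..β j, f j θ) -
            ∫ θ in α..β (j + 1), ∑ i ∈ range (j + 1), f i θ)‖ := by congr 1; ring
        _ ≤ _ := (norm_add_le _ _).trans ((add_le_add h1 h2).trans (by linarith))
  have h1 := key n le_rfl
  have h2 := bd n le_rfl α (β n) le_rfl hα (hβ (by omega))
  calc _ = ‖(∑ i ∈ range n, (∫ θ in α..β i, f i θ) - ∫ θ in α..β n, ∑ i ∈ range n, f i θ) +
      ∫ θ in α..β n, ∑ i ∈ range n, f i θ‖ := by congr 1; ring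
    _ ≤ _ := (norm_add_le _ _).trans ((add_le_add h1 h2).trans (by linarith))

structure CD where
  M : ℕ
  A : ℕ
  hM : 0 < M
  hA : 0 < A
  G : ℂ → ℂ
  hG : ∀ t : ℂ, 0 < t.im → ContinuousAt G t
  hG1 : ∀ t : ℂ, G (t + 1) = G t
  p : ℤ → ℤ → ℤ → ℤ → ℂ
  c : ℕ → ℤ → ℤ → ℤ → ℤ → ℂ
  mu : ℤ → ℤ → ℤ
  v : ℕ → ℕ → ℂ
  U : Finset ℤ
  W : ℝ
  C : ℕ → ℝ
  hp : ∀ h b k d, p h b k d = p (h % M) (b % M) (k % M) (d % M)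
  hc : ∀ ν h b k d, c ν h b k d = c ν (h % M) (b % M) (k % M) (d % M)
  hmu : ∀ h k, mu h k = mu (h % M) (k % M)
  hW : ∀ h b k d, ‖p h b k d‖ ≤ W
  hC : ∀ ν h b k d, ‖c ν h b k d‖ ≤ C ν
  hsum : ∀ y : ℝ, 0 < y → Summable fun ν : ℕ => C ν * Real.exp (-2 * π * (ν * y / M))
  hU : ∀ μ ∈ U, 0 < μ
  hpU : ∀ h b k d, mu h k ∉ U → p h b k d = 0
  hexp : ∀ h b k d : ℤ, 0 < k → h * d - b * k = 1 → ∀ t : ℂ, 0 < t.im →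
    HasSum (fun ν : ℕ => c ν h b k d * ec (ν * t / M))
      (G ((h * t + b) / (k * t + d)) * ec (A / M * ((h * t + b) / (k * t + d))) -
        p h b k d * ec (-(mu h k / M : ℂ) * t))
  hv : ∀ (h k : ℕ) (b d : ℤ), 0 < k → (h : ℤ) * d - b * k = 1 →
    p h b k d = v h k * ec (-((mu h k : ℂ) * d / (M * k)))
  hmu1 : ∀ h k : ℕ, mu (h + k : ℕ) k = mu h k
  hv1 : ∀ h k : ℕ, 0 < k → Nat.gcd h k = 1 → v (h + k) k * ec (-(A * (h + k : ℕ) : ℂ) / (M * k)) = v h k * ec (-(A * h : ℂ) / (M * k))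

namespace CD
variable (D : CD)

def E (k : ℕ) (x : ℤ) (w : ℂ) : ℂ := exp (2 * π * (D.A / D.M) * w + 2 * π * (x / (D.M * k ^ 2)) / w)

def pU (k : ℤ) (μ : ℤ) (h b d : ℤ) : ℂ := if D.mu h k = μ then D.p h b k d else 0

def cs (σ : ℤ) (N k : ℕ) (w : ℤ → ℤ → ℤ → ℂ) (x : ℤ) (i : ℕ) : ℂ :=
  ∑ h ∈ range (D.M * k), if (k : ℤ) ∣ h * (-σ * (N - k + 1 + i : ℕ)) - 1 then
    Gf D.M k (-D.A) x w h (-σ * (N - k + 1 + i : ℕ)) else 0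

lemma hexp' {k : ℕ} (hk : 0 < k) {h d : ℤ} (hd : (k : ℤ) ∣ h * d - 1) {w : ℂ} (hw : 0 < w.re) :
    HasSum (fun ν : ℕ => Gf D.M k (-D.A) (-ν) (fun h b d => D.c ν h b k d) h d * D.E k (-ν) w)
      (D.G (h / k + I * w) - ∑ μ ∈ D.U, Gf D.M k (-D.A) μ (D.pU k μ) h d * D.E k μ w) := by
  obtain ⟨b, hb⟩ := hd
  have hk' : (k : ℂ) ≠ 0 := by exact_mod_cast hk.ne'
  have hM' : (D.M : ℂ) ≠ 0 := by exact_mod_cast D.hM.ne'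
  have hw' : w ≠ 0 := fun h => by simp [h] at hw
  have hbk : (h * d - 1) / (k : ℤ) = b := by rw [hb]; exact Int.mul_ediv_cancel_left _ (by omega)
  have hdet : h * d - b * k = 1 := by linarith
  have hdc : (h : ℂ) * d - b * k = 1 := by exact_mod_cast hdet
  set t : ℂ := -d / k + I / (k ^ 2 * w) with ht
  have htim : 0 < t.im := by
    have e : t = ((-d / k : ℝ) : ℂ) + I * (((1 / k ^ 2 : ℝ) : ℂ) * w⁻¹) := by rw [ht]; push_cast; field_simp
    rw [e, add_im, ofReal_im, zero_add, I_mul_im, re_ofReal_mul, inv_re]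
    have := normSq_pos.mpr hw'
    positivity
  have hden : (k : ℂ) * t + d = I / (k * w) := by rw [ht]; field_simp; ring
  have hτ : ((h : ℂ) * t + b) / ((k : ℤ) * t + d) = h / k + I * w := by
    push_cast
    rw [hden, div_eq_iff (div_ne_zero I_ne_zero (mul_ne_zero hk' hw')), ht]
    field_simp
    linear_combination (-w * k) * hdc - w * k * I_sq
  have key := (D.hexp h b k d (by exact_mod_cast hk) hdet t htim).mul_right (ec (-(D.A / D.M * (h / k + I * w))))
  rw [hτ] at key
  have hE : ∀ (x : ℤ) (z : ℂ), z * ec (-x * t / D.M) * ec (-(D.A / D.M * (h / k + I * w))) =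
      z * ec (((-D.A * h + x * d : ℤ) : ℂ) / ((D.M * k : ℕ) : ℂ)) * D.E k x w := by
    intro x z
    rw [mul_assoc, mul_assoc, ← ec_add]
    congr 1
    rw [E, ec, ec, ← Complex.exp_add]
    congr 1
    rw [ht]; push_cast; field_simp
    linear_combination (-(D.A * w ^ 2 * k ^ 2 + x) : ℂ) * I_sq
  have e2 : (D.G (h / k + I * w) * ec (D.A / D.M * (h / k + I * w)) - D.p h b k d * ec (-(D.mu h k / D.M : ℂ) * t)) *
      ec (-(D.A / D.M * (h / k + I * w))) =
      D.G (h / k + I * w) - ∑ μ ∈ D.U, Gf D.M k (-D.A) μ (D.pU k μ) h d * D.E k μ w := by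
    have e3 : ∑ μ ∈ D.U, Gf D.M k (-D.A) μ (D.pU k μ) h d * D.E k μ w =
        D.p h b k d * ec (-(D.mu h k) * t / D.M) * ec (-(D.A / D.M * (h / k + I * w))) := by
      rw [hE]
      by_cases hmem : D.mu h k ∈ D.U
      · rw [sum_eq_single_of_mem _ hmem]
        · simp only [Gf, pU, hbk, if_true]
        · intro μ _ hne
          simp [Gf, pU, hne.symm]
      · rw [D.hpU _ _ _ _ hmem, zero_mul, zero_mul]
        refine sum_eq_zero fun μ hμ => ?_
        simp [Gf, pU, (show D.mu h k ≠ μ from fun h => hmem (h ▸ hμ))]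
    rw [e3, sub_mul, mul_assoc, ← ec_add, add_neg_cancel, ec_zero, mul_one]
    congr 4; ring
  rw [e2] at key
  refine (congrArg (HasSum · _) (funext fun ν => ?_)).mpr key
  have := hE (-ν) (D.c ν h b k d)
  push_cast at this
  rw [neg_neg] at this
  rw [this, Gf, hbk]
  push_cast; rfl

lemma E_norm {k : ℕ} (x : ℤ) (w : ℂ) : ‖D.E k x w‖ =
    Real.exp (2 * π * (D.A / D.M) * w.re + 2 * π * (x / (D.M * k ^ 2)) * (w.re / normSq w)) := by
  rw [E, norm_exp]
  congr 1
  have e : 2 * (π : ℂ) * (D.A / D.M) * w + 2 * π * (x / (D.M * k ^ 2)) / w =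
    ((2 * π * (D.A / D.M) : ℝ) : ℂ) * w + ((2 * π * (x / (D.M * k ^ 2)) : ℝ) : ℂ) * w⁻¹ := by
    push_cast; rw [← div_eq_mul_inv]
  rw [e, add_re, re_ofReal_mul, re_ofReal_mul, inv_re]

lemma cs_bd : ∃ B : ℝ, 0 ≤ B ∧ ∀ (σ : ℤ), (σ = 1 ∨ σ = -1) → ∀ (N k : ℕ), 0 < k → ∀ (w : ℤ → ℤ → ℤ → ℂ) (W : ℝ),
    (∀ x b y, ‖w x b y‖ ≤ W) → (∀ x b y, w x b y = w (x % D.M) (b % D.M) (y % D.M)) → ∀ x, ∀ n ≤ k,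
    ‖∑ i ∈ range n, D.cs σ N k w x i‖ ≤ B * W * (k : ℝ) ^ ((47 : ℝ) / 48) := by
  obtain ⟨B, hB, H⟩ := KLf D.M D.hM (-D.A) (by have := D.hA; omega)
  refine ⟨B, hB, fun σ hσ N k hk w W hw hper x n hn => ?_⟩
  have hn' : n ≤ D.M * k := hn.trans (Nat.le_mul_of_pos_left _ D.hM)
  rcases hσ with rfl | rfl
  · convert H k hk x (-(N - k + 1 : ℕ) - (n - 1 : ℤ)) n hn' W w hw hper using 2
    rw [← sum_range_reflect]
    refine sum_congr rfl fun i hi => sum_congr rfl fun h _ => ?_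
    have := mem_range.mp hi
    have e : (-1 * (N - k + 1 + (n - 1 - i) : ℕ) : ℤ) = -(N - k + 1 : ℕ) - (n - 1 : ℤ) + i := by omega
    rw [e]
  · convert H k hk x (N - k + 1 : ℕ) n hn' W w hw hper using 2
    refine sum_congr rfl fun i hi => sum_congr rfl fun h _ => ?_
    have e : (- -1 * (N - k + 1 + i : ℕ) : ℤ) = (N - k + 1 : ℕ) + i := by push_cast; ring
    rw [e]

end CD

lemma wgeo1 {N k y θ : ℝ} (hN : 1 ≤ N) (hk : 1 ≤ k) (hkN : k ≤ N) (hy : y = 1 / N ^ 2) (h0 : 0 ≤ θ)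
    (h1 : θ ≤ 1 / (k * (N + 1))) : 1 / 2 ≤ y / (k ^ 2 * (y ^ 2 + θ ^ 2)) := by
  have hy0 : 0 < y := by rw [hy]; positivity
  have a1 : (k * θ) ^ 2 ≤ y := by
    have : k * θ ≤ 1 / N := by
      rw [le_div_iff₀ (by positivity)] at h1
      rw [le_div_iff₀ (by positivity)]; nlinarith [mul_nonneg (by linarith : 0 ≤ k) h0]
    rw [hy, ← one_div_pow]; exact pow_le_pow_left₀ (by positivity) this 2
  have a2 : k ^ 2 * y ≤ 1 := by
    rw [hy, mul_one_div, div_le_one (by positivity)]; exact pow_le_pow_left₀ (by positivity) hkN 2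
  rw [div_le_div_iff₀ two_pos (by positivity)]
  nlinarith

lemma wgeo2 {N k y θ : ℝ} (hN : 1 ≤ N) (hk : 1 ≤ k) (hkN : k ≤ N) (hy : y = 1 / N ^ 2)
    (h1 : 1 / (k * (N + k + 1)) ≤ θ) : y / (k ^ 2 * (y ^ 2 + θ ^ 2)) ≤ 9 := by
  have hy0 : 0 < y := by rw [hy]; positivity
  have a1 : y ≤ 9 * (k * θ) ^ 2 := by
    have : 1 / N ≤ 3 * (k * θ) := by
      rw [div_le_iff₀ (by positivity)] at h1
      have : 0 ≤ k * θ := by by_contra! h; nlinarith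
      rw [div_le_iff₀ (by positivity)]; nlinarith
    rw [hy, ← one_div_pow]; nlinarith [pow_le_pow_left₀ (by positivity) this 2]
  have hθ : 0 < θ := lt_of_lt_of_le (by positivity) h1
  rw [div_le_iff₀ (by positivity)]
  have : 0 ≤ k ^ 2 * y ^ 2 := by positivity
  nlinarith

namespace CD
variable (D : CD)

def Z (σ : ℤ) (N k i : ℕ) (w : ℂ) : ℂ :=
  ∑ h ∈ range (D.M * k), if (k : ℤ) ∣ h * (-σ * (N - k + 1 + i : ℕ)) - 1 then D.G (h / k + I * w) else 0

lemma hexpZ {σ : ℤ} {N k i : ℕ} (hk : 0 < k) {w : ℂ} (hw : 0 < w.re) :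
    HasSum (fun ν : ℕ => D.cs σ N k (fun h b d => D.c ν h b k d) (-ν) i * D.E k (-ν) w)
      (D.Z σ N k i w - ∑ μ ∈ D.U, D.cs σ N k (D.pU k μ) μ i * D.E k μ w) := by
  simp only [cs, Z, sum_mul]
  rw [sum_comm, ← sum_sub_distrib]
  refine hasSum_sum fun h _ => ?_
  by_cases hd : (k : ℤ) ∣ h * (-σ * (N - k + 1 + i : ℕ)) - 1
  · simp only [if_pos hd]
    have := D.hexp' hk hd hw
    simp only [Int.cast_natCast] at this
    exact this
  · simp only [if_neg hd, zero_mul, sum_const_zero, sub_zero]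
    exact hasSum_zero

def wf (σ : ℤ) (y θ : ℝ) : ℂ := y - σ * θ * I

lemma wf_re (σ : ℤ) (y θ : ℝ) : (wf σ y θ).re = y := by
  rw [wf, show (σ * θ * I : ℂ) = ((σ * θ : ℝ) : ℂ) * I by push_cast; ring]; simp

lemma wf_sq {σ : ℤ} (hσ : σ = 1 ∨ σ = -1) (y θ : ℝ) : normSq (wf σ y θ) = y ^ 2 + θ ^ 2 := by
  rcases hσ with rfl | rfl <;> simp [wf, normSq_apply] <;> ring

lemma wf_cont (σ : ℤ) (y : ℝ) : Continuous (wf σ y) := by unfold wf; fun_prop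

lemma E_cont {σ : ℤ} {y : ℝ} (hy : 0 < y) (k : ℕ) (x : ℤ) : Continuous fun θ => D.E k x (wf σ y θ) := by
  have := wf_cont σ y
  have h0 : ∀ θ, wf σ y θ ≠ 0 := fun θ h => by have := wf_re σ y θ; rw [h] at this; simp at this; linarith
  unfold E
  exact continuous_exp.comp ((continuous_const.mul this).add (continuous_const.div this h0))

lemma G_cont {σ : ℤ} {y : ℝ} (hy : 0 < y) (x : ℝ) : Continuous fun θ => D.G (x + I * wf σ y θ) := by
  have := wf_cont σ y
  refine continuous_iff_continuousAt.mpr fun θ => ContinuousAt.comp (D.hG _ ?_) (by fun_prop)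
  simp [wf_re, hy]

lemma Z_cont {σ : ℤ} {y : ℝ} (hy : 0 < y) (N k i : ℕ) : Continuous fun θ => D.Z σ N k i (wf σ y θ) := by
  refine continuous_finsetSum _ fun h _ => ?_
  split_ifs
  · have := D.G_cont (σ := σ) hy (h / k)
    push_cast at this; exact this
  · exact continuous_const

lemma arc_Z {σ : ℤ} {y : ℝ} (hy : 0 < y) (N : ℕ) {k : ℕ} (hk : 0 < k) (i : ℕ) :
    D.M * arcI (fun x => D.G (x + I * y)) σ k (N - k + 1 + i) =
      ∫ θ in (0 : ℝ)..(1 / (k * (k + (N - k + 1 + i : ℕ)))), D.Z σ N k i (wf σ y θ) := by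
  have hk' : (k : ℂ) ≠ 0 := by exact_mod_cast hk.ne'
  unfold Z arcI
  rw [intervalIntegral.integral_finsetSum]
  · generalize N - k + 1 + i = κ
    refine Eq.trans ?_ ((sum_range_periodic k D.M (fun h : ℤ => if (k : ℤ) ∣ h * (-σ * κ) - 1 then
      ∫ θ in (0 : ℝ)..(1 / (k * (k + κ))), D.G (h / k + I * wf σ y θ) else 0) ?_).symm.trans ?_)
    · congr 1
      refine sum_congr rfl fun h _ => ?_
      simp only [Int.cast_natCast]
      split_ifs
      · congr 1; funext θ; congr 1
        rw [wf]; push_cast; linear_combination (σ * θ : ℂ) * I_sq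
      · rfl
    · intro h
      have e : (k : ℤ) ∣ (h + k) * (-σ * κ) - 1 ↔ (k : ℤ) ∣ h * (-σ * κ) - 1 := by
        rw [show (h + k) * (-σ * κ) - 1 = (h * (-σ * κ) - 1) + k * (-σ * κ) by ring]
        exact (dvd_add_left (dvd_mul_right _ _))
      simp only [e]
      congr 2
      funext θ
      rw [← D.hG1 (h / k + I * wf σ y θ)]
      congr 1; push_cast; field_simp; ring
    · refine sum_congr rfl fun h _ => ?_
      split_ifs
      · simp
      · simp
  · intro h _
    refine Continuous.intervalIntegrable ?_ _ _
    split_ifs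
    · have := D.G_cont (σ := σ) hy (h / k)
      push_cast at this; exact this
    · exact continuous_const

lemma arc_bd : ∃ K : ℝ, 0 ≤ K ∧ ∀ (σ : ℤ), (σ = 1 ∨ σ = -1) → ∀ N k : ℕ, 0 < k → k ≤ N → 
    ∀ y : ℝ, y = 1 / (N : ℝ) ^ 2 →
    ‖D.M * ∑ i ∈ range k, arcI (fun x => D.G (x + I * y)) σ k (N - k + 1 + i) -
      ∑ μ ∈ D.U, (∑ i ∈ range k, D.cs σ N k (D.pU k μ) μ i) *
        ∫ θ in (0 : ℝ)..(1 / (k * (N + k + 1))), D.E k μ (wf σ y θ)‖ ≤ K * ((k : ℝ) ^ ((47 : ℝ) / 48) / (k * N)) := by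
  obtain ⟨B, hB, H⟩ := D.cs_bd
  have hMr : (0 : ℝ) < D.M := by exact_mod_cast D.hM
  have hC0 : ∀ ν, 0 ≤ D.C ν := fun ν => (norm_nonneg _).trans (D.hC ν 0 0 0 0)
  have hW0 : 0 ≤ D.W := (norm_nonneg _).trans (D.hW 0 0 0 0)
  have hS := (D.hsum (1 / 2) (by norm_num)).hasSum
  set S := ∑' ν : ℕ, D.C ν * Real.exp (-2 * π * (ν * (1 / 2) / D.M)) with hSd
  have hS0 : 0 ≤ S := tsum_nonneg fun ν => mul_nonneg (hC0 ν) (Real.exp_nonneg _)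
  set a : ℝ := 2 * π * (D.A / D.M) with ha
  have ha0 : 0 ≤ a := by positivity
  refine ⟨B * Real.exp a * S + ∑ μ ∈ D.U, B * D.W * Real.exp (a + 2 * π * (μ / D.M) * 9), by positivity,
    fun σ hσ N k hk hkN y hy => ?_⟩
  have hk1 : (1 : ℝ) ≤ k := by exact_mod_cast hk
  have hkN' : (k : ℝ) ≤ N := by exact_mod_cast hkN
  have hN1 : (1 : ℝ) ≤ N := hk1.trans hkN'
  have hy0 : 0 < y := by rw [hy]; positivity
  have hy1 : y ≤ 1 := by rw [hy, div_le_one (by positivity)]; exact one_le_pow₀ hN1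
  set X := (k : ℝ) ^ ((47 : ℝ) / 48) with hX
  have hX0 : 0 ≤ X := by positivity
  set β : ℕ → ℝ := fun i => 1 / (k * (N + 1 + i)) with hβ
  have hβa : Antitone β := fun i j hij => by
    have : (i : ℝ) ≤ j := by exact_mod_cast hij
    simp only [hβ]; gcongr
  have hβe : ∀ i, (1 / (k * (k + (N - k + 1 + i : ℕ))) : ℝ) = β i := by
    intro i; simp only [hβ]; push_cast [Nat.cast_sub hkN]; congr 2; ring
  set α : ℝ := 1 / (k * (N + k + 1)) with hα
  have hαβ : α ≤ β k := by simp only [hα, hβ]; rw [add_right_comm]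
  have hα0 : 0 ≤ α := by positivity
  have hβ0 : β 0 ≤ 1 / (k * N) := by simp only [hβ]; gcongr; simp
  have hcE : ∀ (z : ℂ) (μ : ℤ), Continuous fun θ => z * D.E k μ (wf σ y θ) :=
    fun z μ => continuous_const.mul (D.E_cont hy0 k μ)
  have hcS : ∀ i, Continuous fun θ => ∑ μ ∈ D.U, D.cs σ N k (D.pU k μ) μ i * D.E k μ (wf σ y θ) :=
    fun i => continuous_finsetSum _ fun μ _ => hcE _ μ
  set f : ℕ → ℝ → ℂ := fun i θ => D.Z σ N k i (wf σ y θ) -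
    ∑ μ ∈ D.U, D.cs σ N k (D.pU k μ) μ i * D.E k μ (wf σ y θ) with hf
  have hfc : ∀ i, Continuous (f i) := fun i => (D.Z_cont hy0 N k i).sub (hcS i)
  have h1 : ‖∑ i ∈ range k, ∫ θ in (0 : ℝ)..β i, f i θ‖ ≤ (B * X * Real.exp a * S) * (β 0 - 0) := by
    refine abel_int hfc hβa (hα0.trans hαβ) fun θ hθ n hn => ?_
    have hs := hasSum_sum (s := range n) fun i _ => D.hexpZ (σ := σ) (N := N) (i := i) hk (w := wf σ y θ) (by rwa [wf_re])
    simp only [← sum_mul] at hs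
    refine hs.norm_le_of_bounded (hS.mul_left (B * X * Real.exp a)) fun ν => ?_
    have q1 := H σ hσ N k hk (fun h b d => D.c ν h b k d) (D.C ν) (fun _ _ _ => D.hC _ _ _ _ _)
      (fun x b z => by rw [D.hc ν x b k z, D.hc ν (x % D.M) (b % D.M) k (z % D.M)]; simp only [Int.emod_emod]) (-ν) n hn
    have q2 : ‖D.E k (-ν) (wf σ y θ)‖ ≤ Real.exp a * Real.exp (-2 * π * (ν * (1 / 2) / D.M)) := by
      rw [E_norm, ← Real.exp_add, wf_re, wf_sq hσ]
      refine Real.exp_le_exp.mpr (add_le_add (mul_le_of_le_one_right ha0 hy1) ?_)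
      have g1 := wgeo1 hN1 hk1 hkN' hy hθ.1 (by simpa [hβ] using hθ.2)
      have e : 2 * π * (((-(ν : ℤ) : ℤ) : ℝ) / (D.M * k ^ 2)) * (y / (y ^ 2 + θ ^ 2)) =
        -(2 * π * (ν / D.M)) * (y / (k ^ 2 * (y ^ 2 + θ ^ 2))) := by push_cast; field_simp
      rw [e]
      have := mul_le_mul_of_nonneg_left g1 (by positivity : 0 ≤ 2 * π * (ν / D.M))
      have e2 : -2 * π * (ν * (1 / 2) / D.M) = -(2 * π * (ν / D.M) * (1 / 2)) := by ring
      rw [e2]; linarith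
    rw [norm_mul]
    refine (mul_le_mul q1 q2 (norm_nonneg _) (by have := hC0 ν; positivity)).trans (le_of_eq ?_)
    rw [hX]; ring
  have h2 : ∀ μ ∈ D.U, ‖∑ i ∈ range k, ∫ θ in α..β i, D.cs σ N k (D.pU k μ) μ i * D.E k μ (wf σ y θ)‖ ≤
      (B * D.W * X * Real.exp (a + 2 * π * (μ / D.M) * 9)) * (β 0 - α) := by
    intro μ hμ
    have hμ0 : (0 : ℝ) < μ := by exact_mod_cast D.hU μ hμ
    refine abel_int (fun i => hcE (D.cs σ N k (D.pU k μ) μ i) μ) hβa hαβ fun θ hθ n hn => ?_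
    rw [← sum_mul, norm_mul]
    have q1 := H σ hσ N k hk (D.pU k μ) D.W (fun x b z => by rw [pU]; split_ifs; exacts [D.hW _ _ _ _, by simpa using hW0])
      (fun x b z => by
        rw [pU, pU, D.hmu x k, D.hmu (x % D.M) k, D.hp x b k z, D.hp (x % D.M) (b % D.M) k (z % D.M)]; simp only [Int.emod_emod]) μ n hn
    refine mul_le_mul q1 ?_ (norm_nonneg _) (by positivity)
    rw [E_norm, wf_re, wf_sq hσ]
    refine Real.exp_le_exp.mpr (add_le_add (mul_le_of_le_one_right ha0 hy1) ?_)
    have g1 := wgeo2 hN1 hk1 hkN' hy hθ.1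
    have e : 2 * π * ((μ : ℝ) / (D.M * k ^ 2)) * (y / (y ^ 2 + θ ^ 2)) =
        (2 * π * (μ / D.M)) * (y / (k ^ 2 * (y ^ 2 + θ ^ 2))) := by field_simp
    rw [e]
    exact mul_le_mul_of_nonneg_left g1 (by positivity)
  have e : D.M * ∑ i ∈ range k, arcI (fun x => D.G (x + I * y)) σ k (N - k + 1 + i) -
      ∑ μ ∈ D.U, (∑ i ∈ range k, D.cs σ N k (D.pU k μ) μ i) * ∫ θ in (0 : ℝ)..α, D.E k μ (wf σ y θ) =
      ∑ i ∈ range k, (∫ θ in (0 : ℝ)..β i, f i θ) +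
      ∑ μ ∈ D.U, ∑ i ∈ range k, ∫ θ in α..β i, D.cs σ N k (D.pU k μ) μ i * D.E k μ (wf σ y θ) := by
    rw [mul_sum, sum_comm (s := D.U), sub_eq_iff_eq_add, ← sum_add_distrib]
    simp only [sum_mul]
    rw [sum_comm (s := D.U), ← sum_add_distrib]
    refine sum_congr rfl fun i _ => ?_
    rw [D.arc_Z hy0 N hk i, hβe, hf]
    simp only
    rw [intervalIntegral.integral_sub ((D.Z_cont hy0 N k i).intervalIntegrable _ _)
      ((hcS i).intervalIntegrable _ _),
      intervalIntegral.integral_finsetSum fun μ _ =>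
        (hcE _ μ).intervalIntegrable _ _, add_assoc, ← sum_add_distrib]
    rw [eq_comm, sub_add_eq_add_sub, sub_eq_iff_eq_add]
    congr 1
    refine sum_congr rfl fun μ _ => ?_
    simp only [intervalIntegral.integral_const_mul]
    rw [← mul_add, add_comm, intervalIntegral.integral_add_adjacent_intervals
      ((D.E_cont hy0 k μ).intervalIntegrable _ _) ((D.E_cont hy0 k μ).intervalIntegrable _ _)]
  rw [e]
  refine (norm_add_le _ _).trans ((add_le_add h1 ((norm_sum_le _ _).trans (sum_le_sum h2))).trans ?_)
  rw [← sum_mul, add_mul, sub_zero]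
  have e3 : ∑ μ ∈ D.U, B * D.W * X * Real.exp (a + 2 * π * (μ / D.M) * 9) =
    (∑ μ ∈ D.U, B * D.W * Real.exp (a + 2 * π * (μ / D.M) * 9)) * X := by
    rw [sum_mul]; exact sum_congr rfl fun _ _ => by ring
  rw [e3, div_eq_mul_one_div X]
  refine add_le_add (le_of_le_of_eq (mul_le_mul_of_nonneg_left hβ0 (by positivity)) (by ring)) ?_
  refine le_of_le_of_eq (mul_le_mul_of_nonneg_left ((sub_le_self _ hα0).trans hβ0) (by positivity)) (by ring)

end CD

lemma count1 {k : ℕ} (hk : 0 < k) (h c : ℤ) {s : ℤ} (hs : s = 1 ∨ s = -1) (z : ℂ) :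
    ∑ i ∈ range k, (if (k : ℤ) ∣ h * (s * (c + i)) - 1 then z else 0) = if Int.gcd h k = 1 then z else 0 := by
  have hs2 : s * s = 1 := by rcases hs with rfl | rfl <;> rfl
  have hk' : (0 : ℤ) < k := by exact_mod_cast hk
  split_ifs with hg
  · obtain ⟨u, v, huv⟩ := Int.isCoprime_iff_gcd_eq_one.mpr hg
    have e0 := Int.emod_nonneg (s * u - c) hk'.ne'
    have e1 := Int.emod_lt_of_pos (s * u - c) hk'
    have e2 := Int.emod_add_mul_ediv (s * u - c) k
    have h0 : (k : ℤ) ∣ h * (s * (c + ((s * u - c) % k).toNat)) - 1 := by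
      rw [Int.toNat_of_nonneg e0]
      refine ⟨-v - h * s * ((s * u - c) / k), ?_⟩
      linear_combination (h * s) * e2 + huv + h * u * hs2
    rw [sum_eq_single ((s * u - c) % k).toNat, if_pos h0]
    · intro i hi hne
      rw [if_neg]
      intro h1
      have h2 := (dvd_sub h1 h0).mul_left (u * s)
      have h5 : ((s * u - c) % k).toNat < k := by omega
      generalize (((s * u - c) % k).toNat) = i0 at *
      have h3 : (k : ℤ) ∣ i - i0 := by
        have : (i : ℤ) - i0 = u * s * (h * (s * (c + i)) - 1 - (h * (s * (c + i0)) - 1)) + k * (v * (i - i0)) := by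
          linear_combination (-(i - i0) * u * h : ℤ) * hs2 - (i - i0 : ℤ) * huv
        rw [this]; exact dvd_add h2 (dvd_mul_right _ _)
      have h4 := mem_range.mp hi
      have h6 := Int.eq_zero_of_abs_lt_dvd h3 (abs_lt.mpr ⟨by omega, by omega⟩)
      omega
    · intro hn; exact absurd (mem_range.mpr (by omega)) hn
  · refine sum_eq_zero fun i _ => if_neg fun h1 => hg ?_
    obtain ⟨q, hq⟩ := h1
    exact Int.isCoprime_iff_gcd_eq_one.mp ⟨s * (c + i), -q, by linear_combination hq⟩

lemma sum_range_periodicN (k M : ℕ) (f : ℕ → ℂ) (hf : ∀ x, f (x + k) = f x) :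
    ∑ x ∈ range (M * k), f x = M * ∑ x ∈ range k, f x := by
  induction M with
  | zero => simp
  | succ M ih =>
    rw [Nat.succ_mul, sum_range_add, ih]
    have : ∀ (j x : ℕ), f (j * k + x) = f x := by
      intro j
      induction j with
      | zero => simp
      | succ j ih => intro x; rw [← ih x, ← hf (j * k + x)]; congr 1; ring
    simp only [this]; push_cast; ring

namespace CD
variable (D : CD)

def vh (k h : ℕ) : ℂ := if Nat.gcd h k = 1 then D.v h k * ec (-(D.A * h : ℂ) / (D.M * k)) else 0

lemma vh_per {k : ℕ} (hk : 0 < k) (h : ℕ) : D.vh k (h + k) = D.vh k h := by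
  unfold vh
  simp only [Nat.gcd_add_self_left]
  split_ifs with hg
  · exact D.hv1 h k hk hg
  · rfl

lemma p_vh {k : ℕ} (hk : 0 < k) (h : ℕ) {d : ℤ} (hd : (k : ℤ) ∣ h * d - 1) :
    D.p h ((h * d - 1) / k) k d * ec (((-D.A * h + D.mu h k * d : ℤ) : ℂ) / ((D.M * k : ℕ) : ℂ)) = D.vh k h := by
  obtain ⟨b, hb⟩ := hd
  have hbk : (h * d - 1) / (k : ℤ) = b := by rw [hb]; exact Int.mul_ediv_cancel_left _ (by omega)
  have hg : Nat.gcd h k = 1 := Nat.isCoprime_iff_coprime.mp ⟨d, -b, by linear_combination hb⟩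
  rw [hbk, D.hv h k b d hk (by linear_combination hb), vh, if_pos hg, mul_assoc, ← ec_add]
  have hk' : (k : ℂ) ≠ 0 := by exact_mod_cast hk.ne'
  have hM' : (D.M : ℂ) ≠ 0 := by exact_mod_cast D.hM.ne'
  congr 2
  push_cast; field_simp; ring

def V (k : ℕ) (μ : ℤ) : ℂ := ∑ h ∈ range k, if D.mu h k = μ then D.vh k h else 0

lemma cs_V {σ : ℤ} (hσ : σ = 1 ∨ σ = -1) (N : ℕ) {k : ℕ} (hk : 0 < k) (μ : ℤ) :
    ∑ i ∈ range k, D.cs σ N k (D.pU k μ) μ i = D.M * D.V k μ := by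
  rw [V, ← sum_range_periodicN k D.M (fun h => if D.mu h k = μ then D.vh k h else 0)
    (fun h => by rw [D.vh_per hk, D.hmu1])]
  unfold cs
  rw [sum_comm]
  refine sum_congr rfl fun h _ => ?_
  have := count1 hk h (N - k + 1 : ℕ) (s := -σ) (by rcases hσ with rfl | rfl <;> simp)
    (if D.mu h k = μ then D.vh k h else 0)
  refine Eq.trans (sum_congr rfl fun i _ => ?_) (this.trans ?_)
  · have e : ((N - k + 1 + i : ℕ) : ℤ) = (N - k + 1 : ℕ) + i := by push_cast; ring
    rw [e]
    by_cases hd : (k : ℤ) ∣ h * (-σ * ((N - k + 1 : ℕ) + i)) - 1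
    · rw [if_pos hd, if_pos hd]
      by_cases hm : D.mu h k = μ
      · rw [if_pos hm, ← D.p_vh hk h hd, hm, Gf, pU, if_pos hm]
      · simp [Gf, pU, hm]
    · rw [if_neg hd, if_neg hd]
  · rw [Int.gcd_natCast_natCast]
    by_cases hg : Nat.gcd h k = 1 <;> simp [hg, vh]

lemma V_cl (μ : ℤ) (hμ : μ ≠ 0) : ∃ B : ℝ, ∀ k : ℕ, 0 < k → ∀ P : ℤ → Prop, (∀ h, P h ↔ P (h % D.M)) →
    (∀ h, P h → D.mu h k = μ) → ∀ [DecidablePred P],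
    ‖∑ h ∈ range k, if P h then D.vh k h else 0‖ ≤ B * (k : ℝ) ^ ((47 : ℝ) / 48) := by
  obtain ⟨B, hB, H⟩ := KLf D.M D.hM μ hμ
  have hW0 : 0 ≤ D.W := (norm_nonneg _).trans (D.hW 0 0 0 0)
  refine ⟨B * D.W, fun k hk P hP hPm _ => ?_⟩
  have := H k hk (-D.A) 0 k (Nat.le_mul_of_pos_left _ D.hM) D.W (fun x b y => if P y then D.p y b k x else 0)
    (fun x b y => by split_ifs; exacts [D.hW _ _ _ _, by simpa using hW0])
    (fun x b y => by
      simp only [← hP]; rw [D.hp y b k x, D.hp (y % D.M) (b % D.M) k (x % D.M)]; simp only [Int.emod_emod])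
  have e : ∑ i ∈ range k, ∑ x ∈ range (D.M * k), (if (k : ℤ) ∣ (x : ℤ) * (0 + i) - 1 then
      Gf D.M k μ (-D.A) (fun x b y => if P y then D.p y b k x else 0) x (0 + i) else 0) =
      D.M * ∑ h ∈ range k, if P h then D.vh k h else 0 := by
    rw [mul_sum]
    refine sum_congr rfl fun h _ => ?_
    have c := count1 hk h 0 (s := 1) (Or.inl rfl) (if P h then D.vh k h else 0)
    have c2 : (if Int.gcd h k = 1 then (if P h then D.vh k h else 0) else 0) = if P h then D.vh k h else 0 := by
      rw [Int.gcd_natCast_natCast]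
      by_cases hg : Nat.gcd h k = 1 <;> simp [hg, vh]
    rw [c2] at c
    rw [← c, ← sum_range_periodicN k D.M]
    · refine sum_congr rfl fun x _ => ?_
      rw [zero_add, zero_add, one_mul, mul_comm (x : ℤ)]
      by_cases hd : (k : ℤ) ∣ h * x - 1
      · rw [if_pos hd, if_pos hd, Gf]
        by_cases hm : P h
        · simp only [if_pos hm]
          rw [← D.p_vh hk h hd, hPm h hm, mul_comm (x : ℤ), add_comm (μ * _)]
        · simp [hm]
      · rw [if_neg hd, if_neg hd]
    · intro x
      refine if_congr ?_ rfl rfl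
      rw [show (h : ℤ) * (1 * (0 + (x + k : ℕ))) - 1 = (h * (1 * (0 + x)) - 1) + k * h by push_cast; ring]
      exact dvd_add_left (dvd_mul_right _ _)
  rw [e, norm_mul, Complex.norm_natCast] at this
  refine le_trans ?_ this
  exact le_mul_of_one_le_left (norm_nonneg _) (by exact_mod_cast D.hM)

def aa : ℝ := 2 * π * (D.A / D.M)
def bb (k : ℕ) (x : ℤ) : ℝ := 2 * π * (x / (D.M * k ^ 2))

lemma core2 {y α : ℝ} (hy : 0 < y) (k : ℕ) (x : ℤ) :
    (∫ θ in (0 : ℝ)..α, D.E k x (wf 1 y θ)) + ∫ θ in (0 : ℝ)..α, D.E k x (wf (-1) y θ) =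
      ∫ θ in (-α)..α, exp (D.aa * (y + θ * I) + D.bb k x / (y + θ * I)) := by
  have e : ∀ θ : ℝ, exp (D.aa * (y + θ * I) + D.bb k x / (y + θ * I)) = D.E k x (wf (-1) y θ) := by
    intro θ; rw [E, aa, bb, wf]; push_cast; simp
  simp only [e]
  have hc := fun u v => (D.E_cont (σ := -1) hy k x).intervalIntegrable (μ := MeasureTheory.volume) u v
  rw [← intervalIntegral.integral_add_adjacent_intervals (hc (-α) 0) (hc 0 α)]
  congr 1
  rw [← neg_zero, ← intervalIntegral.integral_comp_neg, neg_zero]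
  congr 1; funext θ; congr 1; simp [wf]

lemma main_bd {g : ℂ} (hg : ∀ y : ℝ, 0 < y → ∫ x in (0 : ℝ)..1, D.G (x + I * y) = g) : ∃ K : ℝ, ∀ N : ℕ, 0 < N →
    ‖D.M * g - D.M * ∑ k ∈ Icc 1 N, ∑ μ ∈ D.U, D.V k μ * (2 * π * resS D.aa (D.bb k μ))‖ ≤
      K * ∑ k ∈ Icc 1 N, (k : ℝ) ^ ((47 : ℝ) / 48) / (k * N) := by
  obtain ⟨K, hK, H⟩ := D.arc_bd
  obtain ⟨B, hB, HB⟩ := D.cs_bd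
  have hMr : (0 : ℝ) < D.M := by exact_mod_cast D.hM
  have hW0 : 0 ≤ D.W := (norm_nonneg _).trans (D.hW 0 0 0 0)
  have ha0 : 0 ≤ D.aa := by unfold aa; positivity
  refine ⟨K + K + ∑ μ ∈ D.U, B * D.W * (2 * π * (2 * Real.exp (D.aa * 2 + 2 * π * (μ / D.M) * 9))),
    fun N hN => ?_⟩
  have hN1 : (1 : ℝ) ≤ N := by exact_mod_cast hN
  obtain ⟨y, hy⟩ : ∃ y : ℝ, y = 1 / (N : ℝ) ^ 2 := ⟨_, rfl⟩
  have hy0 : 0 < y := by rw [hy]; positivity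
  have hy1 : y ≤ 1 := by rw [hy, div_le_one (by positivity)]; exact one_le_pow₀ hN1
  have hcont : Continuous fun x : ℝ => D.G (x + I * y) := continuous_iff_continuousAt.mpr fun x =>
    ContinuousAt.comp (f := fun x : ℝ => (x + I * y : ℂ)) (D.hG _ (by simp [hy0])) (by fun_prop)
  rw [← hg y hy0, farey hcont (fun x => by rw [← D.hG1 (x + I * y)]; congr 1; push_cast; ring) hN, mul_sum, mul_sum,
    ← sum_sub_distrib, mul_sum]
  refine (norm_sum_le _ _).trans (sum_le_sum fun k hk => ?_)
  rw [mem_Icc] at hk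
  have hk0 : 0 < k := hk.1
  have hk1 : (1 : ℝ) ≤ k := by exact_mod_cast hk0
  have hkN' : (k : ℝ) ≤ N := by exact_mod_cast hk.2
  set α : ℝ := 1 / (k * (N + k + 1)) with hα
  have h1 := H 1 (Or.inl rfl) N k hk0 hk.2 y hy
  have h2 := H (-1) (Or.inr rfl) N k hk0 hk.2 y hy
  simp only [D.cs_V (Or.inl rfl) N hk0] at h1
  simp only [D.cs_V (Or.inr rfl) N hk0] at h2
  set X := (k : ℝ) ^ ((47 : ℝ) / 48) with hX
  have hX0 : 0 ≤ X := by positivity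
  have h3 : ∀ μ ∈ D.U, ‖D.M * D.V k μ * ((∫ θ in (-α)..α, exp (D.aa * (y + θ * I) + D.bb k μ / (y + θ * I))) -
      2 * π * resS D.aa (D.bb k μ))‖ ≤
      B * D.W * (2 * π * (2 * Real.exp (D.aa * 2 + 2 * π * (μ / D.M) * 9))) * (X / (k * N)) := by
    intro μ hμ
    have hμ0 : (0 : ℝ) < μ := by exact_mod_cast D.hU μ hμ
    have q1 := HB 1 (Or.inl rfl) N k hk0 (D.pU k μ) D.W (fun x b z => by rw [pU]; split_ifs; exacts [D.hW _ _ _ _, by simpa using hW0])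
      (fun x b z => by
        rw [pU, pU, D.hmu x k, D.hmu (x % D.M) k, D.hp x b k z, D.hp (x % D.M) (b % D.M) k (z % D.M)]; simp only [Int.emod_emod]) μ k le_rfl
    rw [D.cs_V (Or.inl rfl) N hk0] at q1
    have hb0 : 0 ≤ D.bb k μ := by unfold bb; positivity
    have q2 := core_int ha0 hb0 hy0 (show 0 < α by positivity)
    have a1 : y + α ≤ 2 * (1 / (k * N)) := by
      have : y ≤ 1 / (k * N) := by rw [hy, sq]; gcongr
      have : α ≤ 1 / (k * N) := by rw [hα]; gcongr; linarith
      linarith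
    have a2 : y + α ≤ 2 := a1.trans (by
      have : 1 / ((k : ℝ) * N) ≤ 1 := by rw [div_le_one (by positivity)]; nlinarith
      linarith)
    have a3 : D.bb k μ * (y / α ^ 2) ≤ 2 * π * (μ / D.M) * 9 := by
      have e : D.bb k μ * (y / α ^ 2) = 2 * π * (μ / D.M) * ((N + k + 1) / N) ^ 2 := by
        rw [bb, hα, hy]; field_simp
      rw [e]
      refine mul_le_mul_of_nonneg_left ?_ (by positivity)
      have : ((N + k + 1) / N : ℝ) ≤ 3 := by rw [div_le_iff₀ (by positivity)]; linarith
      have h0 : 0 ≤ ((N + k + 1) / N : ℝ) := by positivity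
      nlinarith
    rw [norm_mul]
    refine (mul_le_mul q1 q2 (norm_nonneg _) (by positivity)).trans ?_
    have q3 : 2 * π * ((y + α) * Real.exp (D.aa * (y + α) + D.bb k μ * (y / α ^ 2))) ≤
      2 * π * (2 * (1 / (k * N)) * Real.exp (D.aa * 2 + 2 * π * (μ / D.M) * 9)) := by gcongr
    refine le_of_le_of_eq (mul_le_mul_of_nonneg_left q3 (by positivity)) ?_
    ring
  have e : D.M * ∑ i ∈ range k, (arcI (fun x => D.G (x + I * y)) 1 k (N - k + 1 + i) +
        arcI (fun x => D.G (x + I * y)) (-1) k (N - k + 1 + i)) -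
      D.M * ∑ μ ∈ D.U, D.V k μ * (2 * π * resS D.aa (D.bb k μ)) =
      (D.M * ∑ i ∈ range k, arcI (fun x => D.G (x + I * y)) 1 k (N - k + 1 + i) -
        ∑ μ ∈ D.U, D.M * D.V k μ * ∫ θ in (0 : ℝ)..α, D.E k μ (wf 1 y θ)) +
      (D.M * ∑ i ∈ range k, arcI (fun x => D.G (x + I * y)) (-1) k (N - k + 1 + i) -
        ∑ μ ∈ D.U, D.M * D.V k μ * ∫ θ in (0 : ℝ)..α, D.E k μ (wf (-1) y θ)) +
      ∑ μ ∈ D.U, D.M * D.V k μ * ((∫ θ in (-α)..α, exp (D.aa * (y + θ * I) + D.bb k μ / (y + θ * I))) -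
        2 * π * resS D.aa (D.bb k μ)) := by
    simp only [← D.core2 hy0]
    simp only [mul_sub, mul_add, sum_add_distrib, sum_sub_distrib, mul_sum, mul_assoc]
    ring
  rw [e]
  refine (norm_add_le _ _).trans ((add_le_add ((norm_add_le _ _).trans (add_le_add h1 h2))
    ((norm_sum_le _ _).trans (sum_le_sum h3))).trans (le_of_eq ?_))
  rw [← sum_mul]; ring

lemma sum_Icc_range {E : Type*} [AddCommMonoid E] (f : ℕ → E) (N : ℕ) : ∑ k ∈ Icc 1 N, f k = ∑ i ∈ range N, f (i + 1) := by
  induction N with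
  | zero => simp
  | succ n ih => rw [sum_Icc_succ_top (by omega), sum_range_succ, ih]

lemma main_tendsto {g : ℂ} (hg : ∀ y : ℝ, 0 < y → ∫ x in (0 : ℝ)..1, D.G (x + I * y) = g) :
    Filter.Tendsto (fun N : ℕ => ∑ k ∈ Icc 1 N, ∑ h ∈ range k,
      if D.mu h k ∈ D.U then D.vh k h * (2 * π * resS D.aa (D.bb k (D.mu h k))) else 0) Filter.atTop (nhds g) := by
  obtain ⟨K, H⟩ := D.main_bd hg
  have hM' : (D.M : ℂ) ≠ 0 := by exact_mod_cast D.hM.ne'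
  have hu : Filter.Tendsto (fun i : ℕ => ((i + 1 : ℕ) : ℝ) ^ (-(1 / 48 : ℝ))) Filter.atTop (nhds 0) :=
    ((tendsto_rpow_neg_atTop (by norm_num : (0 : ℝ) < 1 / 48)).comp tendsto_natCast_atTop_atTop).comp
      (Filter.tendsto_add_atTop_nat 1)
  have h0 := hu.cesaro.const_mul K
  rw [mul_zero] at h0
  have h1 : Filter.Tendsto (fun N : ℕ => D.M * g - D.M * ∑ k ∈ Icc 1 N, ∑ μ ∈ D.U, D.V k μ * (2 * π * resS D.aa (D.bb k μ)))
      Filter.atTop (nhds 0) := by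
    refine squeeze_zero_norm' ?_ h0
    filter_upwards [Filter.eventually_gt_atTop 0] with N hN
    refine (H N hN).trans (le_of_eq ?_)
    rw [sum_Icc_range (E := ℝ)]
    congr 1
    rw [mul_sum (s := range N)]
    refine sum_congr rfl fun i _ => ?_
    have hi : (0 : ℝ) < (i + 1 : ℕ) := by exact_mod_cast i.succ_pos
    rw [← div_div, show -(1 / 48 : ℝ) = 47 / 48 - 1 by norm_num, Real.rpow_sub_one hi.ne', div_eq_inv_mul _ (N : ℝ)]
  have h2 := (tendsto_const_nhds (x := g)).sub (h1.const_mul ((D.M : ℂ)⁻¹))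
  rw [mul_zero, sub_zero] at h2
  refine h2.congr fun N => ?_
  rw [mul_sub, inv_mul_cancel_left₀ hM', inv_mul_cancel_left₀ hM', sub_sub_cancel]
  refine sum_congr rfl fun k _ => ?_
  simp only [V, sum_mul]
  rw [sum_comm]
  refine sum_congr rfl fun h _ => ?_
  simp only [ite_mul, zero_mul]
  rw [sum_ite_eq]

end CD

lemma Om_int {J : ℕ} {m : Fin J → ℕ} (r : Fin J → ℕ) (δ : Fin J → ℤ) (hm : ∀ j, 0 < m j) {M : ℕ}
    (hM : ∀ j, 24 * (m j) ^ 2 ∣ M) : ∃ z : ℤ, (M : ℝ) * (OmegaC J m r δ / 24) = z := by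
  choose x hx using hM
  refine ⟨∑ j, δ j * (x j * m j * (2 * m j ^ 2 - 12 * r j * m j + 12 * r j ^ 2)), ?_⟩
  push_cast
  rw [OmegaC, sum_div, mul_sum]
  refine sum_congr rfl fun j _ => ?_
  have hm' : (m j : ℝ) ≠ 0 := by exact_mod_cast (hm j).ne'
  rw [hx j]; push_cast; field_simp

def GG (J : ℕ) (m r : Fin J → ℕ) (δ : Fin J → ℤ) (n : ℕ) (τ : ℂ) : ℂ :=
  (∏ j, (∏' k : ℕ, (1 - ec τ ^ (r j + m j * k)) * (1 - ec τ ^ (m j * (k + 1) - r j))) ^ (δ j)) * ec (-(n * τ))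

lemma GG_one (J : ℕ) (m r : Fin J → ℕ) (δ : Fin J → ℤ) (n : ℕ) (τ : ℂ) :
    GG J m r δ n (τ + 1) = GG J m r δ n τ := by
  rw [GG, GG, ec_add, ec_one, mul_one]
  congr 1
  exact ec_eq_of_sub_int (-n) (by push_cast; ring)

lemma FF_GG {J : ℕ} {m r : Fin J → ℕ} {δ : Fin J → ℤ} (hm : ∀ j, 0 < m j)
    (hrm : ∀ j, r j < m j) (n : ℕ) (τ : ℂ) :
    GG J m r δ n τ * ec (((n + OmegaC J m r δ / 24 : ℝ) : ℂ) * τ) = FF J m r δ τ := by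
  rw [FF_eq hm hrm, GG, mul_assoc, ← ec_add, mul_comm]
  congr 2; push_cast; ring

lemma int_ec (z : ℤ) : ∫ x in (0:ℝ)..1, ec (z * x) = if z = 0 then 1 else 0 := by
  split_ifs with h
  · simp [h, ec_zero]
  · have hz : (2 * π * I * z : ℂ) ≠ 0 := by
      simp [Real.pi_ne_zero, h]
    have := integral_exp_mul_complex (a := 0) (b := 1) hz
    simp only [ec, ← mul_assoc]
    rw [this]
    have h1 := ec_int z
    rw [ec] at h1
    simp [h1]

lemma GG_int {J : ℕ} {m r : Fin J → ℕ} {δ : Fin J → ℤ} {g : ℕ → ℂ}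
    (hg : ∀ q : ℂ, ‖q‖ < 1 → HasSum (fun n : ℕ => g n * q ^ n)
      (∏ j, (∏' k : ℕ, (1 - q ^ (r j + m j * k)) * (1 - q ^ (m j * (k + 1) - r j))) ^ (δ j)))
    (n : ℕ) {y : ℝ} (hy : 0 < y) : ∫ x in (0:ℝ)..1, GG J m r δ n (x + I * y) = g n := by
  have hlt : ∀ x : ℝ, ‖ec (x + I * y)‖ < 1 := fun x => norm_ec_lt (by simpa using hy)
  have key : ∀ (i : ℕ) (x : ℝ), g i * ec (x + I * y) ^ i * ec (-(n * (x + I * y))) =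
      g i * ec ((i - n) * (I * y)) * ec (((i - n : ℤ) : ℂ) * x) := fun i x => by
    rw [← ec_nat_mul, mul_assoc, mul_assoc, ← ec_add, ← ec_add]; congr 2; push_cast; ring
  have h := intervalIntegral.hasSum_integral_of_dominated_convergence (μ := MeasureTheory.volume) (a := 0) (b := 1)
    (F := fun (i : ℕ) (x : ℝ) => g i * ec ((i - n) * (I * y)) * ec (((i - n : ℤ) : ℂ) * x))
    (f := fun x : ℝ => GG J m r δ n (x + I * y)) (fun i _ => ‖g i * ec ((i - n) * (I * y))‖)
    (fun i => (continuous_const.mul (continuous_ec.comp (by fun_prop))).aestronglyMeasurable)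
    (fun i => Filter.Eventually.of_forall fun x _ => by
      rw [norm_mul, ← ofReal_intCast, ← ofReal_mul, norm_ec_real, mul_one])
    (Filter.Eventually.of_forall fun x _ => by
      have := ((hg _ (hlt 0)).mul_right (ec (-(n * ((0:ℝ) + I * y))))).summable.norm
      simp only [key] at this
      simpa [ec_zero] using this)
    (by simp)
    (Filter.Eventually.of_forall fun x _ => by
      have := (hg _ (hlt x)).mul_right (ec (-(n * (x + I * y))))
      simp only [key] at this
      exact this)
  simp only [intervalIntegral.integral_const_mul, int_ec, mul_ite, mul_one, mul_zero, sub_eq_zero] at h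
  refine h.unique ?_
  have h2 := hasSum_ite_eq n (g n)
  refine (congrArg (HasSum · _) (funext fun i => ?_)).mpr h2
  by_cases hi : i = n
  · simp [hi, ec_zero]
  · simp [hi]

lemma uniq_bd {M : ℕ} {c : ℕ → ℂ} {C : ℕ → ℝ} (hC : ∀ ν, ‖c ν‖ ≤ C ν)
    (hs : Summable fun ν : ℕ => C ν * Real.exp (-2 * π * (ν * 1 / M))) {S : ℂ → ℂ}
    (h : ∀ t : ℂ, 0 < t.im → HasSum (fun ν : ℕ => c ν * ec (ν * t / M)) (S t)) :
    S =O[imInf] fun _ => (1 : ℝ) := by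
  refine Asymptotics.IsBigO.of_bound (∑' ν : ℕ, C ν * Real.exp (-2 * π * (ν * 1 / M))) ?_
  filter_upwards [tendsto_im.eventually_ge_atTop 1] with t ht
  have h1 := h t (by linarith)
  rw [← h1.tsum_eq, norm_one, mul_one]
  refine tsum_of_norm_bounded hs.hasSum fun ν => ?_
  have h3 : ((ν * t / M : ℂ)).im = ν * t.im / M := by
    rw [← ofReal_natCast, ← ofReal_natCast, Complex.div_ofReal_im, Complex.im_ofReal_mul]
  have h4 : (ν * 1 / M : ℝ) ≤ ν * t.im / M := by gcongr
  rw [norm_mul, norm_ec, h3]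
  exact mul_le_mul (hC ν) (Real.exp_le_exp.mpr (by nlinarith [Real.pi_pos])) (Real.exp_nonneg _)
    ((norm_nonneg _).trans (hC ν))

lemma emod_mem {M : ℕ} (hM : 0 < M) (x : ℤ) : x % M ∈ Ico (0:ℤ) M :=
  mem_Ico.mpr ⟨Int.emod_nonneg _ (by omega), Int.emod_lt_of_pos _ (by omega)⟩

def vv (J : ℕ) (m r : Fin J → ℕ) (δ : Fin J → ℤ) (ℏ : Fin J → ℕ → ℕ → ℤ) (h k : ℕ) : ℂ :=
  if 0 < DeltaC J m r δ h k then ec ((OmegaC J m r δ : ℝ) * h / (24 * k)) * I ^ (∑ j, δ j) *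
      ((-1 : ℂ) ^ (∑ j, δ j * lamF (m j) (r j) h k) *
        (omegaC J m δ h k) ^ 2 * DC J m r δ (fun j => ℏ j h k) h k * PiC J m r δ (fun j => ℏ j h k) h k) else 0

lemma exists_CD {J : ℕ} {m r : Fin J → ℕ} {δ : Fin J → ℤ}
    (hm : ∀ j, 0 < m j) (hr : ∀ j, 1 ≤ r j) (hrm : ∀ j, r j < m j)
    {ℏ : Fin J → ℕ → ℕ → ℤ}
    (hℏ : ∀ j h k, 0 < k → Nat.gcd h k = 1 →
      ℏ j h k * (((m j / Nat.gcd (m j) k) * h : ℕ) : ℤ) ≡ -1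
        [ZMOD ((k / Nat.gcd (m j) k : ℕ) : ℤ)])
    (hassump : ∀ ℓ ∈ Finset.Icc 1 (univ.lcm m), ∀ κ ∈ range ℓ, ∀ j,
      ((ups (lamStar (m j) (r j) κ ℓ) : ℚ) : ℝ) * (Nat.gcd (m j) ℓ : ℝ) ^ 2 / (m j : ℝ)
        ≥ DeltaC J m r δ κ ℓ / 24)
    {n : ℕ} (hn' : (n : ℝ) > -(OmegaC J m r δ) / 24) :
    ∃ D : CD, D.G = GG J m r δ n ∧ (D.A / D.M : ℝ) = n + OmegaC J m r δ / 24 ∧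
      (∀ h k : ℕ, (D.mu h k : ℝ) = D.M * (DeltaC J m r δ h k / 24)) ∧
      D.v = vv J m r δ ℏ ∧ (∀ h k : ℕ, D.mu h k ∈ D.U ↔ 0 < D.mu h k) ∧
      (∀ l ∈ Icc 1 (univ.lcm m), l ∣ D.M) := by
  obtain ⟨L, hL⟩ : ∃ L, L = univ.lcm m := ⟨_, rfl⟩
  have hL0 : 0 < L := hL ▸ lcm_pos' hm
  set M := 24 * L ^ 2 * L.factorial with hMd
  have hM0 : 0 < M := by have := L.factorial_pos; positivity
  have hmL : ∀ j, m j ∣ L := fun j => hL ▸ dvd_lcm (mem_univ j)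
  have hM : ∀ j, 24 * (m j) ^ 2 ∣ M := fun j =>
    (Nat.mul_dvd_mul_left 24 (pow_dvd_pow_of_dvd (hmL j) 2)).trans (Dvd.intro _ rfl)
  have hlM : ∀ l ∈ Icc 1 (univ.lcm m), l ∣ M := fun l hl => by
    rw [← hL, mem_Icc] at hl
    exact (Nat.dvd_factorial hl.1 hl.2).trans (Dvd.intro_left _ rfl)
  have hLM : univ.lcm m ∣ M := hlM _ (by rw [← hL, mem_Icc]; omega)
  obtain ⟨z, hz⟩ := Om_int r δ hm hM
  have hMR : (0 : ℝ) < M := by exact_mod_cast hM0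
  have hA1 : (M : ℝ) * (n + OmegaC J m r δ / 24) = ((M * n + z : ℤ) : ℝ) := by push_cast; rw [← hz]; ring
  have hA0 : 0 < (M * n + z : ℤ) := by
    have : (0:ℝ) < (M : ℝ) * (n + OmegaC J m r δ / 24) := mul_pos hMR (by linarith)
    rw [hA1] at this; exact_mod_cast this
  obtain ⟨A, hA⟩ := Int.eq_ofNat_of_zero_le hA0.le
  rw [hA] at hA1 hA0
  have hAM : (A / M : ℝ) = n + OmegaC J m r δ / 24 := by
    rw [div_eq_iff hMR.ne', mul_comm, hA1]; simp
  choose p0 c0 hs0 he0 hz0 hp0 using Iface0 hm hr hrm hassump hM0 hM hLM hlM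
  have hmuE : ∀ h k : ℤ, ∃ z : ℤ, (M : ℝ) * Dc J m r δ h k = z := fun h k => MD_int hm hM _ _
  have hDm : ∀ h k : ℤ, Dc J m r δ (h % M) (k % M) = Dc J m r δ h k := fun h k =>
    Dc_congr r δ hm hLM hlM ((Int.mod_modEq h M).symm.dvd) ((Int.mod_modEq k M).symm.dvd)
  let mu : ℤ → ℤ → ℤ := fun h k => ⌊(M : ℝ) * Dc J m r δ h k⌋
  have hmuR : ∀ h k, (mu h k : ℝ) = M * Dc J m r δ h k := fun h k => by
    obtain ⟨z, hz⟩ := hmuE h k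
    simp only [mu]; rw [hz, Int.floor_intCast]
  have hmup : ∀ h k, 0 < mu h k ↔ 0 < Dc J m r δ h k := fun h k => by
    rw [← @Int.cast_pos ℝ, hmuR, mul_pos_iff_of_pos_left hMR]
  have hmuM : ∀ h k, mu h k = mu (h % M) (k % M) := fun h k => by simp only [mu]; rw [hDm]
  let p : ℤ → ℤ → ℤ → ℤ → ℂ := fun h b k d => p0 (h % M) (b % M) (k % M) (d % M)
  let c : ℕ → ℤ → ℤ → ℤ → ℤ → ℂ := fun ν h b k d => c0 (h % M) (b % M) (k % M) (d % M) ν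
  let R := Ico (0:ℤ) M
  let U := ((R ×ˢ R).image fun x => mu x.1 x.2).filter (0 < ·)
  have hUm : ∀ h k, mu h k ∈ U ↔ 0 < mu h k := fun h k => by
    simp only [U, mem_filter, and_iff_right_iff_imp, mem_image]
    exact fun _ => ⟨(h % M, k % M), mem_product.mpr ⟨emod_mem hM0 _, emod_mem hM0 _⟩, (hmuM h k).symm⟩
  let R4 := R ×ˢ R ×ˢ R ×ˢ R
  have hR4 : ∀ h b k d : ℤ, (h % M, b % M, k % M, d % M) ∈ R4 := fun h b k d => by
    simp only [R4, mem_product]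
    exact ⟨emod_mem hM0 _, emod_mem hM0 _, emod_mem hM0 _, emod_mem hM0 _⟩
  let C : ℕ → ℝ := fun ν => ∑ x ∈ R4, ‖c0 x.1 x.2.1 x.2.2.1 x.2.2.2 ν‖
  have hC : ∀ ν h b k d, ‖c ν h b k d‖ ≤ C ν := fun ν h b k d =>
    single_le_sum (f := fun x : ℤ × ℤ × ℤ × ℤ => ‖c0 x.1 x.2.1 x.2.2.1 x.2.2.2 ν‖) (fun _ _ => norm_nonneg _) (hR4 h b k d)
  have hsum : ∀ y : ℝ, 0 < y → Summable fun ν : ℕ => C ν * Real.exp (-2 * π * (ν * y / M)) := fun y hy => by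
    simp only [C, sum_mul]
    exact summable_sum fun x _ => hs0 _ _ _ _ y hy
  have hpU : ∀ h b k d, ¬ 0 < mu h k → p h b k d = 0 := fun h b k d hh => by
    rw [hmup, ← hDm] at hh
    exact hz0 _ _ _ _ (not_lt.mp hh)
  have hok : ∀ h b k d : ℤ, 0 < k → h * d - b * k = 1 → okG M (h % M) (b % M) (k % M) (d % M) h b k d :=
    fun h b k d hk hd => ⟨hk, hd, (Int.mod_modEq _ _).dvd, (Int.mod_modEq _ _).dvd, (Int.mod_modEq _ _).dvd, (Int.mod_modEq _ _).dvd⟩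
  have hAMc : (A / M : ℂ) = ((n + OmegaC J m r δ / 24 : ℝ) : ℂ) := by rw [← hAM]; simp
  have hmuc : ∀ h k, (mu h k / M : ℂ) = (Dc J m r δ h k : ℂ) := fun h k => by
    rw [div_eq_iff (by exact_mod_cast hM0.ne'), mul_comm]; exact_mod_cast hmuR h k
  have hexp : ∀ h b k d : ℤ, 0 < k → h * d - b * k = 1 → ∀ t : ℂ, 0 < t.im →
    HasSum (fun ν : ℕ => c ν h b k d * ec (ν * t / M))
      (GG J m r δ n ((h * t + b) / (k * t + d)) * ec (A / M * ((h * t + b) / (k * t + d))) -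
        p h b k d * ec (-(mu h k / M : ℂ) * t)) := fun h b k d hk hd t ht => by
    rw [hAMc, FF_GG hm hrm, hmuc, ← hDm]
    exact he0 _ _ _ _ _ _ _ _ (hok h b k d hk hd) t ht
  have hgcd : ∀ {h k : ℕ} {b d : ℤ}, (h : ℤ) * d - b * k = 1 → Nat.gcd h k = 1 := fun {h k b d} hd =>
    Nat.isCoprime_iff_coprime.mp ⟨d, -b, by linear_combination hd⟩
  have hv : ∀ (h k : ℕ) (b d : ℤ), 0 < k → (h : ℤ) * d - b * k = 1 →
    p h b k d = vv J m r δ ℏ h k * ec (-((mu h k : ℂ) * d / (M * k))) := fun h k b d hk hd => by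
    by_cases h0 : 0 < mu h k
    · have h1 := h0
      rw [hmup] at h1
      have h2 := h1
      rw [Dc_eq r δ hm] at h2
      have h3 := hp0 _ _ _ _ h k b d (fun j => ℏ j h k) (hok h b k d (by exact_mod_cast hk) hd)
        (fun j => hℏ j h k hk (hgcd hd)) (by rw [hDm]; exact h1)
      have h4 : (-((mu h k : ℂ) * d / (M * k))) = -((DeltaC J m r δ h k / 24 : ℝ) : ℂ) * d / k := by
        rw [← Dc_eq r δ hm, ← hmuc, mul_div_mul_comm]; ring
      rw [vv, if_pos (by linarith), h4]
      simp only [p]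
      rw [h3, pG_eq]; ring
    · have h1 := h0
      rw [hmup, Dc_eq r δ hm] at h1
      rw [hpU _ _ _ _ h0, vv, if_neg (fun h => h1 (by positivity)), zero_mul]
  have hmu1 : ∀ h k : ℕ, mu (h + k : ℕ) k = mu h k := fun h k => by
    simp only [mu]
    rw [Dc_eq r δ hm, Dc_eq r δ hm, Delta_cl r δ hm (Nat.ModEq.refl k) (h + k), Nat.add_mod_right,
      ← Delta_cl r δ hm (Nat.ModEq.refl k) h]
  have hMc : (M : ℂ) ≠ 0 := by exact_mod_cast hM0.ne'
  have hv1 : ∀ h k : ℕ, 0 < k → Nat.gcd h k = 1 → vv J m r δ ℏ (h + k) k * ec (-(A * (h + k : ℕ) : ℂ) / (M * k)) =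
      vv J m r δ ℏ h k * ec (-(A * h : ℂ) / (M * k)) := fun h k hk hg => by
    have hki : (0 : ℤ) < k := by exact_mod_cast hk
    have hkc : (k : ℂ) ≠ 0 := by exact_mod_cast hk.ne'
    obtain ⟨d, b, hdb⟩ := Nat.isCoprime_iff_coprime.mpr hg
    have d1 : (h : ℤ) * d - (-b) * k = 1 := by linear_combination hdb
    have d2 : ((h + k : ℕ) : ℤ) * d - (-b + d) * k = 1 := by push_cast; linear_combination hdb
    have hpp : p (h + k : ℕ) (-b + d) k d = ec (A / M) * p h (-b) k d := by
      by_cases h0 : 0 < mu h k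
      · refine sub_eq_zero.mp (eq_zero_of_bdd ((hmup _ _).mp h0) ?_)
        have b1 := uniq_bd (fun ν => hC ν h (-b) k d) (hsum 1 one_pos) (hexp h (-b) k d hki d1)
        have b2 := uniq_bd (fun ν => hC ν (h + k : ℕ) (-b + d) k d) (hsum 1 one_pos) (hexp (h + k : ℕ) (-b + d) k d hki d2)
        refine ((b1.const_mul_left (ec (A / M))).sub b2).congr' ?_ Filter.EventuallyEq.rfl
        filter_upwards [tendsto_im.eventually_ge_atTop 1] with t ht
        have hne : ((k : ℤ) * t + d : ℂ) ≠ 0 := fun h => by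
          have := congrArg Complex.im h
          simp at this
          rcases this with h | h
          · omega
          · linarith
        have e1 : (((h + k : ℕ) : ℤ) * t + ((-b + d : ℤ) : ℂ)) / ((k : ℤ) * t + d) =
            ((h : ℤ) * t + ((-b : ℤ) : ℂ)) / ((k : ℤ) * t + d) + 1 := by
          rw [div_add_one hne]; congr 1; push_cast; ring
        rw [e1, GG_one, mul_add (A / M : ℂ), mul_one, ec_add, hmu1, ← hmuc]
        ring
      · rw [hpU _ _ _ _ h0, hpU _ _ _ _ (by rw [hmu1]; exact h0), mul_zero]
    rw [hv _ _ _ _ hk d1, hv _ _ _ _ hk d2, hmu1, ← mul_assoc] at hpp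
    rw [mul_right_cancel₀ (ec_ne_zero _) hpp, show (-(A * (h + k : ℕ) : ℂ) / (M * k)) = -(A * h : ℂ) / (M * k) - A / M by
      push_cast; field_simp; ring, ec_sub]
    have := ec_ne_zero (A / M)
    field_simp
  refine ⟨⟨M, A, hM0, by exact_mod_cast hA0, GG J m r δ n, fun t ht => ?_, GG_one J m r δ n, p, c, mu, vv J m r δ ℏ, U,
    ∑ x ∈ R4, ‖p0 x.1 x.2.1 x.2.2.1 x.2.2.2‖, C, fun h b k d => by simp only [p, Int.emod_emod],
    fun ν h b k d => by simp only [c, Int.emod_emod], hmuM, fun h b k d =>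
    single_le_sum (f := fun x : ℤ × ℤ × ℤ × ℤ => ‖p0 x.1 x.2.1 x.2.2.1 x.2.2.2‖) (fun _ _ => norm_nonneg _) (hR4 h b k d), hC, hsum,
    fun μ hμ => (mem_filter.mp hμ).2, fun h b k d hh => hpU _ _ _ _ (fun hx => hh ((hUm h k).mpr hx)), hexp, hv, hmu1, hv1⟩,
    rfl, hAM, fun h k => ?_, rfl, fun h k => hUm h k, hlM⟩
  · have h1 : GG J m r δ n = fun τ => FF J m r δ τ * ec (-(((n + OmegaC J m r δ / 24 : ℝ) : ℂ) * τ)) := funext fun τ => by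
      rw [← FF_GG hm hrm n, mul_assoc, ← ec_add, add_neg_cancel, ec_zero, mul_one]
    rw [h1]
    exact (differentiableAt_FF hr hrm ht).continuousAt.mul (continuous_ec.comp (by fun_prop)).continuousAt
  · rw [← Dc_eq r δ hm]; exact hmuR h k

lemma resS_bd {a b : ℝ} (ha : 0 ≤ a) (hb : 0 ≤ b) : ‖resS a b‖ ≤ b * Real.exp (a * b) := by
  have h : HasSum (fun j : ℕ => (a * b) ^ j / j.factorial) (Real.exp (a * b)) := by
    rw [Real.exp_eq_exp_ℝ]; exact NormedSpace.expSeries_div_hasSum_exp _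
  refine tsum_of_norm_bounded (h.mul_left b) fun j => ?_
  have e : (a : ℂ) ^ j * (b : ℂ) ^ (j + 1) / (j.factorial * (j + 1).factorial) =
      ((a ^ j * b ^ (j + 1) / (j.factorial * (j + 1).factorial) : ℝ) : ℂ) := by push_cast; rfl
  rw [e, Complex.norm_of_nonneg (by positivity), mul_pow, pow_succ b, ← mul_div_assoc,
    show a ^ j * (b ^ j * b) = b * (a ^ j * b ^ j) by ring]
  have h1 : (1 : ℝ) ≤ (j + 1).factorial := by exact_mod_cast (j + 1).factorial_pos
  have h0 : (0 : ℝ) < j.factorial := by exact_mod_cast j.factorial_pos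
  gcongr
  exact le_mul_of_one_le_right h0.le h1

lemma resS_bessel {X Δ : ℝ} (hX : 0 < X) (hΔ : 0 < Δ) {k : ℕ} (hk : 0 < k) :
    resS ((2 * π * (X / 24) : ℝ) : ℂ) ((2 * π * (Δ / 24 / k ^ 2) : ℝ) : ℂ) =
      (((X / Δ) ^ (-(1 : ℝ) / 2) : ℝ) : ℂ) * ((1 / (k : ℂ)) *
        ((besselImin1 (π / (6 * (k : ℝ)) * Real.sqrt (Δ * X)) : ℝ) : ℂ)) := by
  have hk' : (0 : ℝ) < k := by exact_mod_cast hk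
  rw [resS, besselImin1]
  have e : (1 / (k : ℂ)) = ((1 / k : ℝ) : ℂ) := by push_cast; rfl
  rw [e, ← ofReal_mul, ← ofReal_mul, ← tsum_mul_left, ← tsum_mul_left, ofReal_tsum]
  refine tsum_congr fun j => ?_
  set s := π / (6 * (k : ℝ)) * Real.sqrt (Δ * X) / 2 with hs
  have hs2 : s ^ 2 = (2 * π * (X / 24)) * (2 * π * (Δ / 24 / k ^ 2)) := by
    have := Real.sq_sqrt (mul_pos hΔ hX).le
    rw [hs, div_pow, mul_pow, this]; field_simp; ring
  have hs1 : (X / Δ) ^ (-(1 : ℝ) / 2) * (1 / k * s) = 2 * π * (Δ / 24 / k ^ 2) := by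
    rw [neg_div, Real.rpow_neg (by positivity), ← Real.sqrt_eq_rpow, Real.sqrt_div hX.le, hs, Real.sqrt_mul hΔ.le]
    have h1 := Real.sq_sqrt hΔ.le
    have h2 := Real.sqrt_pos.mpr hX
    have h3 := Real.sqrt_pos.mpr hΔ
    field_simp
    rw [h1]; ring
  have : (X / Δ) ^ (-(1 : ℝ) / 2) * (1 / k * (s ^ (2 * j + 1) / (j.factorial * (j + 1).factorial))) =
      (2 * π * (X / 24)) ^ j * (2 * π * (Δ / 24 / k ^ 2)) ^ (j + 1) / (j.factorial * (j + 1).factorial) := by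
    rw [pow_succ s, pow_mul, hs2, mul_pow, pow_succ (2 * π * (Δ / 24 / k ^ 2)), ← hs1]; ring
  rw [this]; push_cast; rfl

section
variable {J : ℕ} {m r : Fin J → ℕ} {δ : Fin J → ℤ} {ℏ : Fin J → ℕ → ℕ → ℤ} {n : ℕ}

lemma vh_eq {D : CD} (hA : (D.A / D.M : ℝ) = n + OmegaC J m r δ / 24) (hv : D.v = vv J m r δ ℏ) {h k : ℕ} (hk : 0 < k)
    (hΔ : 0 < DeltaC J m r δ h k) : D.vh k h = I ^ (∑ j, δ j) * if Nat.gcd h k = 1 then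
      exp (-2 * (π : ℂ) * I * (n : ℂ) * (h : ℂ) / (k : ℂ)) *
        (-1 : ℂ) ^ (∑ j, δ j * lamF (m j) (r j) h k) *
        (omegaC J m δ h k) ^ 2 * DC J m r δ (fun j => ℏ j h k) h k *
        PiC J m r δ (fun j => ℏ j h k) h k
    else 0 := by
  rw [CD.vh]
  split_ifs with hg
  · have hA' : (D.A / D.M : ℂ) = n + OmegaC J m r δ / 24 := by
      have := congrArg Complex.ofReal hA
      push_cast at this; exact this
    have e1 : exp (-2 * (π : ℂ) * I * (n : ℂ) * (h : ℂ) / (k : ℂ)) =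
        ec ((OmegaC J m r δ : ℝ) * h / (24 * k)) * ec (-(D.A * h : ℂ) / (D.M * k)) := by
      rw [← ec_add, neg_div, mul_div_mul_comm (D.A : ℂ), hA', ec]; congr 1; push_cast; ring
    rw [hv, vv, if_pos hΔ, e1]; ring
  · simp

lemma Delta_kl (hm : ∀ j, 0 < m j) {ℓ κ h : ℕ} (hh : h % ℓ = κ) (t : ℕ) :
    DeltaC J m r δ h (ℓ + t * univ.lcm m) = DeltaC J m r δ κ ℓ := by
  rw [Delta_cl r δ hm (l := ℓ) (by simp [Nat.ModEq]) h, hh]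

lemma class_eq (hm : ∀ j, 0 < m j) {D : CD} (hA : (D.A / D.M : ℝ) = n + OmegaC J m r δ / 24) (hv : D.v = vv J m r δ ℏ)
    (hmu : ∀ h k : ℕ, (D.mu h k : ℝ) = D.M * (DeltaC J m r δ h k / 24))
    {ℓ κ : ℕ} (hℓ : 0 < ℓ) (hκ : κ < ℓ) (hΔ : 0 < DeltaC J m r δ κ ℓ) (t : ℕ) :
    2 * (π : ℂ) * I ^ (∑ j, δ j) *
      (((((24 * (n : ℝ) + OmegaC J m r δ) / DeltaC J m r δ κ ℓ) ^ (-(1 : ℝ) / 2) : ℝ) : ℂ) *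
       kTerm J m r δ ℏ n κ ℓ (ℓ + t * univ.lcm m)) =
    (∑ h ∈ range (ℓ + t * univ.lcm m), if h % ℓ = κ then D.vh (ℓ + t * univ.lcm m) h else 0) *
      (2 * π * resS D.aa (D.bb (ℓ + t * univ.lcm m) (D.mu κ ℓ))) := by
  set k := ℓ + t * univ.lcm m with hkd
  have hk : 0 < k := by omega
  have hMR : (0 : ℝ) < D.M := by exact_mod_cast D.hM
  have hX : 0 < 24 * (n : ℝ) + OmegaC J m r δ := by
    have : (0 : ℝ) < D.A / D.M := div_pos (by exact_mod_cast D.hA) hMR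
    linarith
  have ha : D.aa = 2 * π * ((24 * (n : ℝ) + OmegaC J m r δ) / 24) := by rw [CD.aa, hA]; ring
  have hb : D.bb k (D.mu κ ℓ) = 2 * π * (DeltaC J m r δ κ ℓ / 24 / k ^ 2) := by
    rw [CD.bb, hmu, mul_div_mul_left _ _ hMR.ne']
  rw [ha, hb, resS_bessel hX hΔ hk, kTerm]
  have : ∑ h ∈ range k, (if h % ℓ = κ then D.vh k h else 0) = I ^ (∑ j, δ j) * innerH J m r δ ℏ n κ ℓ k := by
    rw [innerH, mul_sum]
    refine sum_congr rfl fun h _ => ?_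
    rw [Nat.mod_eq_of_lt hκ]
    by_cases hh : h % ℓ = κ
    · rw [if_pos hh, vh_eq hA hv hk (by rw [hkd, Delta_kl hm hh]; exact hΔ)]
      simp only [hh, and_true]
    · simp [hh]
  rw [this]; ring

lemma class_summable (hm : ∀ j, 0 < m j) {D : CD} (hA : (D.A / D.M : ℝ) = n + OmegaC J m r δ / 24) (hv : D.v = vv J m r δ ℏ)
    (hmu : ∀ h k : ℕ, (D.mu h k : ℝ) = D.M * (DeltaC J m r δ h k / 24))
    {ℓ κ : ℕ} (hℓ : 0 < ℓ) (hκ : κ < ℓ) (hΔ : 0 < DeltaC J m r δ κ ℓ) (hlM : ℓ ∣ D.M) :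
    Summable (fun t : ℕ => kTerm J m r δ ℏ n κ ℓ (ℓ + t * univ.lcm m)) := by
  have hMR : (0 : ℝ) < D.M := by exact_mod_cast D.hM
  have hμR : (0 : ℝ) < D.mu κ ℓ := by rw [hmu]; positivity
  have hμ : 0 < D.mu κ ℓ := by exact_mod_cast hμR
  obtain ⟨B, hB⟩ := D.V_cl (D.mu κ ℓ) hμ.ne'
  have hX : 0 < 24 * (n : ℝ) + OmegaC J m r δ := by
    have : (0 : ℝ) < D.A / D.M := div_pos (by exact_mod_cast D.hA) hMR
    linarith
  have hc0 : 2 * (π : ℂ) * I ^ (∑ j, δ j) *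
      ((((24 * (n : ℝ) + OmegaC J m r δ) / DeltaC J m r δ κ ℓ) ^ (-(1 : ℝ) / 2) : ℝ) : ℂ) ≠ 0 := by
    refine mul_ne_zero (mul_ne_zero (by simp [Real.pi_ne_zero]) (zpow_ne_zero _ I_ne_zero)) ?_
    exact_mod_cast (Real.rpow_pos_of_pos (div_pos hX hΔ) _).ne'
  rw [← summable_mul_left_iff hc0]
  simp only [mul_assoc _ _ (kTerm _ _ _ _ _ _ _ _ _)]
  simp only [class_eq hm hA hv hmu hℓ hκ hΔ]
  have haa : 0 ≤ D.aa := by rw [CD.aa]; positivity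
  set E := 2 * π * (D.mu κ ℓ / D.M) with hE
  have hE0 : 0 ≤ E := by positivity
  have hL := lcm_pos' hm
  have hB0 : 0 ≤ B := by
    have := (norm_nonneg _).trans (hB 1 one_pos (fun _ => False) (fun _ => Iff.rfl) (fun _ h => h.elim))
    simpa using this
  refine Summable.of_norm_bounded (g := fun t : ℕ => B * (2 * π * (E * Real.exp (D.aa * E))) * ((t + 1 : ℕ) : ℝ) ^ (-(49 / 48 : ℝ))) ?_ fun t => ?_
  · exact ((summable_nat_add_iff 1).mpr (Real.summable_nat_rpow.mpr (by norm_num))).mul_left _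
  set k := ℓ + t * univ.lcm m with hkd
  have htk : t + 1 ≤ k := by nlinarith
  have hk : 0 < k := by omega
  have hkR : (1 : ℝ) ≤ k := by exact_mod_cast hk
  have hb : D.bb k (D.mu κ ℓ) = E / k ^ 2 := by rw [CD.bb, hE]; field_simp
  have hbE : E / k ^ 2 ≤ E := div_le_self hE0 (one_le_pow₀ hkR)
  have h1 : ‖resS D.aa (D.bb k (D.mu κ ℓ))‖ ≤ E / k ^ 2 * Real.exp (D.aa * E) := by
    rw [hb]
    refine (resS_bd haa (by positivity)).trans ?_
    gcongr
  have hnat : ∀ h : ℤ, h % ℓ = κ → D.mu h k = D.mu κ ℓ := fun h hh => by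
    have e0 : 0 ≤ h % D.M := Int.emod_nonneg _ (by have := D.hM; omega)
    obtain ⟨h', hh'⟩ := Int.eq_ofNat_of_zero_le e0
    have e1 : D.mu h k = D.mu h' k := by
      rw [D.hmu h, D.hmu h', ← hh', Int.emod_emod]
    have e2 : h' % ℓ = κ := by
      have : (h' : ℤ) % ℓ = κ := by rw [← hh', Int.emod_emod_of_dvd _ (by exact_mod_cast hlM), hh]
      exact_mod_cast this
    rw [e1]
    have := hmu h' k
    rw [hkd, Delta_kl hm e2, ← hmu] at this
    exact_mod_cast this
  have h2 := hB k hk (fun h => h % ℓ = κ) (fun h => by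
    rw [Int.emod_emod_of_dvd _ (by exact_mod_cast hlM)]) hnat
  have h3 : (∑ h ∈ range k, if h % ℓ = κ then D.vh k h else 0) = ∑ h ∈ range k, if (h : ℤ) % ℓ = κ then D.vh k h else 0 :=
    sum_congr rfl fun h _ => if_congr (by norm_cast) rfl rfl
  rw [h3, norm_mul, norm_mul (2 * (π : ℂ))]
  have h4 : ‖(2 * π : ℂ)‖ = 2 * π := by simp [abs_of_pos Real.pi_pos]
  rw [h4]
  calc _ ≤ (B * (k : ℝ) ^ ((47 : ℝ) / 48)) * (2 * π * (E / k ^ 2 * Real.exp (D.aa * E))) := by gcongr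
    _ = B * (2 * π * (E * Real.exp (D.aa * E))) * (k : ℝ) ^ (-(49 / 48 : ℝ)) := by
      rw [show (-(49 / 48 : ℝ)) = 47 / 48 - (2 : ℕ) by norm_num, Real.rpow_sub_natCast (by positivity)]; ring
    _ ≤ _ := by
      refine mul_le_mul_of_nonneg_left ?_ (by positivity)
      exact Real.rpow_le_rpow_of_nonpos (by positivity) (by exact_mod_cast htk) (by norm_num)

lemma sum_blocks {E : Type*} [AddCommMonoid E] (f : ℕ → E) (L T : ℕ) :
    ∑ k ∈ Icc 1 (T * L), f k = ∑ t ∈ range T, ∑ ℓ ∈ Icc 1 L, f (ℓ + t * L) := by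
  rw [CD.sum_Icc_range]
  induction T with
  | zero => simp
  | succ T ih =>
    rw [sum_range_succ, ← ih, Nat.succ_mul, sum_range_add, CD.sum_Icc_range]
    congr 1
    exact sum_congr rfl fun i _ => by congr 1; ring

end

theorem main_asymptotic_formula (J : ℕ) (hJ : 1 ≤ J) (m r : Fin J → ℕ) (δ : Fin J → ℤ)
    (hm : ∀ j, 0 < m j) (hr : ∀ j, 1 ≤ r j) (hrm : ∀ j, r j < m j) (hδ : ∀ j, δ j ≠ 0)
    (ℏ : Fin J → ℕ → ℕ → ℤ)
    (hℏ : ∀ j h k, 0 < k → Nat.gcd h k = 1 →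
      ℏ j h k * (((m j / Nat.gcd (m j) k) * h : ℕ) : ℤ) ≡ -1
        [ZMOD ((k / Nat.gcd (m j) k : ℕ) : ℤ)])
    (g : ℕ → ℂ)
    (hg : ∀ q : ℂ, ‖q‖ < 1 → HasSum (fun n : ℕ => g n * q ^ n)
      (∏ j, (∏' k : ℕ, (1 - q ^ (r j + m j * k)) * (1 - q ^ (m j * (k + 1) - r j))) ^ (δ j)))
    (hassump : ∀ ℓ ∈ Finset.Icc 1 (Finset.univ.lcm m), ∀ κ ∈ Finset.range ℓ, ∀ j,
      ((ups (lamStar (m j) (r j) κ ℓ) : ℚ) : ℝ) * (Nat.gcd (m j) ℓ : ℝ) ^ 2 / (m j : ℝ)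
        ≥ DeltaC J m r δ κ ℓ / 24)
    (n : ℕ) (hn : 0 < n) (hn' : (n : ℝ) > -(OmegaC J m r δ) / 24) :
    (∀ ℓ ∈ Finset.Icc 1 (Finset.univ.lcm m), ∀ κ ∈ Finset.range ℓ,
      0 < DeltaC J m r δ κ ℓ →
      Summable (fun t : ℕ => kTerm J m r δ ℏ n κ ℓ (ℓ + t * Finset.univ.lcm m))) ∧
    g n = 2 * (Real.pi : ℂ) * Complex.I ^ (∑ j, δ j) *
      ∑ ℓ ∈ Finset.Icc 1 (Finset.univ.lcm m), ∑ κ ∈ Finset.range ℓ,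
        if 0 < DeltaC J m r δ κ ℓ then
          ((((24 * (n : ℝ) + OmegaC J m r δ) / DeltaC J m r δ κ ℓ) ^ (-(1 : ℝ) / 2) : ℝ) : ℂ) *
            ∑' t : ℕ, kTerm J m r δ ℏ n κ ℓ (ℓ + t * Finset.univ.lcm m)
        else 0 := by
  obtain ⟨D, hG, hA, hmu, hv, hU, hlM⟩ := exists_CD hm hr hrm hℏ hassump hn'
  have hMR : (0 : ℝ) < D.M := by exact_mod_cast D.hM
  have hS : ∀ ℓ ∈ Finset.Icc 1 (univ.lcm m), ∀ κ ∈ range ℓ,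
      0 < DeltaC J m r δ κ ℓ →
      Summable (fun t : ℕ => kTerm J m r δ ℏ n κ ℓ (ℓ + t * univ.lcm m)) := fun ℓ hℓ κ hκ hΔ =>
    class_summable hm hA hv hmu (mem_Icc.mp hℓ).1 (mem_range.mp hκ) hΔ (hlM ℓ hℓ)
  refine ⟨hS, ?_⟩
  have hT := (D.main_tendsto (g := g n) (fun y hy => by rw [hG]; exact GG_int hg n hy)).comp
    (Filter.tendsto_id.atTop_mul_const' (lcm_pos' hm))
  refine tendsto_nhds_unique hT ?_
  rw [mul_sum]
  simp_rw [mul_sum]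
  have hlim : Filter.Tendsto (fun T : ℕ => ∑ ℓ ∈ Finset.Icc 1 (univ.lcm m), ∑ κ ∈ range ℓ, ∑ t ∈ range T,
      2 * (π : ℂ) * I ^ (∑ j, δ j) * if 0 < DeltaC J m r δ κ ℓ then
          ((((24 * (n : ℝ) + OmegaC J m r δ) / DeltaC J m r δ κ ℓ) ^ (-(1 : ℝ) / 2) : ℝ) : ℂ) *
            kTerm J m r δ ℏ n κ ℓ (ℓ + t * univ.lcm m) else 0) Filter.atTop
      (nhds (∑ ℓ ∈ Finset.Icc 1 (univ.lcm m), ∑ κ ∈ range ℓ,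
        2 * (π : ℂ) * I ^ (∑ j, δ j) * if 0 < DeltaC J m r δ κ ℓ then
          ((((24 * (n : ℝ) + OmegaC J m r δ) / DeltaC J m r δ κ ℓ) ^ (-(1 : ℝ) / 2) : ℝ) : ℂ) *
            ∑' t : ℕ, kTerm J m r δ ℏ n κ ℓ (ℓ + t * univ.lcm m)
        else 0)) := by
    refine tendsto_finsetSum _ fun ℓ hℓ => tendsto_finsetSum _ fun κ hκ => ?_
    by_cases hΔ : 0 < DeltaC J m r δ κ ℓ
    · simp only [if_pos hΔ]
      exact (((hS ℓ hℓ κ hκ hΔ).hasSum.mul_left _).mul_left _).tendsto_sum_nat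
    · simp [if_neg hΔ]
  refine hlim.congr fun T => ?_
  simp only [Function.comp_apply, id]
  rw [sum_blocks, sum_comm]
  refine sum_congr rfl fun ℓ hℓ => ?_
  rw [sum_comm]
  refine sum_congr rfl fun t _ => ?_
  have hℓ0 : 0 < ℓ := (mem_Icc.mp hℓ).1
  set k := ℓ + t * univ.lcm m with hkd
  have e1 : ∀ F : ℕ → ℂ, ∑ h ∈ range k, F h = ∑ κ ∈ range ℓ, ∑ h ∈ range k, if h % ℓ = κ then F h else 0 := fun F => by
    rw [sum_comm]
    refine sum_congr rfl fun h _ => ?_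
    rw [sum_ite_eq, if_pos (mem_range.mpr (Nat.mod_lt _ hℓ0))]
  rw [e1]
  refine sum_congr rfl fun κ hκ => ?_
  have hmk : ∀ h, h % ℓ = κ → D.mu h k = D.mu κ ℓ := fun h hh => by
    have := hmu h k
    rw [hkd, Delta_kl hm hh, ← hmu] at this
    exact_mod_cast this
  by_cases hΔ : 0 < DeltaC J m r δ κ ℓ
  · rw [if_pos hΔ, class_eq hm hA hv hmu hℓ0 (mem_range.mp hκ) hΔ, sum_mul]
    refine sum_congr rfl fun h _ => ?_
    by_cases hh : h % ℓ = κ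
    · rw [if_pos hh, if_pos hh, hmk h hh, if_pos]
      have h2 : (0 : ℝ) < D.mu κ ℓ := by rw [hmu]; positivity
      exact (hU _ _).mpr (by exact_mod_cast h2)
    · rw [if_neg hh, if_neg hh, zero_mul]
  · rw [if_neg hΔ, mul_zero]
    symm
    refine sum_eq_zero fun h _ => ?_
    by_cases hh : h % ℓ = κ
    · rw [if_pos hh, hmk h hh, if_neg]
      rw [hU]
      intro h2
      have h3 : (0 : ℝ) < D.mu κ ℓ := by exact_mod_cast h2
      rw [hmu] at h3
      have := (mul_pos_iff_of_pos_left hMR).mp h3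
      exact hΔ (by linarith)
    · rw [if_neg hh]
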